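/- Let Ω ⊆ ℂⁿ be a pseudoconvex open set and let φ: Ω → ℝ be a C², nonnegative, plurisubharmonic function satisfying i∂∂̄φ ≥ δβ for some δ > 0, and set E = {z ∈ Ω : φ(z) = 0}. Then every continuous function on E can be approximated uniformly on compact subsets of E by functions holomorphic in Ω: for every continuous g: E → ℂ, every compact K ⊆ E, and every ε > 0, there exists a holomorphic function h on Ω with sup_{z ∈ K} |g(z) − h(z)| < ε. -/

import Mathlib

open MeasureTheory Complex Metric Set
open scoped ComplexConjugate

noncomputable section

/-- `ℂⁿ` with the Euclidean norm. -/
abbrev Cn (n : ℕ) := EuclideanSpace ℂ (Fin n)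

variable {n : ℕ}

instance : MeasurableSpace (Cn n) := borel _
instance : BorelSpace (Cn n) := ⟨rfl⟩

/-- The Levi form of `φ` at `z` applied to `w`:
`L_φ(z; w) = ¼ (D²φ(z)[w,w] + D²φ(z)[iw,iw])` where `D²φ` is the second real Fréchet
derivative. -/
def LeviForm (φ : Cn n → ℝ) (z w : Cn n) : ℝ :=
  (1 / 4) * (fderiv ℝ (fderiv ℝ φ) z w w +
    fderiv ℝ (fderiv ℝ φ) z (Complex.I • w) (Complex.I • w))

/-- `Ω` is pseudoconvex: it admits a `C²` exhaustion function with nonnegative Levi form. -/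
def Pseudoconvex (Ω : Set (Cn n)) : Prop :=
  ∃ ρ : Cn n → ℝ, ContDiffOn ℝ 2 ρ Ω ∧
    (∀ c : ℝ, IsCompact {z ∈ Ω | ρ z ≤ c}) ∧
    ∀ z ∈ Ω, ∀ w : Cn n, 0 ≤ LeviForm ρ z w

/-- The `j`-th standard basis vector of `ℂⁿ`. -/
def e (n : ℕ) (j : Fin n) : Cn n := EuclideanSpace.single j (1 : ℂ)

/-- The components of `∂̄v`: `(∂̄v)_j = ½(∂v/∂x_j + i ∂v/∂y_j)`. -/
def dbar (v : Cn n → ℂ) (z : Cn n) (j : Fin n) : ℂ :=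
  (1 / 2) * (fderiv ℝ v z (e n j) + Complex.I * fderiv ℝ v z (Complex.I • e n j))

/-- The pointwise squared norm `|f(z)|² = Σ_j |f_j(z)|²` of a `(0,1)`-form. -/
def formNormSq (f : Cn n → Fin n → ℂ) (z : Cn n) : ℝ := ∑ j, ‖f z j‖ ^ 2

/-- A `(0,1)`-form `f` is smooth on `Ω` if each component is. -/
def SmoothFormOn (Ω : Set (Cn n)) (f : Cn n → Fin n → ℂ) : Prop :=
  ∀ j, ContDiffOn ℝ (⊤ : ℕ∞) (fun z => f z j) Ω

/-- A `(0,1)`-form `f` is `∂̄`-closed on `Ω` if `(∂̄f_j)_k = (∂̄f_k)_j` on `Ω`. -/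
def DbarClosedOn (Ω : Set (Cn n)) (f : Cn n → Fin n → ℂ) : Prop :=
  ∀ z ∈ Ω, ∀ j k : Fin n, dbar (fun w => f w j) z k = dbar (fun w => f w k) z j

/-- `v` belongs to the weighted space `L²(Ω, e^{-w})`. -/
def MemL2 (Ω : Set (Cn n)) (w : Cn n → ℝ) (v : Cn n → ℂ) : Prop :=
  AEStronglyMeasurable v (volume.restrict Ω) ∧
  IntegrableOn (fun z => ‖v z‖ ^ 2 * Real.exp (-w z)) Ω volume

/-- `v` is orthogonal to every holomorphic function in `L²(Ω, e^{-w})`. -/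
def OrthToHolo (Ω : Set (Cn n)) (w : Cn n → ℝ) (v : Cn n → ℂ) : Prop :=
  ∀ h : Cn n → ℂ, DifferentiableOn ℂ h Ω → MemL2 Ω w h →
    ∫ z in Ω, v z * conj (h z) * (Real.exp (-w z) : ℂ) = 0

/-- `ψ` is a test function on `Ω`. -/
def IsTestOn (Ω : Set (Cn n)) (ψ : Cn n → ℂ) : Prop :=
  ContDiff ℝ (⊤ : ℕ∞) ψ ∧ HasCompactSupport ψ ∧ tsupport ψ ⊆ Ω

/-- `∂̄v = f` on `Ω` in the sense of distributions. -/
def DbarEqOn (Ω : Set (Cn n)) (v : Cn n → ℂ) (f : Cn n → Fin n → ℂ) : Prop :=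
  ∀ ψ : Cn n → ℂ, IsTestOn Ω ψ → ∀ j : Fin n,
    ∫ z in Ω, v z * dbar ψ z j = -∫ z in Ω, f z j * ψ z

/-- `v` is the `L²(Ω, e^{-w})`-minimal solution of `∂̄v = f`: it solves the equation in the
sense of distributions and is orthogonal to all holomorphic functions in `L²(Ω, e^{-w})`. -/
def MinimalSolution (Ω : Set (Cn n)) (w : Cn n → ℝ) (f : Cn n → Fin n → ℂ) (v : Cn n → ℂ) :
    Prop :=
  MemL2 Ω w v ∧ DbarEqOn Ω v f ∧ OrthToHolo Ω w v

/-! ### Wirtinger derivatives -/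

/-- The components of `∂v`. -/
def del (v : Cn n → ℂ) (z : Cn n) (j : Fin n) : ℂ :=
  (1 / 2) * (fderiv ℝ v z (e n j) - Complex.I * fderiv ℝ v z (Complex.I • e n j))

/-- `C^k` functions on `ℂⁿ` with compact support inside `Ω`. -/
structure CcOn (Ω : Set (Cn n)) (k : WithTop ℕ∞) (v : Cn n → ℂ) : Prop where
  contDiff : ContDiff ℝ k v
  compact : HasCompactSupport v
  subset : tsupport v ⊆ Ω

lemma del_mul {a b : Cn n → ℂ} {z : Cn n} (ha : DifferentiableAt ℝ a z)
    (hb : DifferentiableAt ℝ b z) (j : Fin n) :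
    del (fun w => a w * b w) z j = del a z j * b z + a z * del b z j := by
  simp only [del, fderiv_fun_mul ha hb, add_apply,
    smul_apply, smul_eq_mul]
  ring

lemma dbar_mul {a b : Cn n → ℂ} {z : Cn n} (ha : DifferentiableAt ℝ a z)
    (hb : DifferentiableAt ℝ b z) (j : Fin n) :
    dbar (fun w => a w * b w) z j = dbar a z j * b z + a z * dbar b z j := by
  simp only [dbar, fderiv_fun_mul ha hb, add_apply,
    smul_apply, smul_eq_mul]
  ring

lemma del_add {a b : Cn n → ℂ} {z : Cn n} (ha : DifferentiableAt ℝ a z)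
    (hb : DifferentiableAt ℝ b z) (j : Fin n) :
    del (fun w => a w + b w) z j = del a z j + del b z j := by
  simp only [del, fderiv_fun_add ha hb, add_apply]
  ring

lemma dbar_add {a b : Cn n → ℂ} {z : Cn n} (ha : DifferentiableAt ℝ a z)
    (hb : DifferentiableAt ℝ b z) (j : Fin n) :
    dbar (fun w => a w + b w) z j = dbar a z j + dbar b z j := by
  simp only [dbar, fderiv_fun_add ha hb, add_apply]
  ring

lemma dbar_sub {a b : Cn n → ℂ} {z : Cn n} (ha : DifferentiableAt ℝ a z)
    (hb : DifferentiableAt ℝ b z) (j : Fin n) :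
    dbar (fun w => a w - b w) z j = dbar a z j - dbar b z j := by
  simp only [dbar, fderiv_fun_sub ha hb, sub_apply]
  ring

lemma fderiv_conj_apply {a : Cn n → ℂ} {z : Cn n} (v : Cn n) :
    fderiv ℝ (fun w => conj (a w)) z v = conj (fderiv ℝ a z v) := by
  have := (Complex.conjCLE : ℂ ≃L[ℝ] ℂ).comp_fderiv (f := a) (x := z)
  have h2 : (fun w => conj (a w)) = (Complex.conjCLE : ℂ ≃L[ℝ] ℂ) ∘ a := by
    ext w; simp
  rw [h2, this]; simp

lemma conj_dbar (a : Cn n → ℂ) (z : Cn n) (j : Fin n) :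
    conj (dbar a z j) = del (fun w => conj (a w)) z j := by
  simp only [del, dbar, fderiv_conj_apply, map_mul, map_add, Complex.conj_I, map_div₀, map_one,
    map_ofNat]
  ring

lemma conj_del (a : Cn n → ℂ) (z : Cn n) (j : Fin n) :
    conj (del a z j) = dbar (fun w => conj (a w)) z j := by
  simp only [del, dbar, fderiv_conj_apply, map_mul, map_sub, Complex.conj_I, map_div₀, map_one,
    map_ofNat]
  ring

lemma conj_dbar_real (a : Cn n → ℝ) (z : Cn n) (j : Fin n) :
    conj (dbar (fun w => (a w : ℂ)) z j) = del (fun w => (a w : ℂ)) z j := by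
  simp [conj_dbar]

lemma del_congr {a b : Cn n → ℂ} {z : Cn n} (h : a =ᶠ[nhds z] b) (j : Fin n) :
    del a z j = del b z j := by
  simp only [del, h.fderiv_eq]

lemma dbar_congr {a b : Cn n → ℂ} {z : Cn n} (h : a =ᶠ[nhds z] b) (j : Fin n) :
    dbar a z j = dbar b z j := by
  simp only [dbar, h.fderiv_eq]

lemma del_const (c : ℂ) (z : Cn n) (j : Fin n) : del (fun _ => c) z j = 0 := by
  simp [del]

lemma dbar_const (c : ℂ) (z : Cn n) (j : Fin n) : dbar (fun _ => c) z j = 0 := by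
  simp [dbar]

lemma del_const_mul (c : ℂ) {a : Cn n → ℂ} {z : Cn n} (ha : DifferentiableAt ℝ a z) (j : Fin n) :
    del (fun w => c * a w) z j = c * del a z j := by
  rw [del_mul (differentiableAt_const c) ha, del_const]; ring

lemma dbar_const_mul (c : ℂ) {a : Cn n → ℂ} {z : Cn n} (ha : DifferentiableAt ℝ a z)
    (j : Fin n) : dbar (fun w => c * a w) z j = c * dbar a z j := by
  rw [dbar_mul (differentiableAt_const c) ha, dbar_const]; ring

lemma fderiv_comp_neg_translate (a : Cn n → ℂ) (x t v : Cn n) :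
    fderiv ℝ (fun s => a (x - s)) t v = -fderiv ℝ a (x - t) v := by
  have h : (fun s => a (x - s)) = (fun s => a (x + s)) ∘ (fun s => -s) := by
    ext s; simp [sub_eq_add_neg]
  have h2 : fderiv ℝ (fun s => a (x - s)) t = -fderiv ℝ (fun s => a (x + s)) (-t) := by
    have := (ContinuousLinearEquiv.neg ℝ : Cn n ≃L[ℝ] Cn n).comp_right_fderiv
      (f := fun s => a (x + s)) (x := t)
    rw [h]
    ext w
    simpa [Function.comp_def, sub_eq_add_neg] using congrArg (fun L => L w) this
  rw [h2, fderiv_comp_add_left]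
  simp [sub_eq_add_neg]

lemma del_translate (a : Cn n → ℂ) (x t : Cn n) (j : Fin n) :
    del (fun s => a (x - s)) t j = -del a (x - t) j := by
  simp only [del, fderiv_comp_neg_translate]; ring

lemma dbar_translate (a : Cn n → ℂ) (x t : Cn n) (j : Fin n) :
    dbar (fun s => a (x - s)) t j = -dbar a (x - t) j := by
  simp only [dbar, fderiv_comp_neg_translate]; ring

/-- The functional extracting `∂v/∂z_j` from the real derivative. -/
def delL (j : Fin n) : (Cn n →L[ℝ] ℂ) →L[ℝ] ℂ :=
  (1 / 2 : ℂ) • (ContinuousLinearMap.apply ℝ ℂ (e n j) -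
    Complex.I • ContinuousLinearMap.apply ℝ ℂ (Complex.I • e n j))

/-- The functional extracting `∂v/∂z̄_j` from the real derivative. -/
def dbarL (j : Fin n) : (Cn n →L[ℝ] ℂ) →L[ℝ] ℂ :=
  (1 / 2 : ℂ) • (ContinuousLinearMap.apply ℝ ℂ (e n j) +
    Complex.I • ContinuousLinearMap.apply ℝ ℂ (Complex.I • e n j))

lemma del_eq (a : Cn n → ℂ) (j : Fin n) : (fun z => del a z j) = fun z => delL j (fderiv ℝ a z) := by
  ext z; simp [del, delL, mul_sub]

lemma dbar_eq (a : Cn n → ℂ) (j : Fin n) :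
    (fun z => dbar a z j) = fun z => dbarL j (fderiv ℝ a z) := by
  ext z; simp [dbar, dbarL, mul_add]

lemma contDiffOn_del {Ω : Set (Cn n)} (hΩ : IsOpen Ω) {a : Cn n → ℂ} {k l : WithTop ℕ∞}
    (ha : ContDiffOn ℝ k a Ω) (hkl : l + 1 ≤ k) (j : Fin n) :
    ContDiffOn ℝ l (fun z => del a z j) Ω := by
  rw [del_eq]
  exact (delL j).contDiff.comp_contDiffOn (ha.fderiv_of_isOpen hΩ hkl)

lemma contDiffOn_dbar {Ω : Set (Cn n)} (hΩ : IsOpen Ω) {a : Cn n → ℂ} {k l : WithTop ℕ∞}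
    (ha : ContDiffOn ℝ k a Ω) (hkl : l + 1 ≤ k) (j : Fin n) :
    ContDiffOn ℝ l (fun z => dbar a z j) Ω := by
  rw [dbar_eq]
  exact (dbarL j).contDiff.comp_contDiffOn (ha.fderiv_of_isOpen hΩ hkl)

lemma contDiff_del {a : Cn n → ℂ} {k l : WithTop ℕ∞}
    (ha : ContDiff ℝ k a) (hkl : l + 1 ≤ k) (j : Fin n) :
    ContDiff ℝ l (fun z => del a z j) := by
  rw [del_eq]
  exact (delL j).contDiff.comp (ha.fderiv_right hkl)

lemma contDiff_dbar {a : Cn n → ℂ} {k l : WithTop ℕ∞}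
    (ha : ContDiff ℝ k a) (hkl : l + 1 ≤ k) (j : Fin n) :
    ContDiff ℝ l (fun z => dbar a z j) := by
  rw [dbar_eq]
  exact (dbarL j).contDiff.comp (ha.fderiv_right hkl)

lemma fderiv_fderiv_apply {a : Cn n → ℂ} {z : Cn n} (ha : ContDiffAt ℝ 2 a z)
    (L : (Cn n →L[ℝ] ℂ) →L[ℝ] ℂ) (v : Cn n) :
    fderiv ℝ (fun w => L (fderiv ℝ a w)) z v = L (fderiv ℝ (fderiv ℝ a) z v) := by
  have h1 : DifferentiableAt ℝ (fderiv ℝ a) z :=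
    (ha.fderiv_right (m := 1) (by norm_num)).differentiableAt (by norm_num)
  have := (L.hasFDerivAt.comp z h1.hasFDerivAt).fderiv
  simp only [Function.comp_def] at this
  rw [this]; rfl

lemma dbar_del_comm {a : Cn n → ℂ} {z : Cn n} (ha : ContDiffAt ℝ 2 a z) (j k : Fin n) :
    dbar (fun w => del a w j) z k = del (fun w => dbar a w k) z j := by
  have hs : IsSymmSndFDerivAt ℝ a z := ha.isSymmSndFDerivAt (by simp)
  rw [del_eq, dbar_eq]
  simp only [dbar, del, fderiv_fderiv_apply ha]
  simp only [delL, dbarL, smul_apply, sub_apply,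
    add_apply, ContinuousLinearMap.apply_apply, smul_eq_mul]
  rw [hs (e n k) (e n j), hs (e n k) (I • e n j), hs (I • e n k) (e n j),
    hs (I • e n k) (I • e n j)]
  ring

lemma dbar_dbar_comm {a : Cn n → ℂ} {z : Cn n} (ha : ContDiffAt ℝ 2 a z) (j k : Fin n) :
    dbar (fun w => dbar a w j) z k = dbar (fun w => dbar a w k) z j := by
  have hs : IsSymmSndFDerivAt ℝ a z := ha.isSymmSndFDerivAt (by simp)
  rw [dbar_eq, dbar_eq]
  simp only [dbar, fderiv_fderiv_apply ha]
  simp only [dbarL, smul_apply,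
    add_apply, ContinuousLinearMap.apply_apply, smul_eq_mul]
  rw [hs (e n k) (e n j), hs (e n k) (I • e n j), hs (I • e n k) (e n j),
    hs (I • e n k) (I • e n j)]
  ring

namespace CcOn

variable {Ω : Set (Cn n)} {k l : WithTop ℕ∞} {a b : Cn n → ℂ}

lemma eq_zero (hb : CcOn Ω k b) {z : Cn n} (hz : z ∉ Ω) : b z = 0 :=
  image_eq_zero_of_notMem_tsupport fun h => hz (hb.subset h)

lemma mono (hb : CcOn Ω k b) (h : l ≤ k) : CcOn Ω l b :=
  ⟨hb.contDiff.of_le h, hb.compact, hb.subset⟩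

lemma continuous (hb : CcOn Ω k b) : Continuous b := hb.contDiff.continuous

lemma of_tsupport (hΩ : IsOpen Ω) (ha : ContDiffOn ℝ k a Ω) (hb : CcOn Ω l b)
    (h : tsupport a ⊆ tsupport b) : CcOn Ω k a := by
  refine ⟨contDiff_iff_contDiffAt.2 fun x => ?_, ?_, h.trans hb.subset⟩
  · by_cases hx : x ∈ tsupport a
    · exact ha.contDiffAt (hΩ.mem_nhds (hb.subset (h hx)))
    · exact contDiffAt_const.congr_of_eventuallyEq (notMem_tsupport_iff_eventuallyEq.1 hx)
  · exact hb.compact.mono' ((subset_tsupport a).trans h)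

lemma mul_left (hΩ : IsOpen Ω) (ha : ContDiffOn ℝ k a Ω) (hb : CcOn Ω k b) :
    CcOn Ω k (fun z => a z * b z) :=
  of_tsupport hΩ (ha.mul hb.contDiff.contDiffOn) hb (tsupport_mul_subset_right)

lemma mul_right (hΩ : IsOpen Ω) (hb : CcOn Ω k b) (ha : ContDiffOn ℝ k a Ω) :
    CcOn Ω k (fun z => b z * a z) := by
  simpa only [mul_comm] using mul_left hΩ ha hb

lemma add (ha : CcOn Ω k a) (hb : CcOn Ω k b) : CcOn Ω k (fun z => a z + b z) :=
  ⟨ha.contDiff.add hb.contDiff, ha.compact.add hb.compact,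
    (tsupport_add a b).trans (union_subset ha.subset hb.subset)⟩

lemma zero : CcOn Ω k (fun _ : Cn n => (0 : ℂ)) :=
  ⟨contDiff_const, HasCompactSupport.zero, by
    have : tsupport (fun _ : Cn n => (0 : ℂ)) = ∅ := tsupport_eq_empty_iff.2 rfl
    simp [this]⟩

lemma conjugate (ha : CcOn Ω k a) : CcOn Ω k (fun z => conj (a z)) := by
  refine ⟨(Complex.conjCLE : ℂ ≃L[ℝ] ℂ).contDiff.comp ha.contDiff, ?_, ?_⟩
  · exact ha.compact.comp_left (g := fun w : ℂ => (starRingEnd ℂ) w) (by simp)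
  · exact (tsupport_comp_subset (g := fun w : ℂ => (starRingEnd ℂ) w) (by simp) a).trans ha.subset

lemma const_mul (c : ℂ) (ha : CcOn Ω k a) : CcOn Ω k (fun z => c * a z) :=
  ⟨contDiff_const.mul ha.contDiff, ha.compact.mul_left,
    tsupport_mul_subset_right.trans ha.subset⟩

lemma tsupport_dbar (b : Cn n → ℂ) (j : Fin n) : tsupport (fun z => dbar b z j) ⊆ tsupport b := by
  rw [dbar_eq]
  exact (tsupport_comp_subset (g := dbarL j) (map_zero _) _).trans (tsupport_fderiv_subset ℝ)

lemma tsupport_del (b : Cn n → ℂ) (j : Fin n) : tsupport (fun z => del b z j) ⊆ tsupport b := by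
  rw [del_eq]
  exact (tsupport_comp_subset (g := delL j) (map_zero _) _).trans (tsupport_fderiv_subset ℝ)

lemma dbar (hb : CcOn Ω k b) (h : l + 1 ≤ k) (j : Fin n) : CcOn Ω l (fun z => dbar b z j) :=
  ⟨contDiff_dbar hb.contDiff h j, hb.compact.mono' ((subset_tsupport _).trans (tsupport_dbar b j)),
    (tsupport_dbar b j).trans hb.subset⟩

lemma del (hb : CcOn Ω k b) (h : l + 1 ≤ k) (j : Fin n) : CcOn Ω l (fun z => del b z j) :=
  ⟨contDiff_del hb.contDiff h j, hb.compact.mono' ((subset_tsupport _).trans (tsupport_del b j)),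
    (tsupport_del b j).trans hb.subset⟩

lemma integrable (hb : CcOn Ω k b) : Integrable b :=
  hb.continuous.integrable_of_hasCompactSupport hb.compact

lemma mul_left₀ (hΩ : IsOpen Ω) (ha : ContinuousOn a Ω) (hb : CcOn Ω k b) :
    CcOn Ω 0 (fun z => a z * b z) :=
  mul_left hΩ (contDiffOn_zero.2 ha) (hb.mono (by simp))

lemma differentiable (hb : CcOn Ω k b) (h : k ≠ 0) : Differentiable ℝ b :=
  hb.contDiff.differentiable h

end CcOn

lemma integral_mul_fderiv_ccOn {Ω : Set (Cn n)} (hΩ : IsOpen Ω) {a b : Cn n → ℂ}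
    (ha : ContDiffOn ℝ 1 a Ω) (hb : CcOn Ω 1 b) (v : Cn n) :
    ∫ z, a z * fderiv ℝ b z v = -∫ z, fderiv ℝ a z v * b z := by
  have hb' : CcOn Ω 0 (fun z => fderiv ℝ b z v) := by
    refine CcOn.of_tsupport hΩ ?_ hb ?_
    · exact contDiffOn_zero.2
        ((hb.contDiff.continuous_fderiv (by norm_num)).clm_apply continuous_const).continuousOn
    · exact (tsupport_comp_subset (g := fun L : Cn n →L[ℝ] ℂ => L v) (by simp) _).trans
        (tsupport_fderiv_subset ℝ)
  have ha' : ContinuousOn (fun z => fderiv ℝ a z v) Ω :=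
    (ha.continuousOn_fderiv_of_isOpen hΩ (by norm_num)).clm_apply continuousOn_const
  refine integral_mul_fderiv_eq_neg_fderiv_mul_of_integrable ?_ ?_ ?_ ?_ ?_
  · exact (CcOn.mul_left₀ hΩ ha' hb).integrable
  · exact (CcOn.mul_left₀ hΩ ha.continuousOn hb').integrable
  · exact (CcOn.mul_left₀ hΩ ha.continuousOn hb).integrable
  · intro x hx
    exact (ha.contDiffAt (hΩ.mem_nhds (hb.subset hx))).differentiableAt (by norm_num)
  · intro x _
    exact hb.differentiable (by norm_num) x

lemma integrable_fderiv_mul_ccOn {Ω : Set (Cn n)} (hΩ : IsOpen Ω) {a b : Cn n → ℂ}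
    (ha : ContDiffOn ℝ 1 a Ω) (hb : CcOn Ω 1 b) (v : Cn n) :
    Integrable (fun z => fderiv ℝ a z v * b z) := by
  have ha' : ContinuousOn (fun z => fderiv ℝ a z v) Ω :=
    (ha.continuousOn_fderiv_of_isOpen hΩ (by norm_num)).clm_apply continuousOn_const
  exact (CcOn.mul_left₀ hΩ ha' hb).integrable

lemma integrable_mul_fderiv_ccOn {Ω : Set (Cn n)} (hΩ : IsOpen Ω) {a b : Cn n → ℂ}
    (ha : ContDiffOn ℝ 1 a Ω) (hb : CcOn Ω 1 b) (v : Cn n) :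
    Integrable (fun z => a z * fderiv ℝ b z v) := by
  have hb' : CcOn Ω 0 (fun z => fderiv ℝ b z v) := by
    refine CcOn.of_tsupport hΩ ?_ hb ?_
    · exact contDiffOn_zero.2
        ((hb.contDiff.continuous_fderiv (by norm_num)).clm_apply continuous_const).continuousOn
    · exact (tsupport_comp_subset (g := fun L : Cn n →L[ℝ] ℂ => L v) (by simp) _).trans
        (tsupport_fderiv_subset ℝ)
  exact (CcOn.mul_left₀ hΩ ha.continuousOn hb').integrable

/-- Integration by parts for `∂/∂z̄_j`. -/
lemma integral_mul_dbar {Ω : Set (Cn n)} (hΩ : IsOpen Ω) {a b : Cn n → ℂ}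
    (ha : ContDiffOn ℝ 1 a Ω) (hb : CcOn Ω 1 b) (j : Fin n) :
    ∫ z, a z * dbar b z j = -∫ z, dbar a z j * b z := by
  have h1 := integrable_fderiv_mul_ccOn hΩ ha hb (e n j)
  have h2 := integrable_fderiv_mul_ccOn hΩ ha hb (I • e n j)
  have h3 := integrable_mul_fderiv_ccOn hΩ ha hb (e n j)
  have h4 := integrable_mul_fderiv_ccOn hΩ ha hb (I • e n j)
  have e1 : ∀ z, a z * dbar b z j =
      (1 / 2) * (a z * fderiv ℝ b z (e n j)) + (I / 2) * (a z * fderiv ℝ b z (I • e n j)) := by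
    intro z; simp only [dbar]; ring
  have e2 : ∀ z, dbar a z j * b z =
      (1 / 2) * (fderiv ℝ a z (e n j) * b z) + (I / 2) * (fderiv ℝ a z (I • e n j) * b z) := by
    intro z; simp only [dbar]; ring
  simp only [e1, e2]
  rw [integral_add (h3.const_mul _) (h4.const_mul _), integral_add (h1.const_mul _) (h2.const_mul _)]
  simp only [integral_const_mul, integral_mul_fderiv_ccOn hΩ ha hb]
  ring

/-- Integration by parts for `∂/∂z_j`. -/
lemma integral_mul_del {Ω : Set (Cn n)} (hΩ : IsOpen Ω) {a b : Cn n → ℂ}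
    (ha : ContDiffOn ℝ 1 a Ω) (hb : CcOn Ω 1 b) (j : Fin n) :
    ∫ z, a z * del b z j = -∫ z, del a z j * b z := by
  have h1 := integrable_fderiv_mul_ccOn hΩ ha hb (e n j)
  have h2 := integrable_fderiv_mul_ccOn hΩ ha hb (I • e n j)
  have h3 := integrable_mul_fderiv_ccOn hΩ ha hb (e n j)
  have h4 := integrable_mul_fderiv_ccOn hΩ ha hb (I • e n j)
  have e1 : ∀ z, a z * del b z j =
      (1 / 2) * (a z * fderiv ℝ b z (e n j)) + (-I / 2) * (a z * fderiv ℝ b z (I • e n j)) := by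
    intro z; simp only [del]; ring
  have e2 : ∀ z, del a z j * b z =
      (1 / 2) * (fderiv ℝ a z (e n j) * b z) + (-I / 2) * (fderiv ℝ a z (I • e n j) * b z) := by
    intro z; simp only [del]; ring
  simp only [e1, e2]
  rw [integral_add (h3.const_mul _) (h4.const_mul _), integral_add (h1.const_mul _) (h2.const_mul _)]
  simp only [integral_const_mul, integral_mul_fderiv_ccOn hΩ ha hb]
  ring

/-! ### Weighted operators on `(0,1)`-forms -/

/-- `e^W ∂_j (e^{-W} a)`. -/
def delW (W : Cn n → ℝ) (a : Cn n → ℂ) (z : Cn n) (j : Fin n) : ℂ :=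
  del a z j - del (fun w => (W w : ℂ)) z j * a z

/-- The formal adjoint of `∂̄` with respect to the weight `e^{-W}`. -/
def dstar (W : Cn n → ℝ) (α : Fin n → Cn n → ℂ) (z : Cn n) : ℂ :=
  -∑ j, delW W (α j) z j

/-- The components of `∂̄α`. -/
def curl (α : Fin n → Cn n → ℂ) (z : Cn n) (j k : Fin n) : ℂ :=
  dbar (α k) z j - dbar (α j) z k

/-- The weight `e^{-W}`. -/
def ew (W : Cn n → ℝ) (z : Cn n) : ℝ := Real.exp (-W z)

/-- Test forms. -/
def TForm (Ω : Set (Cn n)) (α : Fin n → Cn n → ℂ) : Prop := ∀ j, CcOn Ω 2 (α j)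

/-- The pointwise energy density `|∂̄^*α|² + |∂̄α|²`. -/
def energy (W : Cn n → ℝ) (α : Fin n → Cn n → ℂ) (z : Cn n) : ℝ :=
  ‖dstar W α z‖ ^ 2 + (1 / 2) * ∑ j, ∑ k, ‖curl α z j k‖ ^ 2

lemma ew_pos (W : Cn n → ℝ) (z : Cn n) : 0 < ew W z := Real.exp_pos _

lemma continuous_of_vanish {F : Type*} [NormedAddCommGroup F] {Ω S : Set (Cn n)} (hΩ : IsOpen Ω)
    {f : Cn n → F} (hf : ContinuousOn f Ω) (hS : IsCompact S) (hSΩ : S ⊆ Ω)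
    (h0 : ∀ z ∉ S, f z = 0) : Continuous f ∧ HasCompactSupport f := by
  refine ⟨continuous_iff_continuousAt.2 fun z => ?_, HasCompactSupport.intro hS h0⟩
  by_cases hz : z ∈ S
  · exact hf.continuousAt (hΩ.mem_nhds (hSΩ hz))
  · have h : ContinuousAt (fun _ : Cn n => (0 : F)) z := continuousAt_const
    refine h.congr ?_
    filter_upwards [hS.isClosed.isOpen_compl.mem_nhds hz] with w hw
    exact (h0 w hw).symm

lemma integrable_of_vanish {F : Type*} [NormedAddCommGroup F] {Ω S : Set (Cn n)} (hΩ : IsOpen Ω)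
    {f : Cn n → F} (hf : ContinuousOn f Ω) (hS : IsCompact S) (hSΩ : S ⊆ Ω)
    (h0 : ∀ z ∉ S, f z = 0) : Integrable f :=
  let h := continuous_of_vanish hΩ hf hS hSΩ h0
  h.1.integrable_of_hasCompactSupport h.2

section Weight

variable {Ω : Set (Cn n)} (hΩ : IsOpen Ω) {W : Cn n → ℝ} (hW : ContDiffOn ℝ 2 W Ω)

lemma contDiffOn_ofReal {k : WithTop ℕ∞} {W : Cn n → ℝ} (hW : ContDiffOn ℝ k W Ω) :
    ContDiffOn ℝ k (fun w => (W w : ℂ)) Ω :=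
  Complex.ofRealCLM.contDiff.comp_contDiffOn hW

lemma contDiffOn_ew {k : WithTop ℕ∞} {W : Cn n → ℝ} (hW : ContDiffOn ℝ k W Ω) :
    ContDiffOn ℝ k (ew W) Ω := hW.neg.exp

lemma fderiv_ofReal_apply {W : Cn n → ℝ} {z : Cn n} (hW : DifferentiableAt ℝ W z) (v : Cn n) :
    fderiv ℝ (fun w => (W w : ℂ)) z v = (fderiv ℝ W z v : ℂ) := by
  have := (Complex.ofRealCLM.hasFDerivAt.comp z hW.hasFDerivAt).fderiv
  simp only [Function.comp_def, Complex.ofRealCLM_apply] at this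
  rw [this]; simp

lemma del_ew {W : Cn n → ℝ} {z : Cn n} (hW : DifferentiableAt ℝ W z) (j : Fin n) :
    del (fun w => (ew W w : ℂ)) z j = -del (fun w => (W w : ℂ)) z j * ew W z := by
  have h : fderiv ℝ (ew W) z = -(ew W z) • fderiv ℝ W z := by
    have := (hW.hasFDerivAt.neg.exp).fderiv
    change fderiv ℝ (fun w => Real.exp (-W w)) z = _
    rw [show (fun w => Real.exp (-W w)) = (fun w => Real.exp ((-W) w)) from rfl, this]
    simp [ew]
  have hd : DifferentiableAt ℝ (ew W) z := hW.neg.exp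
  simp only [del, fderiv_ofReal_apply hW, fderiv_ofReal_apply hd, h]
  simp
  ring

include hΩ hW

lemma contDiffOn_delW {a : Cn n → ℂ} {k l : WithTop ℕ∞} (ha : ContDiffOn ℝ k a Ω)
    (hk : l + 1 ≤ k) (hk2 : k ≤ 2) (j : Fin n) :
    ContDiffOn ℝ l (fun z => delW W a z j) Ω := by
  have hl : l ≤ k := (le_add_of_nonneg_right (by simp)).trans hk
  exact (contDiffOn_del hΩ ha hk j).sub
    ((contDiffOn_del hΩ (contDiffOn_ofReal hW) (hk.trans hk2) j).mul (ha.of_le hl))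

lemma del_mul_ew {a : Cn n → ℂ} (ha : ContDiffOn ℝ 1 a Ω) {z : Cn n} (hz : z ∈ Ω) (j : Fin n) :
    del (fun w => a w * (ew W w : ℂ)) z j = delW W a z j * ew W z := by
  have hWd : DifferentiableAt ℝ W z := (hW.contDiffAt (hΩ.mem_nhds hz)).differentiableAt (by simp)
  have had : DifferentiableAt ℝ a z := (ha.contDiffAt (hΩ.mem_nhds hz)).differentiableAt (by simp)
  have hed : DifferentiableAt ℝ (fun w => (ew W w : ℂ)) z :=
    ((contDiffOn_ofReal (contDiffOn_ew hW)).contDiffAt (hΩ.mem_nhds hz)).differentiableAt (by simp)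
  rw [del_mul had hed, del_ew hWd, delW]
  ring

/-- Weighted integration by parts, second factor compactly supported. -/
lemma integral_delW_mul {a b : Cn n → ℂ} (ha : ContDiffOn ℝ 1 a Ω) (hb : CcOn Ω 1 b) (j : Fin n) :
    ∫ z, delW W a z j * conj (b z) * ew W z = -∫ z, a z * conj (dbar b z j) * ew W z := by
  have hE : ContDiffOn ℝ 1 (fun w => (ew W w : ℂ)) Ω :=
    (contDiffOn_ofReal (contDiffOn_ew hW)).of_le (by norm_num)
  have h := integral_mul_del hΩ (ha.mul hE) hb.conjugate j
  have e1 : ∀ z, a z * conj (dbar b z j) * ew W z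
      = a z * ew W z * del (fun w => conj (b w)) z j := by
    intro z; rw [conj_dbar]; ring
  have e2 : ∀ z, delW W a z j * conj (b z) * ew W z
      = del (fun w => a w * (ew W w : ℂ)) z j * conj (b z) := by
    intro z
    by_cases hz : z ∈ Ω
    · rw [del_mul_ew hΩ hW ha hz]; ring
    · simp [hb.eq_zero hz]
  simp only [e1, e2]
  rw [h]; simp

/-- Weighted integration by parts, first factor compactly supported. -/
lemma integral_delW_mul' {a b : Cn n → ℂ} (ha : CcOn Ω 1 a) (hb : ContDiffOn ℝ 1 b Ω) (j : Fin n) :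
    ∫ z, delW W a z j * conj (b z) * ew W z = -∫ z, a z * conj (dbar b z j) * ew W z := by
  have hE : ContDiffOn ℝ 1 (fun w => (ew W w : ℂ)) Ω :=
    (contDiffOn_ofReal (contDiffOn_ew hW)).of_le (by norm_num)
  have hb' : ContDiffOn ℝ 1 (fun z => conj (b z)) Ω :=
    (Complex.conjCLE : ℂ ≃L[ℝ] ℂ).contDiff.comp_contDiffOn hb
  have h := integral_mul_del hΩ hb' (ha.mul_right hΩ hE) j
  have e1 : ∀ z, a z * conj (dbar b z j) * ew W z
      = del (fun w => conj (b w)) z j * (a z * ew W z) := by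
    intro z; rw [conj_dbar]; ring
  have e2 : ∀ z, delW W a z j * conj (b z) * ew W z
      = conj (b z) * del (fun w => a w * (ew W w : ℂ)) z j := by
    intro z
    by_cases hz : z ∈ Ω
    · rw [del_mul_ew hΩ hW ha.contDiff.contDiffOn hz]; ring
    · have h0 : z ∉ tsupport a := fun h => hz (ha.subset h)
      have h1 : a =ᶠ[nhds z] fun _ => 0 := notMem_tsupport_iff_eventuallyEq.1 h0
      have h2 : (fun w => a w * (ew W w : ℂ)) =ᶠ[nhds z] fun _ => 0 := by
        filter_upwards [h1] with w hw; simp [hw]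
      rw [delW, del_congr h1, del_congr h2, ha.eq_zero hz, del_const]; simp
  simp only [e1, e2]
  rw [h]

lemma dbar_delW {a : Cn n → ℂ} (ha : ContDiffOn ℝ 2 a Ω) {z : Cn n} (hz : z ∈ Ω) (j k : Fin n) :
    dbar (fun w => delW W a w k) z j = delW W (fun w => dbar a w j) z k
      - dbar (fun w => del (fun w => (W w : ℂ)) w k) z j * a z := by
  have hn := hΩ.mem_nhds hz
  have d1 : DifferentiableAt ℝ (fun w => del a w k) z :=
    ((contDiffOn_del (l := 1) hΩ ha (by norm_num) k).contDiffAt hn).differentiableAt (by simp)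
  have d2 : DifferentiableAt ℝ (fun w => del (fun w => (W w : ℂ)) w k) z :=
    ((contDiffOn_del (l := 1) hΩ (contDiffOn_ofReal hW) (by norm_num) k).contDiffAt
      hn).differentiableAt (by simp)
  have d3 : DifferentiableAt ℝ a z := (ha.contDiffAt hn).differentiableAt (by simp)
  have : (fun w => delW W a w k)
      = fun w => del a w k - del (fun w => (W w : ℂ)) w k * a w := rfl
  rw [this, dbar_sub d1 (d2.fun_mul d3), dbar_mul d2 d3, dbar_del_comm (ha.contDiffAt hn), delW]
  ring

/-- The commutator identity behind the Bochner formula. -/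
lemma integral_delW_delW {a b : Cn n → ℂ} (ha : CcOn Ω 2 a) (hb : CcOn Ω 2 b) (j k : Fin n) :
    ∫ z, (delW W a z j * conj (delW W b z k) - dbar a z k * conj (dbar b z j)
      - conj (dbar (fun w => del (fun w => (W w : ℂ)) w k) z j) * a z * conj (b z)) * ew W z = 0 := by
  have hb1 : ContDiffOn ℝ 1 (fun z => delW W b z k) Ω :=
    contDiffOn_delW hΩ hW hb.contDiff.contDiffOn (by norm_num) le_rfl k
  have ha1 : ContDiffOn ℝ 1 (fun z => delW W a z j) Ω :=
    contDiffOn_delW hΩ hW ha.contDiff.contDiffOn (by norm_num) le_rfl j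
  have hdb : CcOn Ω 1 (fun z => dbar b z j) := hb.dbar (by norm_num) j
  have hda : CcOn Ω 1 (fun z => dbar a z k) := ha.dbar (by norm_num) k
  have hE : ContinuousOn (fun w => (ew W w : ℂ)) Ω :=
    (contDiffOn_ofReal (contDiffOn_ew hW)).continuousOn
  have hdel : ContDiffOn ℝ 0 (fun z => delW W (fun w => dbar b w j) z k) Ω :=
    contDiffOn_delW hΩ hW hdb.contDiff.contDiffOn (by norm_num) (by norm_num) k
  have hc : ContinuousOn (fun z => conj (dbar (fun w => del (fun w => (W w : ℂ)) w k) z j)) Ω :=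
    Complex.continuous_conj.comp_continuousOn (contDiffOn_dbar (l := 0) hΩ
      (contDiffOn_del (l := 1) hΩ (contDiffOn_ofReal hW) (by norm_num) k)
      (by norm_num) j).continuousOn
  have h1 := integral_delW_mul' hΩ hW (ha.mono (by norm_num)) hb1 j
  have h2 := integral_delW_mul hΩ hW hdb.contDiff.contDiffOn (ha.mono (by norm_num)) k
  have h2' : ∫ z, conj (delW W (fun w => dbar b w j) z k) * a z * ew W z
      = -∫ z, conj (dbar b z j) * dbar a z k * ew W z := by
    have := congrArg conj h2
    rw [← integral_conj, map_neg, ← integral_conj] at this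
    simpa using this
  have cj : Continuous (starRingEnd ℂ) := Complex.continuous_conj
  have vz : ∀ z ∉ tsupport a, a z = 0 ∧ dbar a z k = 0 ∧ delW W a z j = 0 := by
    intro z hz
    have h1 : a =ᶠ[nhds z] fun _ => 0 := notMem_tsupport_iff_eventuallyEq.1 hz
    refine ⟨h1.eq_of_nhds, ?_, ?_⟩
    · rw [dbar_congr h1, dbar_const]
    · rw [delW, del_congr h1, del_const, h1.eq_of_nhds]; simp
  have i1 : Integrable (fun z => delW W a z j * conj (delW W b z k) * ew W z) :=
    integrable_of_vanish hΩ ((ha1.continuousOn.mul (cj.comp_continuousOn hb1.continuousOn)).mul hE)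
      ha.compact ha.subset (fun z hz => by simp [vz z hz])
  have i2 : Integrable (fun z => conj (dbar b z j) * dbar a z k * ew W z) :=
    integrable_of_vanish hΩ (((cj.comp hdb.continuous).mul hda.continuous).continuousOn.mul hE)
      ha.compact ha.subset (fun z hz => by simp [vz z hz])
  have i3 : Integrable (fun z => conj (delW W (fun w => dbar b w j) z k) * a z * ew W z) :=
    integrable_of_vanish hΩ (((cj.comp_continuousOn hdel.continuousOn).mul
      ha.continuous.continuousOn).mul hE)
      ha.compact ha.subset (fun z hz => by simp [vz z hz])
  have i4 : Integrable (fun z => conj (dbar (fun w => del (fun w => (W w : ℂ)) w k) z j) * a z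
      * conj (b z) * ew W z) :=
    integrable_of_vanish hΩ (((hc.mul ha.continuous.continuousOn).mul
      (cj.comp hb.continuous).continuousOn).mul hE)
      ha.compact ha.subset (fun z hz => by simp [vz z hz])
  have e1 : ∀ z, a z * conj (dbar (fun w => delW W b w k) z j) * ew W z
      = conj (delW W (fun w => dbar b w j) z k) * a z * ew W z
        - conj (dbar (fun w => del (fun w => (W w : ℂ)) w k) z j) * a z * conj (b z) * ew W z := by
    intro z
    by_cases hz : z ∈ Ω
    · rw [dbar_delW hΩ hW hb.contDiff.contDiffOn hz]
      simp only [map_sub, map_mul]; ring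
    · simp [ha.eq_zero hz]
  simp only [e1] at h1
  rw [integral_sub i3 i4, h2'] at h1
  have e2 : ∀ z, (delW W a z j * conj (delW W b z k) - dbar a z k * conj (dbar b z j)
      - conj (dbar (fun w => del (fun w => (W w : ℂ)) w k) z j) * a z * conj (b z)) * ew W z
      = delW W a z j * conj (delW W b z k) * ew W z - conj (dbar b z j) * dbar a z k * ew W z
        - conj (dbar (fun w => del (fun w => (W w : ℂ)) w k) z j) * a z * conj (b z) * ew W z := by
    intro z; ring
  have i12 : Integrable (fun z => delW W a z j * conj (delW W b z k) * ew W z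
      - conj (dbar b z j) * dbar a z k * ew W z) := i1.sub i2
  simp only [e2]
  rw [integral_sub i12 i4, integral_sub i1 i2, h1]
  ring

end Weight

/-! ### The Bochner inequality -/

lemma eq_sum_basis (w : Cn n) :
    w = ∑ j, ((w j).re • e n j + (w j).im • (Complex.I • e n j)) := by
  ext k
  simp only [WithLp.ofLp_sum, WithLp.ofLp_add, WithLp.ofLp_smul, Finset.sum_apply, Pi.add_apply,
    Pi.smul_apply, e, PiLp.single_apply, Finset.sum_add_distrib]
  simp [Complex.re_add_im]

lemma fderiv_fderiv_ofReal {W : Cn n → ℝ} {z : Cn n} (hW : ContDiffAt ℝ 2 W z) (v w : Cn n) :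
    fderiv ℝ (fderiv ℝ (fun w => (W w : ℂ))) z v w = (fderiv ℝ (fderiv ℝ W) z v w : ℂ) := by
  have h1 : fderiv ℝ (fun w => (W w : ℂ)) =ᶠ[nhds z]
      fun x => (ContinuousLinearMap.compL ℝ (Cn n) ℝ ℂ Complex.ofRealCLM) (fderiv ℝ W x) := by
    filter_upwards [hW.eventually (by simp)] with x hx
    have hd : DifferentiableAt ℝ W x := hx.differentiableAt (by simp)
    ext v
    rw [fderiv_ofReal_apply hd]; simp
  have hd : DifferentiableAt ℝ (fderiv ℝ W) z :=
    (hW.fderiv_right (m := 1) (by norm_num)).differentiableAt (by norm_num)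
  rw [h1.fderiv_eq]
  have := ((ContinuousLinearMap.compL ℝ (Cn n) ℝ ℂ Complex.ofRealCLM).hasFDerivAt.comp z
    hd.hasFDerivAt).fderiv
  simp only [Function.comp_def] at this
  rw [this]; simp

/-- The Levi form in coordinates. -/
lemma re_sum_levi {W : Cn n → ℝ} {z : Cn n} (hW : ContDiffAt ℝ 2 W z) (w : Cn n) :
    (∑ j, ∑ k, conj (dbar (fun x => del (fun x => (W x : ℂ)) x k) z j) * w j * conj (w k)).re
      = LeviForm W z w := by
  have hW' : ContDiffAt ℝ 2 (fun x => (W x : ℂ)) z := Complex.ofRealCLM.contDiff.contDiffAt.comp z hW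
  set B := fderiv ℝ (fderiv ℝ W) z with hB
  have h1 : ∀ j k, dbar (fun x => del (fun x => (W x : ℂ)) x k) z j
      = (1 / 4) * (B (e n j) (e n k) - Complex.I * B (e n j) (Complex.I • e n k)
        + Complex.I * B (Complex.I • e n j) (e n k)
        + B (Complex.I • e n j) (Complex.I • e n k)) := by
    intro j k
    rw [del_eq]
    simp only [dbar, fderiv_fderiv_apply hW']
    simp only [delL, smul_apply, sub_apply, ContinuousLinearMap.apply_apply, smul_eq_mul,
      fderiv_fderiv_ofReal hW, ← hB]
    linear_combination (-(1 / 4 : ℂ)) * B (Complex.I • e n j) (Complex.I • e n k) * Complex.I_sq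
  have hI : Complex.I • w = ∑ j, ((w j).re • (Complex.I • e n j) + (-(w j).im) • e n j) := by
    conv_lhs => rw [eq_sum_basis w]
    rw [Finset.smul_sum]
    refine Finset.sum_congr rfl fun j _ => ?_
    rw [smul_add, smul_comm Complex.I, smul_comm Complex.I, smul_smul Complex.I, Complex.I_mul_I]
    simp
  have key : ∀ j k, (conj (dbar (fun x => del (fun x => (W x : ℂ)) x k) z j) * w j * conj (w k)).re
      = (1 / 4) * (B ((w j).re • e n j + (w j).im • (Complex.I • e n j))
          ((w k).re • e n k + (w k).im • (Complex.I • e n k))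
        + B ((w j).re • (Complex.I • e n j) + (-(w j).im) • e n j)
          ((w k).re • (Complex.I • e n k) + (-(w k).im) • e n k)) := by
    intro j k
    rw [h1]
    simp only [map_add, map_smul, add_apply, smul_apply, smul_eq_mul]
    simp
    ring
  have e1 : B w w = ∑ j, ∑ k, B ((w j).re • e n j + (w j).im • (Complex.I • e n j))
          ((w k).re • e n k + (w k).im • (Complex.I • e n k)) := by
    conv_lhs => rw [eq_sum_basis w]
    simp only [map_sum, sum_apply]
    exact Finset.sum_comm
  have e2 : B (Complex.I • w) (Complex.I • w)
      = ∑ j, ∑ k, B ((w j).re • (Complex.I • e n j) + (-(w j).im) • e n j)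
          ((w k).re • (Complex.I • e n k) + (-(w k).im) • e n k) := by
    rw [hI]
    simp only [map_sum, sum_apply]
    exact Finset.sum_comm
  rw [LeviForm, ← hB, e1, e2]
  simp only [Complex.re_sum, key, ← Finset.mul_sum, ← Finset.sum_add_distrib]

/-- The pointwise squared norm of a form. -/
def nsq (α : Fin n → Cn n → ℂ) (z : Cn n) : ℝ := ∑ j, ‖α j z‖ ^ 2

lemma nsq_nonneg (α : Fin n → Cn n → ℂ) (z : Cn n) : 0 ≤ nsq α z :=
  Finset.sum_nonneg fun _ _ => by positivity

lemma energy_nonneg (W : Cn n → ℝ) (α : Fin n → Cn n → ℂ) (z : Cn n) : 0 ≤ energy W α z := by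
  have : 0 ≤ ∑ j, ∑ k, ‖curl α z j k‖ ^ 2 :=
    Finset.sum_nonneg fun _ _ => Finset.sum_nonneg fun _ _ => by positivity
  unfold energy; positivity

/-- The polarized energy density. -/
def energyPol (W : Cn n → ℝ) (α β : Fin n → Cn n → ℂ) (z : Cn n) : ℂ :=
  dstar W α z * conj (dstar W β z) + (1 / 2) * ∑ j, ∑ k, curl α z j k * conj (curl β z j k)

lemma normSq_re (w : ℂ) : ‖w‖ ^ 2 = (w * conj w).re := by
  rw [Complex.mul_conj, Complex.ofReal_re, Complex.normSq_eq_norm_sq]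

lemma energy_eq_re_integrand (W : Cn n → ℝ) (α : Fin n → Cn n → ℂ) (z : Cn n) :
    energy W α z = (∑ j, ∑ k, (delW W (α j) z j * conj (delW W (α k) z k)
      - dbar (α j) z k * conj (dbar (α k) z j))).re + ∑ j, ∑ k, ‖dbar (α k) z j‖ ^ 2 := by
  have h1 : ‖dstar W α z‖ ^ 2 = (∑ j, ∑ k, delW W (α j) z j * conj (delW W (α k) z k)).re := by
    rw [dstar, norm_neg, normSq_re, map_sum, Finset.sum_mul_sum]
  have h2 : ∀ j k, ‖curl α z j k‖ ^ 2 = ‖dbar (α k) z j‖ ^ 2 + ‖dbar (α j) z k‖ ^ 2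
      - 2 * (dbar (α j) z k * conj (dbar (α k) z j)).re := by
    intro j k
    simp only [curl, normSq_re]
    simp
    ring
  have h3 : ∑ j, ∑ k, ‖dbar (α j) z k‖ ^ 2 = ∑ j, ∑ k, ‖dbar (α k) z j‖ ^ 2 := Finset.sum_comm
  rw [energy, h1]
  simp only [h2, Finset.sum_add_distrib, Finset.sum_sub_distrib, h3, ← Finset.mul_sum,
    Complex.sub_re, Complex.re_sum]
  ring

lemma TForm.exists_compact {Ω : Set (Cn n)} {α : Fin n → Cn n → ℂ} (h : TForm Ω α) :
    ∃ S : Set (Cn n), IsCompact S ∧ S ⊆ Ω ∧ ∀ z ∉ S, ∀ j,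
      α j =ᶠ[nhds z] fun _ => 0 := by
  refine ⟨⋃ j, tsupport (α j), isCompact_iUnion fun j => (h j).compact,
    iUnion_subset fun j => (h j).subset, fun z hz j => ?_⟩
  simp only [mem_iUnion, not_exists] at hz
  exact notMem_tsupport_iff_eventuallyEq.1 (hz j)

lemma delW_eq_zero {W : Cn n → ℝ} {a : Cn n → ℂ} {z : Cn n} (h : a =ᶠ[nhds z] fun _ => 0)
    (j : Fin n) : delW W a z j = 0 := by
  rw [delW, del_congr h, del_const, h.eq_of_nhds]; simp

lemma dbar_eq_zero {a : Cn n → ℂ} {z : Cn n} (h : a =ᶠ[nhds z] fun _ => 0)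
    (j : Fin n) : dbar a z j = 0 := by
  rw [dbar_congr h, dbar_const]

lemma dstar_eq_zero {W : Cn n → ℝ} {α : Fin n → Cn n → ℂ} {z : Cn n}
    (h : ∀ j, α j =ᶠ[nhds z] fun _ => 0) : dstar W α z = 0 := by
  simp [dstar, delW_eq_zero (h _)]

lemma curl_eq_zero {α : Fin n → Cn n → ℂ} {z : Cn n}
    (h : ∀ j, α j =ᶠ[nhds z] fun _ => 0) (j k : Fin n) : curl α z j k = 0 := by
  simp [curl, dbar_eq_zero (h _)]

section Weight

variable {Ω : Set (Cn n)} (hΩ : IsOpen Ω) {W : Cn n → ℝ} (hW : ContDiffOn ℝ 2 W Ω)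

include hΩ

lemma continuousOn_curl {α : Fin n → Cn n → ℂ} (hα : ∀ j, ContDiffOn ℝ 1 (α j) Ω) (j k : Fin n) :
    ContinuousOn (fun z => curl α z j k) Ω :=
  (contDiffOn_dbar (l := 0) hΩ (hα k) (by norm_num) j).continuousOn.sub
    (contDiffOn_dbar (l := 0) hΩ (hα j) (by norm_num) k).continuousOn

include hW

lemma continuousOn_dstar {α : Fin n → Cn n → ℂ} (hα : ∀ j, ContDiffOn ℝ 1 (α j) Ω) :
    ContinuousOn (dstar W α) Ω :=
  (continuousOn_finsetSum _ fun j _ =>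
    (contDiffOn_delW (l := 0) hΩ hW (hα j) (by norm_num) (by norm_num) j).continuousOn).neg

lemma continuousOn_energy {α : Fin n → Cn n → ℂ} (hα : ∀ j, ContDiffOn ℝ 1 (α j) Ω) :
    ContinuousOn (energy W α) Ω :=
  ((continuousOn_dstar hΩ hW hα).norm.pow 2).add (continuousOn_const.mul
    (continuousOn_finsetSum _ fun j _ => continuousOn_finsetSum _ fun k _ =>
      (continuousOn_curl hΩ hα j k).norm.pow 2))

lemma integrable_energy {α : Fin n → Cn n → ℂ} (hα : TForm Ω α) {m : Cn n → ℝ}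
    (hm : ContinuousOn m Ω) :
    Integrable (fun z => m z * energy W α z * ew W z) := by
  obtain ⟨S, hS, hSΩ, h0⟩ := hα.exists_compact
  refine integrable_of_vanish hΩ ((hm.mul (continuousOn_energy hΩ hW fun j =>
    ((hα j).contDiff.of_le (by norm_num)).contDiffOn)).mul (contDiffOn_ew hW).continuousOn) hS hSΩ
    fun z hz => ?_
  simp [energy, dstar_eq_zero (h0 z hz), curl_eq_zero (h0 z hz)]

lemma integrable_nsq {α : Fin n → Cn n → ℂ} (hα : TForm Ω α) {m : Cn n → ℝ}
    (hm : ContinuousOn m Ω) :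
    Integrable (fun z => m z * nsq α z * ew W z) := by
  obtain ⟨S, hS, hSΩ, h0⟩ := hα.exists_compact
  refine integrable_of_vanish hΩ ((hm.mul (continuousOn_finsetSum _ fun j _ =>
    ((hα j).continuous.norm.pow 2).continuousOn)).mul (contDiffOn_ew hW).continuousOn) hS hSΩ
    fun z hz => ?_
  simp [nsq, fun j => (h0 z hz j).eq_of_nhds]

/-- The Bochner inequality. -/
lemma bochner {lam : Cn n → ℝ} (hlam : ContinuousOn lam Ω)
    (hL : ∀ z ∈ Ω, ∀ w, lam z * ‖w‖ ^ 2 ≤ LeviForm W z w)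
    {α : Fin n → Cn n → ℂ} (hα : TForm Ω α) :
    ∫ z, lam z * nsq α z * ew W z ≤ ∫ z, energy W α z * ew W z := by
  have hE : ContinuousOn (fun w => (ew W w : ℂ)) Ω :=
    (contDiffOn_ofReal (contDiffOn_ew hW)).continuousOn
  obtain ⟨S, hS, hSΩ, h0⟩ := hα.exists_compact
  set R : Fin n → Fin n → Cn n → ℂ := fun j k z =>
    (delW W (α j) z j * conj (delW W (α k) z k) - dbar (α j) z k * conj (dbar (α k) z j)
      - conj (dbar (fun w => del (fun w => (W w : ℂ)) w k) z j) * α j z * conj (α k z)) * ew W z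
    with hR
  have cj : Continuous (starRingEnd ℂ) := Complex.continuous_conj
  have cα : ∀ j, ContDiffOn ℝ 1 (α j) Ω := fun j =>
    ((hα j).contDiff.of_le (by norm_num)).contDiffOn
  have cdelW : ∀ j k, ContinuousOn (fun z => delW W (α j) z k) Ω := fun j k =>
    (contDiffOn_delW (l := 0) hΩ hW (cα j) (by norm_num) (by norm_num) k).continuousOn
  have cdbar : ∀ j k, ContinuousOn (fun z => dbar (α j) z k) Ω := fun j k =>
    (contDiffOn_dbar (l := 0) hΩ (cα j) (by norm_num) k).continuousOn
  have cL : ∀ j k, ContinuousOn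
      (fun z => dbar (fun w => del (fun w => (W w : ℂ)) w k) z j) Ω := fun j k =>
    (contDiffOn_dbar (l := 0) hΩ
      (contDiffOn_del (l := 1) hΩ (contDiffOn_ofReal hW) (by norm_num) k)
      (by norm_num) j).continuousOn
  have iR : ∀ j k, Integrable (R j k) := fun j k =>
    integrable_of_vanish hΩ
      (((((cdelW j j).mul (cj.comp_continuousOn (cdelW k k))).sub
        ((cdbar j k).mul (cj.comp_continuousOn (cdbar k j)))).sub
        (((cj.comp_continuousOn (cL j k)).mul (cα j).continuousOn).mul
          (cj.comp_continuousOn (cα k).continuousOn))).mul hE) hS hSΩ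
      (fun z hz => by
        simp [hR, delW_eq_zero (h0 z hz _), dbar_eq_zero (h0 z hz _), (h0 z hz _).eq_of_nhds])
  have h1 : ∫ z, ∑ j, ∑ k, R j k z = 0 := by
    rw [integral_finsetSum _ fun j _ => integrable_finsetSum _ fun k _ => iR j k]
    refine Finset.sum_eq_zero fun j _ => ?_
    rw [integral_finsetSum _ fun k _ => iR j k]
    exact Finset.sum_eq_zero fun k _ => integral_delW_delW hΩ hW (hα j) (hα k) j k
  have iRs : Integrable (fun z => ∑ j, ∑ k, R j k z) :=
    integrable_finsetSum _ fun j _ => integrable_finsetSum _ fun k _ => iR j k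
  have h2 : ∫ z, (∑ j, ∑ k, R j k z).re = 0 := by
    have := integral_re iRs
    simp only [RCLike.re_eq_complex_re] at this
    rw [this, h1]; simp
  have i1 : Integrable (fun z => energy W α z * ew W z) := by
    simpa using integrable_energy hΩ hW hα (m := fun _ => 1) continuousOn_const
  have i2 := integrable_nsq hΩ hW hα hlam
  have i3 : Integrable (fun z => (∑ j, ∑ k, R j k z).re) := iRs.re
  have h3 : ∫ z, (energy W α z * ew W z - (∑ j, ∑ k, R j k z).re)
      = ∫ z, energy W α z * ew W z := by
    rw [integral_sub i1 i3, h2, sub_zero]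
  rw [← h3]
  refine integral_mono i2 (i1.sub i3) fun z => ?_
  by_cases hz : z ∈ Ω
  · have hl := hL z hz (WithLp.toLp 2 fun j => α j z)
    rw [← re_sum_levi (hW.contDiffAt (hΩ.mem_nhds hz)), EuclideanSpace.norm_sq_eq] at hl
    have e1 : (∑ j, ∑ k, R j k z).re = ((∑ j, ∑ k, (delW W (α j) z j * conj (delW W (α k) z k)
      - dbar (α j) z k * conj (dbar (α k) z j))).re
      - (∑ j, ∑ k, conj (dbar (fun w => del (fun w => (W w : ℂ)) w k) z j) * α j z
        * conj (α k z)).re) * ew W z := by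
      rw [← Complex.sub_re, ← Complex.re_mul_ofReal, ← Finset.sum_sub_distrib, Finset.sum_mul]
      congr 1
      refine Finset.sum_congr rfl fun j _ => ?_
      rw [← Finset.sum_sub_distrib, Finset.sum_mul]
    have h4 : 0 ≤ ∑ j, ∑ k, ‖dbar (α k) z j‖ ^ 2 :=
      Finset.sum_nonneg fun _ _ => Finset.sum_nonneg fun _ _ => by positivity
    have he := ew_pos W z
    simp only [e1, energy_eq_re_integrand, nsq]
    simp only at hl
    rw [← sub_mul]
    refine mul_le_mul_of_nonneg_right ?_ he.le
    linarith
  · have hz' : ∀ j, α j =ᶠ[nhds z] fun _ => 0 := h0 z fun h => hz (hSΩ h)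
    simp [hR, nsq, energy, dstar_eq_zero hz', curl_eq_zero hz', fun j => (hz' j).eq_of_nhds,
      delW_eq_zero (hz' _), dbar_eq_zero (hz' _)]

end Weight

/-! ### Localization -/

lemma lagrange_identity (b a : Fin n → ℂ) :
    ‖∑ j, conj (b j) * a j‖ ^ 2 + (1 / 2) * ∑ j, ∑ k, ‖b j * a k - b k * a j‖ ^ 2
      = (∑ j, ‖b j‖ ^ 2) * ∑ j, ‖a j‖ ^ 2 := by
  have h1 : ‖∑ j, conj (b j) * a j‖ ^ 2
      = ∑ j, ∑ k, ((conj (b j) * a j) * conj (conj (b k) * a k)).re := by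
    rw [normSq_re, map_sum, Finset.sum_mul_sum]
    simp only [Complex.re_sum]
  have h2 : ∀ j k, ‖b j * a k - b k * a j‖ ^ 2 = ‖b j‖ ^ 2 * ‖a k‖ ^ 2 + ‖b k‖ ^ 2 * ‖a j‖ ^ 2
      - 2 * ((conj (b j) * a j) * conj (conj (b k) * a k)).re := by
    intro j k
    simp only [← Complex.normSq_eq_norm_sq, Complex.normSq_apply]
    simp
    ring
  have h3 : ∑ j, ∑ k, ‖b k‖ ^ 2 * ‖a j‖ ^ 2 = ∑ j, ∑ k, ‖b j‖ ^ 2 * ‖a k‖ ^ 2 := Finset.sum_comm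
  rw [h1, Finset.sum_mul_sum]
  simp only [h2, Finset.sum_add_distrib, Finset.sum_sub_distrib, h3, ← Finset.mul_sum]
  ring

/-- Multiplication of a form by a real function. -/
def smulForm (θ : Cn n → ℝ) (α : Fin n → Cn n → ℂ) : Fin n → Cn n → ℂ :=
  fun j z => (θ z : ℂ) * α j z

/-- `|∂̄θ|²`. -/
def gradSq (θ : Cn n → ℝ) (z : Cn n) : ℝ := ∑ j, ‖dbar (fun w => (θ w : ℂ)) z j‖ ^ 2

lemma gradSq_nonneg (θ : Cn n → ℝ) (z : Cn n) : 0 ≤ gradSq θ z :=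
  Finset.sum_nonneg fun _ _ => by positivity

lemma dstar_smulForm {W θ : Cn n → ℝ} {α : Fin n → Cn n → ℂ} {z : Cn n}
    (hθ : DifferentiableAt ℝ θ z) (hα : ∀ j, DifferentiableAt ℝ (α j) z) :
    dstar W (smulForm θ α) z = θ z * dstar W α z
      - ∑ j, conj (dbar (fun w => (θ w : ℂ)) z j) * α j z := by
  have hθ' : DifferentiableAt ℝ (fun w => (θ w : ℂ)) z :=
    Complex.ofRealCLM.differentiableAt.comp z hθ
  have hs : ∀ j, del (smulForm θ α j) z j
      = del (fun w => (θ w : ℂ)) z j * α j z + θ z * del (α j) z j := fun j => del_mul hθ' (hα j) j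
  simp only [dstar, delW, hs, conj_dbar_real]
  simp only [smulForm]
  rw [mul_neg, Finset.mul_sum, ← neg_add', ← Finset.sum_add_distrib]
  congr 1
  refine Finset.sum_congr rfl fun j _ => ?_
  ring

lemma curl_smulForm {θ : Cn n → ℝ} {α : Fin n → Cn n → ℂ} {z : Cn n}
    (hθ : DifferentiableAt ℝ θ z) (hα : ∀ j, DifferentiableAt ℝ (α j) z) (j k : Fin n) :
    curl (smulForm θ α) z j k = θ z * curl α z j k
      + (dbar (fun w => (θ w : ℂ)) z j * α k z - dbar (fun w => (θ w : ℂ)) z k * α j z) := by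
  have hθ' : DifferentiableAt ℝ (fun w => (θ w : ℂ)) z :=
    Complex.ofRealCLM.differentiableAt.comp z hθ
  have hs : ∀ j k, dbar (smulForm θ α j) z k
      = dbar (fun w => (θ w : ℂ)) z k * α j z + θ z * dbar (α j) z k :=
    fun j k => dbar_mul hθ' (hα j) k
  simp only [curl, hs]
  ring

lemma dbar_ofReal_sq {θ : Cn n → ℝ} {z : Cn n} (hθ : DifferentiableAt ℝ θ z) (j : Fin n) :
    dbar (fun w => ((θ w ^ 2 : ℝ) : ℂ)) z j = 2 * θ z * dbar (fun w => (θ w : ℂ)) z j := by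
  have hθ' : DifferentiableAt ℝ (fun w => (θ w : ℂ)) z :=
    Complex.ofRealCLM.differentiableAt.comp z hθ
  have : (fun w => ((θ w ^ 2 : ℝ) : ℂ)) = fun w => (θ w : ℂ) * θ w := by
    ext w; push_cast; ring
  rw [this, dbar_mul hθ' hθ']; ring

/-- The localization identity for the energy density. -/
lemma energy_smulForm {W θ : Cn n → ℝ} {α : Fin n → Cn n → ℂ} {z : Cn n}
    (hθ : DifferentiableAt ℝ θ z) (hα : ∀ j, DifferentiableAt ℝ (α j) z) :
    energy W (smulForm θ α) z = (energyPol W α (smulForm (fun z => θ z ^ 2) α) z).re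
      + gradSq θ z * nsq α z := by
  have hθ2 : DifferentiableAt ℝ (fun z => θ z ^ 2) z := hθ.pow 2
  have h1 : ∀ (D s : ℂ) (t : ℝ), ‖t * D - s‖ ^ 2
      = (D * conj ((t ^ 2 : ℝ) * D - 2 * t * s)).re + ‖s‖ ^ 2 := by
    intro D s t
    simp only [normSq_re]
    simp [pow_two]
    ring
  have h2 : ∀ (D s : ℂ) (t : ℝ), ‖t * D + s‖ ^ 2
      = (D * conj ((t ^ 2 : ℝ) * D + 2 * t * s)).re + ‖s‖ ^ 2 := by
    intro D s t
    simp only [normSq_re]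
    simp [pow_two]
    ring
  have e1 : dstar W (smulForm (fun z => θ z ^ 2) α) z = (θ z ^ 2 : ℝ) * dstar W α z
      - 2 * θ z * ∑ j, conj (dbar (fun w => (θ w : ℂ)) z j) * α j z := by
    rw [dstar_smulForm hθ2 hα]
    congr 1
    rw [Finset.mul_sum]
    refine Finset.sum_congr rfl fun j _ => ?_
    rw [dbar_ofReal_sq hθ]
    simp only [map_mul, Complex.conj_ofReal, map_ofNat]
    ring
  have e2 : ∀ j k, curl (smulForm (fun z => θ z ^ 2) α) z j k = (θ z ^ 2 : ℝ) * curl α z j k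
      + 2 * θ z * (dbar (fun w => (θ w : ℂ)) z j * α k z
        - dbar (fun w => (θ w : ℂ)) z k * α j z) := by
    intro j k
    rw [curl_smulForm hθ2 hα, dbar_ofReal_sq hθ, dbar_ofReal_sq hθ]
    ring
  have hl := lagrange_identity (fun j => dbar (fun w => (θ w : ℂ)) z j) (fun j => α j z)
  rw [gradSq, nsq, ← hl, energy, energyPol, dstar_smulForm hθ hα, e1, h1]
  simp only [curl_smulForm hθ hα, e2, h2, Finset.sum_add_distrib]
  simp only [Complex.add_re]
  have : ∀ w : ℂ, ((1 / 2 : ℂ) * w).re = 1 / 2 * w.re := by intro w; simp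
  rw [this]
  simp only [Complex.re_sum]
  ring

/-! ### The Hilbert space formulation -/

/-- Values of the pair `(∂̄^*α, ∂̄α)`. -/
abbrev PairSpace (n : ℕ) := EuclideanSpace ℂ (Option (Fin n × Fin n))

/-- The pair `e^{-W/2} (∂̄^*α, ∂̄α / √2)`. -/
def pairFun (W : Cn n → ℝ) (α : Fin n → Cn n → ℂ) (z : Cn n) : PairSpace n :=
  WithLp.toLp 2 fun o => (Real.exp (-W z / 2) : ℂ) *
    match o with
    | none => dstar W α z
    | some (j, k) => (Real.sqrt 2 : ℂ)⁻¹ * curl α z j k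

/-- The pair `e^{-W/2} (F, 0)`. -/
def pairScalar (W : Cn n → ℝ) (F : Cn n → ℂ) (z : Cn n) : PairSpace n :=
  WithLp.toLp 2 fun o => (Real.exp (-W z / 2) : ℂ) *
    match o with
    | none => F z
    | some _ => 0

lemma exp_half_sq (W : Cn n → ℝ) (z : Cn n) :
    Real.exp (-W z / 2) * Real.exp (-W z / 2) = ew W z := by
  rw [← Real.exp_add, ew]; congr 1; ring

lemma sqrt_two_inv_sq : ((Real.sqrt 2 : ℂ)⁻¹) * (Real.sqrt 2 : ℂ)⁻¹ = 1 / 2 := by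
  rw [← mul_inv, ← Complex.ofReal_mul, Real.mul_self_sqrt (by norm_num)]; norm_num

lemma inner_pairFun (W : Cn n → ℝ) (α β : Fin n → Cn n → ℂ) (z : Cn n) :
    inner ℂ (pairFun W α z) (pairFun W β z) = energyPol W β α z * ew W z := by
  have h1 : ∀ x y : ℂ, (Real.exp (-W z / 2) : ℂ) * y * ((Real.exp (-W z / 2) : ℂ) * x)
      = y * x * ew W z := by
    intro x y; rw [← exp_half_sq]; push_cast; ring
  have h2 : ∀ x y : ℂ, ((Real.sqrt 2 : ℂ)⁻¹ * y) * ((Real.sqrt 2 : ℂ)⁻¹ * x)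
      = (1 / 2) * (y * x) := by
    intro x y; rw [← sqrt_two_inv_sq]; ring
  simp only [PiLp.inner_apply, pairFun, Fintype.sum_option, Fintype.sum_prod_type, energyPol,
    RCLike.inner_apply, map_mul, Complex.conj_ofReal, h1, map_inv₀, h2]
  simp only [Finset.mul_sum, add_mul, Finset.sum_mul]

lemma energyPol_self (W : Cn n → ℝ) (α : Fin n → Cn n → ℂ) (z : Cn n) :
    energyPol W α α z = energy W α z := by
  simp only [energyPol, energy, Complex.mul_conj, Complex.normSq_eq_norm_sq]
  push_cast; rfl

lemma norm_pairFun_sq (W : Cn n → ℝ) (α : Fin n → Cn n → ℂ) (z : Cn n) :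
    ‖pairFun W α z‖ ^ 2 = energy W α z * ew W z := by
  have h := inner_self_eq_norm_sq_to_K (𝕜 := ℂ) (pairFun W α z)
  rw [inner_pairFun, energyPol_self] at h
  have h' : ((energy W α z * ew W z : ℝ) : ℂ) = ((‖pairFun W α z‖ ^ 2 : ℝ) : ℂ) := by
    push_cast; simpa using h
  exact (Complex.ofReal_injective h').symm

lemma inner_pairScalar (W : Cn n → ℝ) (F : Cn n → ℂ) (β : Fin n → Cn n → ℂ) (z : Cn n) :
    inner ℂ (pairScalar W F z) (pairFun W β z) = dstar W β z * conj (F z) * ew W z := by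
  simp only [PiLp.inner_apply, pairFun, pairScalar, Fintype.sum_option, RCLike.inner_apply,
    map_mul, Complex.conj_ofReal]
  rw [← exp_half_sq]; push_cast
  simp
  ring

lemma dstar_add {W : Cn n → ℝ} {α β : Fin n → Cn n → ℂ} {z : Cn n}
    (hα : ∀ j, DifferentiableAt ℝ (α j) z) (hβ : ∀ j, DifferentiableAt ℝ (β j) z) :
    dstar W (α + β) z = dstar W α z + dstar W β z := by
  have h : ∀ j, del ((α + β) j) z j = del (α j) z j + del (β j) z j :=
    fun j => del_add (hα j) (hβ j) j
  simp only [dstar, delW, h]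
  rw [← neg_add, ← Finset.sum_add_distrib]
  congr 1
  refine Finset.sum_congr rfl fun j _ => ?_
  simp only [Pi.add_apply]; ring

lemma dstar_smul {W : Cn n → ℝ} {α : Fin n → Cn n → ℂ} {z : Cn n} (c : ℂ)
    (hα : ∀ j, DifferentiableAt ℝ (α j) z) :
    dstar W (c • α) z = c * dstar W α z := by
  have h : ∀ j, del ((c • α) j) z j = c * del (α j) z j := fun j => del_const_mul c (hα j) j
  simp only [dstar, delW, h, mul_neg, Finset.mul_sum]
  congr 1
  refine Finset.sum_congr rfl fun j _ => ?_
  simp only [Pi.smul_apply, smul_eq_mul]; ring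

lemma curl_add {α β : Fin n → Cn n → ℂ} {z : Cn n}
    (hα : ∀ j, DifferentiableAt ℝ (α j) z) (hβ : ∀ j, DifferentiableAt ℝ (β j) z) (j k : Fin n) :
    curl (α + β) z j k = curl α z j k + curl β z j k := by
  have h : ∀ j k, dbar ((α + β) j) z k = dbar (α j) z k + dbar (β j) z k :=
    fun j k => dbar_add (hα j) (hβ j) k
  simp only [curl, h]; ring

lemma curl_smul {α : Fin n → Cn n → ℂ} {z : Cn n} (c : ℂ)
    (hα : ∀ j, DifferentiableAt ℝ (α j) z) (j k : Fin n) :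
    curl (c • α) z j k = c * curl α z j k := by
  have h : ∀ j k, dbar ((c • α) j) z k = c * dbar (α j) z k :=
    fun j k => dbar_const_mul c (hα j) k
  simp only [curl, h]; ring

lemma pairFun_add {W : Cn n → ℝ} {α β : Fin n → Cn n → ℂ} {z : Cn n}
    (hα : ∀ j, DifferentiableAt ℝ (α j) z) (hβ : ∀ j, DifferentiableAt ℝ (β j) z) :
    pairFun W (α + β) z = pairFun W α z + pairFun W β z := by
  ext o
  rcases o with _ | ⟨j, k⟩
  · simp only [pairFun, PiLp.add_apply, dstar_add hα hβ]; ring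
  · simp only [pairFun, PiLp.add_apply, curl_add hα hβ]; ring

lemma pairFun_smul {W : Cn n → ℝ} {α : Fin n → Cn n → ℂ} {z : Cn n} (c : ℂ)
    (hα : ∀ j, DifferentiableAt ℝ (α j) z) :
    pairFun W (c • α) z = c • pairFun W α z := by
  ext o
  rcases o with _ | ⟨j, k⟩
  · simp only [pairFun, PiLp.smul_apply, dstar_smul c hα, smul_eq_mul]; ring
  · simp only [pairFun, PiLp.smul_apply, curl_smul c hα, smul_eq_mul]; ring

/-- The space of test forms. -/
def testForms (Ω : Set (Cn n)) : Submodule ℂ (Fin n → Cn n → ℂ) where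
  carrier := {α | TForm Ω α}
  add_mem' ha hb j := (ha j).add (hb j)
  zero_mem' _ := CcOn.zero
  smul_mem' c _ ha j := (ha j).const_mul c

lemma TForm.differentiableAt {Ω : Set (Cn n)} {α : Fin n → Cn n → ℂ} (h : TForm Ω α) (z : Cn n)
    (j : Fin n) : DifferentiableAt ℝ (α j) z := (h j).differentiable (by norm_num) z

lemma TForm.contDiffOn {Ω : Set (Cn n)} {α : Fin n → Cn n → ℂ} (h : TForm Ω α) (j : Fin n) :
    ContDiffOn ℝ 1 (α j) Ω := ((h j).contDiff.of_le (by norm_num)).contDiffOn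

lemma TForm.smulForm {Ω : Set (Cn n)} (hΩ : IsOpen Ω) {α : Fin n → Cn n → ℂ} (h : TForm Ω α)
    {θ : Cn n → ℝ} (hθ : ContDiffOn ℝ 2 θ Ω) : TForm Ω (smulForm θ α) := fun j =>
  CcOn.mul_left hΩ (contDiffOn_ofReal hθ) (h j)

section Weight

variable {Ω : Set (Cn n)} (hΩ : IsOpen Ω) {W : Cn n → ℝ} (hW : ContDiffOn ℝ 2 W Ω)

include hΩ hW

omit hΩ in
lemma continuousOn_exp_half : ContinuousOn (fun z => (Real.exp (-W z / 2) : ℂ)) Ω := by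
  have h1 : ContinuousOn W Ω := hW.continuousOn
  exact Complex.continuous_ofReal.comp_continuousOn
    (Real.continuous_exp.comp_continuousOn (h1.neg.div_const 2))

lemma memLp_pairFun {α : Fin n → Cn n → ℂ} (hα : TForm Ω α) : MemLp (pairFun W α) 2 volume := by
  obtain ⟨S, hS, hSΩ, h0⟩ := hα.exists_compact
  have hc : ContinuousOn (pairFun W α) Ω := by
    refine (PiLp.continuous_toLp 2 _).comp_continuousOn (continuousOn_pi.2 fun o => ?_)
    refine (continuousOn_exp_half hW).mul ?_
    rcases o with _ | ⟨j, k⟩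
    · exact continuousOn_dstar hΩ hW hα.contDiffOn
    · exact continuousOn_const.mul (continuousOn_curl hΩ hα.contDiffOn j k)
  have := continuous_of_vanish hΩ hc hS hSΩ fun z hz => by
    ext o
    rcases o with _ | ⟨j, k⟩
    · simp [pairFun, dstar_eq_zero (h0 z hz)]
    · simp [pairFun, curl_eq_zero (h0 z hz)]
  exact this.1.memLp_of_hasCompactSupport this.2

lemma memLp_pairScalar {F : Cn n → ℂ} (hF : CcOn Ω 0 F) : MemLp (pairScalar W F) 2 volume := by
  have hc : ContinuousOn (pairScalar W F) Ω := by
    refine (PiLp.continuous_toLp 2 _).comp_continuousOn (continuousOn_pi.2 fun o => ?_)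
    refine (continuousOn_exp_half hW).mul ?_
    rcases o with _ | ⟨j, k⟩
    · exact hF.continuous.continuousOn
    · exact continuousOn_const
  have := continuous_of_vanish hΩ hc hF.compact hF.subset fun z hz => by
    ext o
    rcases o with _ | ⟨j, k⟩
    · simp [pairScalar, image_eq_zero_of_notMem_tsupport hz]
    · simp [pairScalar]
  exact this.1.memLp_of_hasCompactSupport this.2

/-- The map `α ↦ e^{-W/2} (∂̄^*α, ∂̄α / √2)` into `L²`. -/
def pairMap : testForms Ω →ₗ[ℂ] Lp (PairSpace n) 2 (volume : Measure (Cn n)) where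
  toFun α := (memLp_pairFun hΩ hW α.2).toLp
  map_add' α β := by
    rw [← MemLp.toLp_add]
    refine MemLp.toLp_congr _ _ (Filter.Eventually.of_forall fun z => ?_)
    exact pairFun_add (TForm.differentiableAt α.2 z) (TForm.differentiableAt β.2 z)
  map_smul' c α := by
    rw [RingHom.id_apply, ← MemLp.toLp_const_smul]
    refine MemLp.toLp_congr _ _ (Filter.Eventually.of_forall fun z => ?_)
    exact pairFun_smul c (TForm.differentiableAt α.2 z)

omit hΩ hW in
lemma integral_norm_sq_eq {V : Type*} [NormedAddCommGroup V] [InnerProductSpace ℂ V]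
    (X : Lp V 2 (volume : Measure (Cn n))) : ∫ z, ‖X z‖ ^ 2 = ‖X‖ ^ 2 := by
  have h := L2.inner_def (𝕜 := ℂ) X X
  have h2 := inner_self_eq_norm_sq_to_K (𝕜 := ℂ) X
  rw [h] at h2
  simp only [inner_self_eq_norm_sq_to_K] at h2
  have h3 : ((∫ z, ‖X z‖ ^ 2 : ℝ) : ℂ) = ((‖X‖ ^ 2 : ℝ) : ℂ) := by
    rw [← integral_complex_ofReal]; push_cast; simpa using h2
  exact Complex.ofReal_injective h3

omit hΩ hW in
lemma inner_toLp {V : Type*} [NormedAddCommGroup V] [InnerProductSpace ℂ V]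
    (X : Lp V 2 (volume : Measure (Cn n))) {f : Cn n → V} (hf : MemLp f 2 volume) :
    inner ℂ X hf.toLp = ∫ z, inner ℂ (X z) (f z) := by
  rw [L2.inner_def]
  refine integral_congr_ae ?_
  filter_upwards [hf.coeFn_toLp] with z hz
  rw [hz]

omit hΩ hW in
lemma toLp_inner_toLp {V : Type*} [NormedAddCommGroup V] [InnerProductSpace ℂ V]
    {f g : Cn n → V} (hf : MemLp f 2 volume) (hg : MemLp g 2 volume) :
    inner ℂ hf.toLp hg.toLp = ∫ z, inner ℂ (f z) (g z) := by
  rw [L2.inner_def]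
  refine integral_congr_ae ?_
  filter_upwards [hf.coeFn_toLp, hg.coeFn_toLp] with z hz hz'
  rw [hz, hz']

omit hΩ hW in
lemma integral_norm_sub_sq {V : Type*} [NormedAddCommGroup V] [InnerProductSpace ℂ V]
    (X : Lp V 2 (volume : Measure (Cn n))) {f : Cn n → V} (hf : MemLp f 2 volume) :
    ∫ z, ‖X z - f z‖ ^ 2 = ‖X - hf.toLp‖ ^ 2 := by
  rw [← integral_norm_sq_eq]
  refine integral_congr_ae ?_
  filter_upwards [hf.coeFn_toLp, Lp.coeFn_sub X hf.toLp] with z hz hz'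
  rw [hz', Pi.sub_apply, hz]

lemma norm_pairMap_sq (α : testForms Ω) :
    ‖pairMap hΩ hW α‖ ^ 2 = ∫ z, energy W α.1 z * ew W z := by
  rw [← integral_norm_sq_eq]
  refine integral_congr_ae ?_
  filter_upwards [(memLp_pairFun hΩ hW α.2).coeFn_toLp] with z hz
  rw [← norm_pairFun_sq, ← hz]
  rfl

lemma inner_pairMap (α β : testForms Ω) :
    inner ℂ (pairMap hΩ hW α) (pairMap hΩ hW β) = ∫ z, energyPol W β.1 α.1 z * ew W z := by
  rw [show inner ℂ (pairMap hΩ hW α) (pairMap hΩ hW β) = _ from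
    toLp_inner_toLp (memLp_pairFun hΩ hW α.2) (memLp_pairFun hΩ hW β.2)]
  simp only [inner_pairFun]

/-- The pairing of `∂̄^*β` with a test function. -/
lemma inner_pairScalar_pairMap {F : Cn n → ℂ} (hF : CcOn Ω 1 F) (β : testForms Ω) :
    inner ℂ (memLp_pairScalar hΩ hW (hF.mono (by simp))).toLp (pairMap hΩ hW β)
      = ∫ z, (∑ j, β.1 j z * conj (dbar F z j)) * ew W z := by
  rw [show inner ℂ (memLp_pairScalar hΩ hW (hF.mono (by simp))).toLp (pairMap hΩ hW β) = _ from
    toLp_inner_toLp _ (memLp_pairFun hΩ hW β.2)]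
  have hE : ContinuousOn (fun w => (ew W w : ℂ)) Ω :=
    (contDiffOn_ofReal (contDiffOn_ew hW)).continuousOn
  have cj : Continuous (starRingEnd ℂ) := Complex.continuous_conj
  have i1 : ∀ j, Integrable (fun z => delW W (β.1 j) z j * conj (F z) * ew W z) := fun j =>
    integrable_of_vanish hΩ ((((contDiffOn_delW (l := 0) hΩ hW (TForm.contDiffOn β.2 j)
      (by norm_num) (by norm_num) j).continuousOn).mul
      (cj.comp hF.continuous).continuousOn).mul hE) hF.compact hF.subset
      fun z hz => by simp [image_eq_zero_of_notMem_tsupport hz]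
  have i2 : ∀ j, Integrable (fun z => β.1 j z * conj (dbar F z j) * ew W z) := fun j =>
    integrable_of_vanish hΩ (((β.2 j).continuous.continuousOn.mul
      (cj.comp (hF.dbar (l := 0) (by norm_num) j).continuous).continuousOn).mul hE)
      (β.2 j).compact (β.2 j).subset
      fun z hz => by simp [image_eq_zero_of_notMem_tsupport hz]
  simp only [inner_pairScalar, dstar, neg_mul, Finset.sum_mul]
  rw [integral_neg, integral_finsetSum _ fun j _ => i1 j, integral_finsetSum _ fun j _ => i2 j,
    ← Finset.sum_neg_distrib]
  refine Finset.sum_congr rfl fun j _ => ?_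
  rw [integral_delW_mul hΩ hW (TForm.contDiffOn β.2 j) hF j, neg_neg]

end Weight

/-! ### The weak solution -/

lemma norm_add_sq_le_two {V : Type*} [NormedAddCommGroup V] (x y : V) :
    ‖x + y‖ ^ 2 ≤ 2 * ‖x‖ ^ 2 + 2 * ‖y‖ ^ 2 := by
  have := norm_add_le x y
  have h0 := norm_nonneg (x + y)
  nlinarith [sq_nonneg (‖x‖ - ‖y‖)]

lemma energy_smulForm_le {W θ : Cn n → ℝ} {α : Fin n → Cn n → ℂ} {z : Cn n}
    (hθ : DifferentiableAt ℝ θ z) (hα : ∀ j, DifferentiableAt ℝ (α j) z) :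
    energy W (smulForm θ α) z ≤ 2 * θ z ^ 2 * energy W α z + 2 * (gradSq θ z * nsq α z) ∧
    θ z ^ 2 * energy W α z ≤ 2 * energy W (smulForm θ α) z + 2 * (gradSq θ z * nsq α z) := by
  have hl := lagrange_identity (fun j => dbar (fun w => (θ w : ℂ)) z j) (fun j => α j z)
  have hn : ∀ w : ℂ, ‖(θ z : ℂ) * w‖ ^ 2 = θ z ^ 2 * ‖w‖ ^ 2 := by
    intro w; rw [norm_mul, mul_pow, Complex.norm_real, Real.norm_eq_abs, sq_abs]
  rw [gradSq, nsq, ← hl, energy, energy, dstar_smulForm hθ hα]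
  simp only [curl_smulForm hθ hα]
  set s := ∑ j, conj (dbar (fun w => (θ w : ℂ)) z j) * α j z
  set D := dstar W α z
  set τ : Fin n → Fin n → ℂ := fun j k => dbar (fun w => (θ w : ℂ)) z j * α k z
    - dbar (fun w => (θ w : ℂ)) z k * α j z with hτ
  have e1 : ‖θ z * D - s‖ ^ 2 ≤ 2 * (θ z ^ 2 * ‖D‖ ^ 2) + 2 * ‖s‖ ^ 2 := by
    have := norm_add_sq_le_two (θ z * D) (-s)
    rwa [← sub_eq_add_neg, norm_neg, hn] at this
  have e2 : θ z ^ 2 * ‖D‖ ^ 2 ≤ 2 * ‖θ z * D - s‖ ^ 2 + 2 * ‖s‖ ^ 2 := by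
    have := norm_add_sq_le_two (θ z * D - s) s
    rwa [sub_add_cancel, hn] at this
  have f1 : ∑ j, ∑ k, ‖θ z * curl α z j k + τ j k‖ ^ 2
      ≤ 2 * (θ z ^ 2 * ∑ j, ∑ k, ‖curl α z j k‖ ^ 2) + 2 * ∑ j, ∑ k, ‖τ j k‖ ^ 2 := by
    simp only [Finset.mul_sum, ← Finset.sum_add_distrib]
    refine Finset.sum_le_sum fun j _ => Finset.sum_le_sum fun k _ => ?_
    have := norm_add_sq_le_two (θ z * curl α z j k) (τ j k)
    rwa [hn] at this
  have f2 : θ z ^ 2 * ∑ j, ∑ k, ‖curl α z j k‖ ^ 2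
      ≤ 2 * (∑ j, ∑ k, ‖θ z * curl α z j k + τ j k‖ ^ 2) + 2 * ∑ j, ∑ k, ‖τ j k‖ ^ 2 := by
    simp only [Finset.mul_sum, ← Finset.sum_add_distrib]
    refine Finset.sum_le_sum fun j _ => Finset.sum_le_sum fun k _ => ?_
    have := norm_add_sq_le_two (θ z * curl α z j k + τ j k) (-τ j k)
    rwa [add_neg_cancel_right, norm_neg, hn] at this
  constructor <;> nlinarith

lemma gradSq_sq {θ : Cn n → ℝ} {z : Cn n} (hθ : DifferentiableAt ℝ θ z) :
    gradSq (fun z => θ z ^ 2) z = 4 * θ z ^ 2 * gradSq θ z := by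
  simp only [gradSq, dbar_ofReal_sq hθ, Finset.mul_sum]
  refine Finset.sum_congr rfl fun j _ => ?_
  simp only [norm_mul, Complex.norm_real, mul_pow, Real.norm_eq_abs, sq_abs]
  norm_num

lemma nsq_smulForm (θ : Cn n → ℝ) (α : Fin n → Cn n → ℂ) (z : Cn n) :
    nsq (smulForm θ α) z = θ z ^ 2 * nsq α z := by
  simp only [nsq, smulForm, Finset.mul_sum, norm_mul, mul_pow, Complex.norm_real,
    Real.norm_eq_abs, sq_abs]

lemma continuousOn_gradSq {Ω : Set (Cn n)} (hΩ : IsOpen Ω) {θ : Cn n → ℝ}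
    (hθ : ContDiffOn ℝ 2 θ Ω) : ContinuousOn (gradSq θ) Ω :=
  continuousOn_finsetSum _ fun j _ => (contDiffOn_dbar (l := 0) hΩ (contDiffOn_ofReal hθ)
    (by norm_num) j).continuousOn.norm.pow 2

section Weight

variable {Ω : Set (Cn n)} (hΩ : IsOpen Ω) {W : Cn n → ℝ} (hW : ContDiffOn ℝ 2 W Ω)

lemma exists_projection {F : Cn n → ℂ} (hF : CcOn Ω 1 F) :
    ∃ X : Lp (PairSpace n) 2 (volume : Measure (Cn n)),
      (∀ ε > 0, ∃ α : testForms Ω, ‖pairMap hΩ hW α - X‖ < ε) ∧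
      ∀ β : testForms Ω, inner ℂ X (pairMap hΩ hW β)
        = ∫ z, (∑ j, β.1 j z * conj (dbar F z j)) * ew W z := by
  set S := (LinearMap.range (pairMap hΩ hW)).topologicalClosure with hS
  set Y := (memLp_pairScalar hΩ hW (hF.mono (by simp))).toLp
  have hc : IsClosed (S : Set (Lp (PairSpace n) 2 (volume : Measure (Cn n)))) :=
    Submodule.isClosed_topologicalClosure _
  have : CompleteSpace S := hc.completeSpace_coe
  refine ⟨S.starProjection Y, fun ε hε => ?_, fun β => ?_⟩
  · have h : S.starProjection Y ∈ S := Submodule.starProjection_apply_mem _ _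
    have h : S.starProjection Y ∈ closure (LinearMap.range (pairMap hΩ hW) : Set _) := h
    rw [Metric.mem_closure_iff] at h
    obtain ⟨_, ⟨α, rfl⟩, hα⟩ := h ε hε
    exact ⟨α, by rwa [← dist_eq_norm, dist_comm]⟩
  · have hm : pairMap hΩ hW β ∈ S := Submodule.le_topologicalClosure _ ⟨β, rfl⟩
    rw [← inner_pairScalar_pairMap hΩ hW hF β]
    have := Submodule.inner_right_of_mem_orthogonal hm (Submodule.sub_starProjection_mem_orthogonal (K := S) Y)
    rw [inner_sub_right, sub_eq_zero] at this
    rw [← inner_conj_symm, ← this, inner_conj_symm]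

/-- Multiplication of test forms by real functions. -/
def smulTest {θ : Cn n → ℝ} (hθ : ContDiffOn ℝ 2 θ Ω) (α : testForms Ω) : testForms Ω :=
  ⟨smulForm θ α.1, TForm.smulForm hΩ α.2 hθ⟩

variable {lam : Cn n → ℝ} (hlam : ContinuousOn lam Ω)
    (hL : ∀ z ∈ Ω, ∀ w, lam z * ‖w‖ ^ 2 ≤ LeviForm W z w) {c : ℝ} (hc : 0 < c)
    (hcl : ∀ z ∈ Ω, c ≤ lam z)

include hΩ hW

lemma integrable_energy_one {α : Fin n → Cn n → ℂ} (hα : TForm Ω α) :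
    Integrable (fun z => energy W α z * ew W z) := by
  simpa using integrable_energy hΩ hW hα (m := fun _ => 1) continuousOn_const

lemma norm_pairMap_smulTest_sq {θ : Cn n → ℝ} (hθ : ContDiffOn ℝ 2 θ Ω) (α : testForms Ω) :
    ‖pairMap hΩ hW (smulTest hΩ hθ α)‖ ^ 2
      = (inner ℂ (pairMap hΩ hW α) (pairMap hΩ hW (smulTest hΩ (hθ.pow 2) α))).re
        + ∫ z, gradSq θ z * nsq α.1 z * ew W z := by
  rw [← inner_conj_symm, Complex.conj_re, inner_pairMap, norm_pairMap_sq]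
  have h1 : ∀ z, energy W (smulTest hΩ hθ α).1 z * ew W z
      = (energyPol W α.1 (smulTest hΩ (hθ.pow 2) α).1 z * ew W z).re
        + gradSq θ z * nsq α.1 z * ew W z := by
    intro z
    by_cases hz : z ∈ Ω
    · have := energy_smulForm (W := W)
        ((hθ.contDiffAt (hΩ.mem_nhds hz)).differentiableAt (by norm_num))
        (TForm.differentiableAt α.2 z)
      rw [Complex.re_mul_ofReal, ← add_mul]
      congr 1
    · have h0 : ∀ β : testForms Ω, ∀ j, β.1 j =ᶠ[nhds z] fun _ => 0 := fun β j =>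
        notMem_tsupport_iff_eventuallyEq.1 fun h => hz ((β.2 j).subset h)
      simp [energy, energyPol, nsq, dstar_eq_zero (h0 _), curl_eq_zero (h0 _),
        fun j => (h0 α j).eq_of_nhds]
  have i1 : Integrable (fun z => energyPol W α.1 (smulTest hΩ (hθ.pow 2) α).1 z * ew W z) := by
    have := L2.integrable_inner (𝕜 := ℂ) (pairMap hΩ hW (smulTest hΩ (hθ.pow 2) α))
      (pairMap hΩ hW α)
    refine this.congr ?_
    filter_upwards [(memLp_pairFun hΩ hW α.2).coeFn_toLp,
      (memLp_pairFun hΩ hW (smulTest hΩ (hθ.pow 2) α).2).coeFn_toLp] with z hz hz'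
    rw [← inner_pairFun, ← hz, ← hz']
    rfl
  simp only [h1]
  have i1r : Integrable (fun z =>
      (energyPol W α.1 (smulTest hΩ (hθ.pow 2) α).1 z * ew W z).re) := i1.re
  rw [integral_add i1r (integrable_nsq hΩ hW α.2 (continuousOn_gradSq hΩ hθ))]
  congr 1
  have := integral_re i1
  simpa only [RCLike.re_eq_complex_re] using this

include hL hcl in
lemma bochner_const (α : testForms Ω) :
    c * ∫ z, nsq α.1 z * ew W z ≤ ‖pairMap hΩ hW α‖ ^ 2 := by
  rw [norm_pairMap_sq, ← integral_const_mul]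
  have h := bochner hΩ hW (lam := fun _ => c) continuousOn_const (fun z hz w =>
    (mul_le_mul_of_nonneg_right (hcl z hz) (by positivity)).trans (hL z hz w)) α.2
  simpa only [mul_assoc] using h

include hL hc hcl in
lemma norm_pairMap_smulTest_le {θ : Cn n → ℝ} (hθ : ContDiffOn ℝ 2 θ Ω)
    (hθ1 : ∀ z ∈ Ω, |θ z| ≤ 1) {G : ℝ} (hG : 0 ≤ G) (hθG : ∀ z ∈ Ω, gradSq θ z ≤ G)
    (α : testForms Ω) :
    ‖pairMap hΩ hW (smulTest hΩ (hθ.pow 2) α)‖ ^ 2 ≤ (2 + 8 * G / c) * ‖pairMap hΩ hW α‖ ^ 2 := by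
  have hB := bochner_const hΩ hW hL hcl α
  have i1 := integrable_energy_one hΩ hW α.2
  have i2 : Integrable (fun z => nsq α.1 z * ew W z) := by
    simpa using integrable_nsq hΩ hW α.2 (m := fun _ => 1) continuousOn_const
  have h1 : ‖pairMap hΩ hW (smulTest hΩ (hθ.pow 2) α)‖ ^ 2
      ≤ 2 * ‖pairMap hΩ hW α‖ ^ 2 + 8 * G * ∫ z, nsq α.1 z * ew W z := by
    rw [norm_pairMap_sq, norm_pairMap_sq, ← integral_const_mul, ← integral_const_mul,
      ← integral_add (i1.const_mul _) (i2.const_mul _)]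
    refine integral_mono (integrable_energy_one hΩ hW (smulTest hΩ (hθ.pow 2) α).2)
      ((i1.const_mul _).add (i2.const_mul _)) fun z => ?_
    have he := ew_pos W z
    have hn := nsq_nonneg α.1 z
    have hen := energy_nonneg W α.1 z
    by_cases hz : z ∈ Ω
    · have hd : DifferentiableAt ℝ θ z :=
        (hθ.contDiffAt (hΩ.mem_nhds hz)).differentiableAt (by norm_num)
      have h := (energy_smulForm_le (W := W) (θ := fun z => θ z ^ 2) (hd.pow 2)
        (TForm.differentiableAt α.2 z)).1
      rw [gradSq_sq hd] at h
      have ht : θ z ^ 2 ≤ 1 := (sq_le_one_iff_abs_le_one _).2 (hθ1 z hz)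
      have ht0 := sq_nonneg (θ z)
      have hg0 := gradSq_nonneg θ z
      have hg1 := hθG z hz
      have ht2 : (θ z ^ 2) ^ 2 ≤ 1 := by nlinarith
      have a1 : 2 * (θ z ^ 2) ^ 2 * energy W α.1 z ≤ 2 * energy W α.1 z := by nlinarith
      have a2 : 4 * θ z ^ 2 * gradSq θ z ≤ 4 * G := by nlinarith
      have a3 : 4 * θ z ^ 2 * gradSq θ z * nsq α.1 z ≤ 4 * G * nsq α.1 z := by gcongr
      have : energy W (smulTest hΩ (hθ.pow 2) α).1 z
          ≤ 2 * energy W α.1 z + 8 * G * nsq α.1 z := by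
        refine h.trans ?_
        linarith
      calc _ ≤ (2 * energy W α.1 z + 8 * G * nsq α.1 z) * ew W z := by gcongr
        _ = _ := by ring
    · have h0 : ∀ j, (smulTest hΩ (hθ.pow 2) α).1 j =ᶠ[nhds z] fun _ => 0 := fun j =>
        notMem_tsupport_iff_eventuallyEq.1 fun h => hz (((smulTest hΩ (hθ.pow 2) α).2 j).subset h)
      have : energy W (smulTest hΩ (hθ.pow 2) α).1 z = 0 := by
        simp [energy, dstar_eq_zero h0, curl_eq_zero h0]
      simp only [this, zero_mul]
      positivity
  have h2 : 8 * G * ∫ z, nsq α.1 z * ew W z ≤ 8 * G / c * ‖pairMap hΩ hW α‖ ^ 2 := by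
    rw [div_mul_eq_mul_div, le_div_iff₀ hc]
    nlinarith
  linarith

lemma integral_sq_energy_le {θ : Cn n → ℝ} (hθ : ContDiffOn ℝ 2 θ Ω) (α : testForms Ω) :
    ∫ z, θ z ^ 2 * energy W α.1 z * ew W z ≤ 2 * ‖pairMap hΩ hW (smulTest hΩ hθ α)‖ ^ 2
      + 2 * ∫ z, gradSq θ z * nsq α.1 z * ew W z := by
  have i1 := integrable_energy_one hΩ hW (smulTest hΩ hθ α).2
  have i2 := integrable_nsq hΩ hW α.2 (continuousOn_gradSq hΩ hθ)
  rw [norm_pairMap_sq, ← integral_const_mul, ← integral_const_mul,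
    ← integral_add (i1.const_mul _) (i2.const_mul _)]
  refine integral_mono (integrable_energy hΩ hW α.2 (hθ.continuousOn.pow 2))
    ((i1.const_mul _).add (i2.const_mul _)) fun z => ?_
  have he := ew_pos W z
  by_cases hz : z ∈ Ω
  · have hd : DifferentiableAt ℝ θ z :=
      (hθ.contDiffAt (hΩ.mem_nhds hz)).differentiableAt (by norm_num)
    have h := (energy_smulForm_le (W := W) hd (TForm.differentiableAt α.2 z)).2
    calc _ ≤ (2 * energy W (smulForm θ α.1) z + 2 * (gradSq θ z * nsq α.1 z)) * ew W z := by gcongr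
      _ = _ := by simp only [smulTest]; ring
  · have h0 : ∀ j, α.1 j =ᶠ[nhds z] fun _ => 0 := fun j =>
      notMem_tsupport_iff_eventuallyEq.1 fun h => hz ((α.2 j).subset h)
    have : energy W α.1 z = 0 := by
      simp [energy, dstar_eq_zero h0, curl_eq_zero h0]
    have h1 := energy_nonneg W (smulTest hΩ hθ α).1 z
    have h2 := gradSq_nonneg θ z
    have h3 := nsq_nonneg α.1 z
    simp only [this, mul_zero, zero_mul]
    positivity

/-- Passing from test forms to the limit in weighted estimates. -/
lemma setIntegral_sq_norm_le (X : Lp (PairSpace n) 2 (volume : Measure (Cn n))) {θ : Cn n → ℝ}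
    (hθ : ContDiffOn ℝ 2 θ Ω) (hθ1 : ∀ z ∈ Ω, |θ z| ≤ 1) (α : testForms Ω) :
    ∫ z in Ω, θ z ^ 2 * ‖X z‖ ^ 2 ≤ 2 * (∫ z, θ z ^ 2 * energy W α.1 z * ew W z)
      + 2 * ‖pairMap hΩ hW α - X‖ ^ 2 := by
  have i1 : Integrable (fun z => θ z ^ 2 * energy W α.1 z * ew W z) :=
    integrable_energy hΩ hW α.2 (hθ.continuousOn.pow 2)
  have hXα := integral_norm_sub_sq X (memLp_pairFun hΩ hW α.2)
  have hX2 : Integrable (fun z => ‖X z - pairFun W α.1 z‖ ^ 2) :=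
    ((Lp.memLp X).sub (memLp_pairFun hΩ hW α.2)).integrable_norm_pow (p := 2) (by norm_num)
  have e0 : ‖pairMap hΩ hW α - X‖ ^ 2 = ∫ z, ‖X z - pairFun W α.1 z‖ ^ 2 := by
    rw [hXα, norm_sub_rev]; rfl
  have h1 : ∫ z in Ω, θ z ^ 2 * energy W α.1 z * ew W z
      ≤ ∫ z, θ z ^ 2 * energy W α.1 z * ew W z :=
    setIntegral_le_integral i1 (Filter.Eventually.of_forall fun z => by
      have he := ew_pos W z
      have hen := energy_nonneg W α.1 z
      change 0 ≤ _
      positivity)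
  have h2 : ∫ z in Ω, ‖X z - pairFun W α.1 z‖ ^ 2 ≤ ∫ z, ‖X z - pairFun W α.1 z‖ ^ 2 :=
    setIntegral_le_integral hX2 (Filter.Eventually.of_forall fun z => by
      change 0 ≤ _
      positivity)
  have h3 : ∫ z in Ω, θ z ^ 2 * ‖X z‖ ^ 2 ≤ ∫ z in Ω, (2 * (θ z ^ 2 * energy W α.1 z * ew W z)
      + 2 * ‖X z - pairFun W α.1 z‖ ^ 2) := by
    refine setIntegral_mono_on ?_ ((i1.integrableOn.const_mul 2).add
      (hX2.integrableOn.const_mul 2)) hΩ.measurableSet ?_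
    · have hXi : Integrable (fun z => ‖X z‖ ^ 2) :=
        (Lp.memLp X).integrable_norm_pow (p := 2) (by norm_num)
      refine Integrable.mono' hXi.integrableOn
        (((hθ.continuousOn.pow 2).aestronglyMeasurable hΩ.measurableSet).mul
          hXi.aestronglyMeasurable.restrict) ?_
      refine (ae_restrict_iff' hΩ.measurableSet).2 (Filter.Eventually.of_forall fun z hz => ?_)
      have ht : θ z ^ 2 ≤ 1 := (sq_le_one_iff_abs_le_one _).2 (hθ1 z hz)
      rw [Real.norm_of_nonneg (by positivity)]
      nlinarith [sq_nonneg ‖X z‖]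
    · intro z hz
      have ht : θ z ^ 2 ≤ 1 := (sq_le_one_iff_abs_le_one _).2 (hθ1 z hz)
      have h := norm_add_sq_le_two (pairFun W α.1 z) (X z - pairFun W α.1 z)
      rw [add_sub_cancel, norm_pairFun_sq] at h
      have h4 := sq_nonneg (θ z)
      have h5 := sq_nonneg ‖X z - pairFun W α.1 z‖
      nlinarith [mul_le_mul_of_nonneg_left h h4]
  rw [integral_add (i1.integrableOn.const_mul 2) (hX2.integrableOn.const_mul 2),
    integral_const_mul, integral_const_mul] at h3
  rw [e0]
  linarith

include hlam hL hc hcl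

/-- The weak solution with its interior estimates. -/
theorem exists_weak_solution {F : Cn n → ℂ} (hF : CcOn Ω 1 F) :
    ∃ X : Lp (PairSpace n) 2 (volume : Measure (Cn n)),
      (∀ β : testForms Ω, inner ℂ X (pairMap hΩ hW β)
        = ∫ z, (∑ j, β.1 j z * conj (dbar F z j)) * ew W z) ∧
      (∀ θ : Cn n → ℝ, ContDiffOn ℝ 2 θ Ω → (∀ z ∈ Ω, |θ z| ≤ 1) →
        (∀ z ∈ Ω, gradSq θ z ≤ c / 8 * θ z ^ 2) →
        ∫ z in Ω, θ z ^ 2 * ‖X z‖ ^ 2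
          ≤ 6 / c * ∫ z, θ z ^ 2 * (∑ j, ‖dbar F z j‖ ^ 2) * ew W z) ∧
      (∀ ε > 0, ∃ S : Set (Cn n), IsCompact S ∧ S ⊆ Ω ∧ ∀ (η : Cn n → ℝ) (M G : ℝ),
        ContDiffOn ℝ 2 η Ω → (∀ z ∈ Ω, |η z| ≤ 1) → 0 ≤ M → 0 ≤ G →
        (∀ z ∈ Ω, gradSq η z ≤ G) → (∀ z ∈ Ω, M * gradSq η z ≤ lam z) →
        (∀ z, η z ≠ 0 → ∀ j, dbar F z j = 0) → (∀ z ∈ S, gradSq η z = 0) →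
        M * ∫ z in Ω, η z ^ 2 * ‖X z‖ ^ 2 ≤ ε) := by
  obtain ⟨X, hX1, hX2⟩ := exists_projection hΩ hW hF
  have hdF : ∀ j, CcOn Ω 0 (fun z => dbar F z j) := fun j => hF.dbar (by norm_num) j
  refine ⟨X, hX2, fun θ hθ hθ1 hθ2 => ?_, fun ε hε => ?_⟩
  · set A := ∫ z, θ z ^ 2 * (∑ j, ‖dbar F z j‖ ^ 2) * ew W z with hA
    have iA : Integrable (fun z => θ z ^ 2 * (∑ j, ‖dbar F z j‖ ^ 2) * ew W z) := by
      refine integrable_of_vanish hΩ (((hθ.continuousOn.pow 2).mul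
        (continuousOn_finsetSum _ fun j _ => ((hdF j).continuous.norm.pow 2).continuousOn)).mul
        (contDiffOn_ew hW).continuousOn) hF.compact hF.subset fun z hz => ?_
      have h0 : F =ᶠ[nhds z] fun _ => 0 := notMem_tsupport_iff_eventuallyEq.1 hz
      simp [dbar_eq_zero h0]
    have hG : ∀ z ∈ Ω, gradSq θ z ≤ c / 8 := fun z hz => (hθ2 z hz).trans <| by
      have := (sq_le_one_iff_abs_le_one _).2 (hθ1 z hz)
      nlinarith
    set K := Real.sqrt (2 + 8 * (c / 8) / c) with hK
    have key : ∀ α : testForms Ω, ∫ z in Ω, θ z ^ 2 * ‖X z‖ ^ 2 ≤ 6 / c * A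
        + 12 * (‖pairMap hΩ hW α - X‖ * (K * ‖pairMap hΩ hW α‖))
        + 2 * ‖pairMap hΩ hW α - X‖ ^ 2 := by
      intro α
      have h1 := setIntegral_sq_norm_le hΩ hW X hθ hθ1 α
      have h2 := integral_sq_energy_le hΩ hW hθ α
      have h3 := norm_pairMap_smulTest_sq hΩ hW hθ α
      set Q := ‖pairMap hΩ hW (smulTest hΩ hθ α)‖ ^ 2 with hQ
      set T := smulTest hΩ (hθ.pow 2) α with hT
      have h4 : ‖pairMap hΩ hW T‖ ≤ K * ‖pairMap hΩ hW α‖ := by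
        have := norm_pairMap_smulTest_le hΩ hW hL hc hcl hθ hθ1 (by positivity) hG α
        refine abs_le_of_sq_le_sq' ?_ (by positivity) |>.2
        rw [mul_pow, hK, Real.sq_sqrt (by positivity)]
        exact this
      have i3 : Integrable (fun z => nsq (smulTest hΩ hθ α).1 z * ew W z) := by
        simpa using integrable_nsq hΩ hW (smulTest hΩ hθ α).2 (m := fun _ => 1) continuousOn_const
      set B := ∫ z, nsq (smulTest hΩ hθ α).1 z * ew W z with hB
      have h5 : c * B ≤ Q := bochner_const hΩ hW hL hcl (smulTest hΩ hθ α)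
      have h6 : ∫ z, gradSq θ z * nsq α.1 z * ew W z ≤ c / 8 * B := by
        rw [hB, ← integral_const_mul]
        refine integral_mono (integrable_nsq hΩ hW α.2 (continuousOn_gradSq hΩ hθ))
          (i3.const_mul _) fun z => ?_
        have he := ew_pos W z
        have hn := nsq_nonneg α.1 z
        simp only [smulTest, nsq_smulForm]
        by_cases hz : z ∈ Ω
        · have := hθ2 z hz
          calc _ ≤ c / 8 * θ z ^ 2 * nsq α.1 z * ew W z := by gcongr
            _ = _ := by ring
        · have : nsq α.1 z = 0 := by simp [nsq, fun j => (α.2 j).eq_zero hz]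
          simp [this]
      have h7 : (inner ℂ X (pairMap hΩ hW T)).re ≤ A / (2 * c) + c / 2 * B := by
        rw [hX2, hA, hB, ← integral_const_mul, ← integral_div, ← integral_add (iA.div_const _)
          (i3.const_mul _)]
        have i7 : Integrable (fun z => (∑ j, T.1 j z * conj (dbar F z j)) * ew W z) := by
          simp only [Finset.sum_mul]
          refine integrable_finsetSum _ fun j _ => ?_
          exact integrable_of_vanish hΩ (((T.2 j).continuous.continuousOn.mul
            (Complex.continuous_conj.comp (hdF j).continuous).continuousOn).mul
            (contDiffOn_ofReal (contDiffOn_ew hW)).continuousOn)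
            (T.2 j).compact (T.2 j).subset
            fun z hz => by simp [image_eq_zero_of_notMem_tsupport hz]
        have e7 := integral_re i7
        simp only [RCLike.re_eq_complex_re] at e7
        rw [← e7]
        refine integral_mono i7.re ((iA.div_const _).add (i3.const_mul _)) fun z => ?_
        have he := ew_pos W z
        have en : nsq (smulTest hΩ hθ α).1 z = θ z ^ 2 * ∑ j, ‖α.1 j z‖ ^ 2 :=
          nsq_smulForm θ α.1 z
        simp only [en, Complex.re_mul_ofReal, hT]
        simp only [smulTest, smulForm]
        have : (∑ j, ((θ z ^ 2 : ℝ) : ℂ) * α.1 j z * conj (dbar F z j)).re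
            ≤ θ z ^ 2 * (∑ j, ‖dbar F z j‖ ^ 2) / (2 * c)
              + c / 2 * (θ z ^ 2 * ∑ j, ‖α.1 j z‖ ^ 2) := by
          rw [Complex.re_sum, Finset.mul_sum, Finset.mul_sum, Finset.mul_sum, Finset.sum_div,
            ← Finset.sum_add_distrib]
          refine Finset.sum_le_sum fun j _ => ?_
          refine (Complex.re_le_norm _).trans ?_
          rw [norm_mul, norm_mul, Complex.norm_real, Real.norm_of_nonneg (sq_nonneg _),
            RCLike.norm_conj]
          have h := sq_nonneg (c * ‖α.1 j z‖ - ‖dbar F z j‖)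
          have ht := sq_nonneg (θ z)
          have : ‖α.1 j z‖ * ‖dbar F z j‖ ≤ ‖dbar F z j‖ ^ 2 / (2 * c)
              + c / 2 * ‖α.1 j z‖ ^ 2 := by
            have : ‖dbar F z j‖ ^ 2 / (2 * c) + c / 2 * ‖α.1 j z‖ ^ 2
                - ‖α.1 j z‖ * ‖dbar F z j‖ = (c * ‖α.1 j z‖ - ‖dbar F z j‖) ^ 2 / (2 * c) := by
              field_simp; ring
            have h' : 0 ≤ (c * ‖α.1 j z‖ - ‖dbar F z j‖) ^ 2 / (2 * c) := by positivity
            linarith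
          calc _ = θ z ^ 2 * (‖α.1 j z‖ * ‖dbar F z j‖) := by ring
            _ ≤ θ z ^ 2 * (‖dbar F z j‖ ^ 2 / (2 * c) + c / 2 * ‖α.1 j z‖ ^ 2) := by gcongr
            _ = _ := by ring
        calc _ ≤ (θ z ^ 2 * (∑ j, ‖dbar F z j‖ ^ 2) / (2 * c)
              + c / 2 * (θ z ^ 2 * ∑ j, ‖α.1 j z‖ ^ 2)) * ew W z := by gcongr
          _ = _ := by ring
      have h8 : (inner ℂ (pairMap hΩ hW α) (pairMap hΩ hW T)).re
          ≤ (inner ℂ X (pairMap hΩ hW T)).re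
            + ‖pairMap hΩ hW α - X‖ * (K * ‖pairMap hΩ hW α‖) := by
        have e8 : inner ℂ (pairMap hΩ hW α) (pairMap hΩ hW T) = inner ℂ X (pairMap hΩ hW T)
            + inner ℂ (pairMap hΩ hW α - X) (pairMap hΩ hW T) := by
          rw [inner_sub_left]; ring
        rw [e8, Complex.add_re]
        gcongr
        refine (Complex.re_le_norm _).trans ((norm_inner_le_norm _ _).trans ?_)
        gcongr
      have e1 : A / (2 * c) = 1 / 2 * (A / c) := by field_simp
      have e2 : 6 / c * A = 6 * (A / c) := by ring
      rw [e1] at h7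
      rw [e2]
      nlinarith
    refine le_of_forall_pos_le_add fun ε hε => ?_
    set D := 12 * (K * (‖X‖ + 1)) + 2 with hD
    have hD0 : 0 < D := by positivity
    obtain ⟨α, hα⟩ := hX1 (min 1 (ε / D)) (by positivity)
    have h1 : ‖pairMap hΩ hW α - X‖ ≤ 1 := hα.le.trans (min_le_left _ _)
    have h2 : ‖pairMap hΩ hW α - X‖ * D ≤ ε := by
      rw [← le_div_iff₀ hD0]; exact hα.le.trans (min_le_right _ _)
    have h3 : ‖pairMap hΩ hW α‖ ≤ ‖X‖ + 1 := by
      have := norm_add_le X (pairMap hΩ hW α - X)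
      rw [add_sub_cancel] at this
      linarith
    have hk := key α
    have h0 := norm_nonneg (pairMap hΩ hW α - X)
    have h4 : K * ‖pairMap hΩ hW α‖ ≤ K * (‖X‖ + 1) := by gcongr
    have h5 := mul_le_mul_of_nonneg_left h4 h0
    nlinarith
  · obtain ⟨α₀, hα₀⟩ := hX1 (Real.sqrt ε / 8) (by positivity)
    obtain ⟨S, hS, hSΩ, h0⟩ := TForm.exists_compact α₀.2
    refine ⟨S, hS, hSΩ, fun η M G hη hη1 hM hG0 hG hMl hηF hηS => ?_⟩
    set K := Real.sqrt (2 + 8 * G / c) with hK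
    have key : ∀ α : testForms Ω, M * ∫ z in Ω, η z ^ 2 * ‖X z‖ ^ 2 ≤
        4 * M * (‖pairMap hΩ hW α - X‖ * (K * ‖pairMap hΩ hW α‖))
        + 8 * ‖pairMap hΩ hW (α - α₀)‖ ^ 2 + 2 * M * ‖pairMap hΩ hW α - X‖ ^ 2 := by
      intro α
      have h1 := setIntegral_sq_norm_le hΩ hW X hη hη1 α
      have h2 := integral_sq_energy_le hΩ hW hη α
      have h3 := norm_pairMap_smulTest_sq hΩ hW hη α
      set T := smulTest hΩ (hη.pow 2) α with hT
      have h4 : ‖pairMap hΩ hW T‖ ≤ K * ‖pairMap hΩ hW α‖ := by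
        have := norm_pairMap_smulTest_le hΩ hW hL hc hcl hη hη1 hG0 hG α
        refine abs_le_of_sq_le_sq' ?_ (by positivity) |>.2
        rw [mul_pow, hK, Real.sq_sqrt (by positivity)]
        exact this
      have h7 : inner ℂ X (pairMap hΩ hW T) = 0 := by
        rw [hX2]
        refine integral_eq_zero_of_ae (Filter.Eventually.of_forall fun z => ?_)
        by_cases hz : η z = 0
        · simp [hT, smulTest, smulForm, hz]
        · simp [hηF z hz]
      have h8 : (inner ℂ (pairMap hΩ hW α) (pairMap hΩ hW T)).re
          ≤ ‖pairMap hΩ hW α - X‖ * (K * ‖pairMap hΩ hW α‖) := by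
        have e8 : inner ℂ (pairMap hΩ hW α) (pairMap hΩ hW T)
            = inner ℂ (pairMap hΩ hW α - X) (pairMap hΩ hW T) := by
          rw [inner_sub_left, h7, sub_zero]
        rw [e8]
        refine (Complex.re_le_norm _).trans ((norm_inner_le_norm _ _).trans ?_)
        gcongr
      have h9 : M * ∫ z, gradSq η z * nsq α.1 z * ew W z ≤ ‖pairMap hΩ hW (α - α₀)‖ ^ 2 := by
        rw [norm_pairMap_sq]
        refine le_trans ?_ (bochner hΩ hW hlam hL (α - α₀).2)
        rw [← integral_const_mul]
        refine integral_mono ((integrable_nsq hΩ hW α.2 (continuousOn_gradSq hΩ hη)).const_mul _)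
          (integrable_nsq hΩ hW (α - α₀).2 hlam) fun z => ?_
        have he := ew_pos W z
        have hn := nsq_nonneg (α - α₀).1 z
        by_cases hz : z ∈ Ω
        · have hl := hcl z hz
          by_cases hzS : z ∈ S
          · simp only [hηS z hzS, zero_mul, mul_zero]
            have : 0 ≤ lam z := by linarith
            positivity
          · have e9 : nsq (α - α₀).1 z = nsq α.1 z := by
              simp only [nsq, Submodule.coe_sub, Pi.sub_apply]
              refine Finset.sum_congr rfl fun j _ => ?_
              rw [(h0 z hzS j).eq_of_nhds, sub_zero]
            simp only [e9] at hn ⊢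
            calc _ = M * gradSq η z * nsq α.1 z * ew W z := by ring
              _ ≤ _ := by gcongr; exact hMl z hz
        · have e1 : nsq α.1 z = 0 := by simp [nsq, fun j => (α.2 j).eq_zero hz]
          have e2 : nsq (α - α₀).1 z = 0 := by simp [nsq, fun j => ((α - α₀).2 j).eq_zero hz]
          simp only [e1, e2]
          simp
      have h10 := mul_le_mul_of_nonneg_left h1 hM
      have h11 := mul_le_mul_of_nonneg_left h2 hM
      have h12 := mul_le_mul_of_nonneg_left h8 hM
      rw [h3] at h11
      nlinarith
    refine le_of_forall_pos_le_add fun ε' hε' => ?_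
    set D := 4 * M * (K * (‖X‖ + 1)) + 2 * M + 1 with hD
    have hD0 : 0 < D := by positivity
    obtain ⟨α, hα⟩ := hX1 (min (min 1 (Real.sqrt ε / 8)) (ε' / D)) (by positivity)
    have h1 : ‖pairMap hΩ hW α - X‖ ≤ 1 :=
      hα.le.trans ((min_le_left _ _).trans (min_le_left _ _))
    have h1' : ‖pairMap hΩ hW α - X‖ ≤ Real.sqrt ε / 8 :=
      hα.le.trans ((min_le_left _ _).trans (min_le_right _ _))
    have h2 : ‖pairMap hΩ hW α - X‖ * D ≤ ε' := by
      rw [← le_div_iff₀ hD0]; exact hα.le.trans (min_le_right _ _)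
    have h3 : ‖pairMap hΩ hW α‖ ≤ ‖X‖ + 1 := by
      have := norm_add_le X (pairMap hΩ hW α - X)
      rw [add_sub_cancel] at this
      linarith
    have hk := key α
    have hn0 := norm_nonneg (pairMap hΩ hW α - X)
    have h4 : K * ‖pairMap hΩ hW α‖ ≤ K * (‖X‖ + 1) := by gcongr
    have h5 := mul_le_mul_of_nonneg_left h4 (mul_nonneg hM hn0)
    have h6 : ‖pairMap hΩ hW (α - α₀)‖ ≤ Real.sqrt ε / 4 := by
      rw [map_sub]
      have := norm_sub_le (pairMap hΩ hW α - X) (pairMap hΩ hW α₀ - X)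
      rw [sub_sub_sub_cancel_right] at this
      linarith
    have h7 : ‖pairMap hΩ hW (α - α₀)‖ ^ 2 ≤ ε / 16 := by
      have := pow_le_pow_left₀ (norm_nonneg _) h6 2
      rw [div_pow, Real.sq_sqrt hε.le] at this
      linarith
    have h8 : M * ‖pairMap hΩ hW α - X‖ ^ 2 ≤ M * ‖pairMap hΩ hW α - X‖ := by
      gcongr
      nlinarith
    have h9 : ‖pairMap hΩ hW α - X‖ * D
        = 4 * (M * ‖pairMap hΩ hW α - X‖ * (K * (‖X‖ + 1)))
          + 2 * (M * ‖pairMap hΩ hW α - X‖) + ‖pairMap hΩ hW α - X‖ := by rw [hD]; ring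
    have h10 : 4 * M * (‖pairMap hΩ hW α - X‖ * (K * ‖pairMap hΩ hW α‖))
        = 4 * (M * ‖pairMap hΩ hW α - X‖ * (K * ‖pairMap hΩ hW α‖)) := by ring
    have h11 : 2 * M * ‖pairMap hΩ hW α - X‖ ^ 2 = 2 * (M * ‖pairMap hΩ hW α - X‖ ^ 2) := by ring
    rw [h10, h11] at hk
    linarith

end Weight

/-! ### Locally square integrable functions and the weak equation -/

/-- `f` is square integrable on the compact subsets of `Ω`. -/
def L2loc (Ω : Set (Cn n)) (f : Cn n → ℂ) : Prop :=
  ∀ L, IsCompact L → L ⊆ Ω → MemLp f 2 (volume.restrict L)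

namespace L2loc

variable {Ω : Set (Cn n)} {f g : Cn n → ℂ}

lemma sub (hf : L2loc Ω f) (hg : L2loc Ω g) : L2loc Ω (fun z => f z - g z) :=
  fun L hL hLΩ => (hf L hL hLΩ).sub (hg L hL hLΩ)

lemma integrableOn (hf : L2loc Ω f) {L : Set (Cn n)} (hL : IsCompact L) (hLΩ : L ⊆ Ω) :
    IntegrableOn f L := by
  have : IsFiniteMeasure (volume.restrict L) := ⟨by
    rw [Measure.restrict_apply_univ]; exact hL.measure_lt_top⟩
  exact (hf L hL hLΩ).integrable (by norm_num)

lemma integrableOn_sq (hf : L2loc Ω f) {L : Set (Cn n)} (hL : IsCompact L) (hLΩ : L ⊆ Ω) :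
    IntegrableOn (fun z => ‖f z‖ ^ 2) L :=
  (hf L hL hLΩ).integrable_norm_pow (p := 2) (by norm_num)

lemma continuousOn_mul (hf : L2loc Ω f) (hg : ContinuousOn g Ω) :
    L2loc Ω (fun z => g z * f z) := by
  intro L hL hLΩ
  obtain ⟨C, hC⟩ := hL.exists_bound_of_continuousOn (hg.mono hLΩ)
  have hfL := hf L hL hLΩ
  refine hfL.of_le_mul (c := C) (((hg.mono hLΩ).aestronglyMeasurable hL.measurableSet).mul
    hfL.aestronglyMeasurable) ?_
  refine (ae_restrict_iff' hL.measurableSet).2 (Filter.Eventually.of_forall fun z hz => ?_)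
  rw [norm_mul]
  gcongr
  exact hC z hz

lemma of_continuousOn (hg : ContinuousOn g Ω) : L2loc Ω g := by
  have h1 : L2loc Ω (fun _ => (1 : ℂ)) := fun L hL _ => by
    have : IsFiniteMeasure (volume.restrict L) := ⟨by
      rw [Measure.restrict_apply_univ]; exact hL.measure_lt_top⟩
    exact memLp_const _
  simpa using h1.continuousOn_mul hg

lemma of_memLp (hf : MemLp f 2 volume) : L2loc Ω f := fun _ _ _ => hf.restrict _

lemma integrable_mul (hf : L2loc Ω f) (hg : ContinuousOn g Ω) {S : Set (Cn n)} (hS : IsCompact S)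
    (hSΩ : S ⊆ Ω) (h0 : ∀ z ∉ S, g z = 0) : Integrable (fun z => f z * g z) := by
  have h := (hf.continuousOn_mul hg).integrableOn hS hSΩ
  rw [← integrable_indicator_iff hS.measurableSet] at h
  refine h.congr (Filter.Eventually.of_forall fun z => ?_)
  by_cases hz : z ∈ S
  · simp [hz, mul_comm]
  · simp [hz, h0 z hz]

end L2loc

/-- The scalar component of a weak solution. -/
def scalarPart (W : Cn n → ℝ) (X : Cn n → PairSpace n) (z : Cn n) : ℂ :=
  (Real.exp (W z / 2) : ℂ) * X z none

/-- The antisymmetric component of a weak solution. -/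
def formPart (W : Cn n → ℝ) (X : Cn n → PairSpace n) (j k : Fin n) (z : Cn n) : ℂ :=
  (Real.exp (W z / 2) : ℂ) * ((Real.sqrt 2 : ℂ)⁻¹ * (X z (some (j, k)) - X z (some (k, j))))

lemma formPart_antisymm (W : Cn n → ℝ) (X : Cn n → PairSpace n) (j k : Fin n) (z : Cn n) :
    formPart W X k j z = -formPart W X j k z := by
  simp only [formPart]; ring

lemma exp_half_sq_mul_ew (W : Cn n → ℝ) (z : Cn n) : Real.exp (W z / 2) ^ 2 * ew W z = 1 := by
  rw [ew, sq, ← Real.exp_add, ← Real.exp_add, ← Real.exp_zero]; congr 1; ring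

lemma norm_pairSpace_sq (x : PairSpace n) :
    ‖x‖ ^ 2 = ‖x none‖ ^ 2 + ∑ j, ∑ k, ‖x (some (j, k))‖ ^ 2 := by
  rw [EuclideanSpace.norm_sq_eq, Fintype.sum_option, Fintype.sum_prod_type]

lemma norm_scalarPart_sq_le (W : Cn n → ℝ) (X : Cn n → PairSpace n) (z : Cn n) :
    ‖scalarPart W X z‖ ^ 2 * ew W z ≤ ‖X z‖ ^ 2 := by
  have h := exp_half_sq_mul_ew W z
  have : ‖scalarPart W X z‖ ^ 2 * ew W z = ‖X z none‖ ^ 2 := by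
    rw [scalarPart, norm_mul, Complex.norm_real, Real.norm_of_nonneg (Real.exp_pos _).le, mul_pow,
      mul_right_comm, h, one_mul]
  rw [this, norm_pairSpace_sq]
  have : 0 ≤ ∑ j, ∑ k, ‖X z (some (j, k))‖ ^ 2 := by positivity
  linarith

lemma sum_norm_formPart_sq_le (W : Cn n → ℝ) (X : Cn n → PairSpace n) (z : Cn n) :
    (∑ j, ∑ k, ‖formPart W X j k z‖ ^ 2) * ew W z ≤ 2 * ‖X z‖ ^ 2 := by
  have h := exp_half_sq_mul_ew W z
  have h1 : ∀ j k, ‖formPart W X j k z‖ ^ 2 * ew W z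
      ≤ ‖X z (some (j, k))‖ ^ 2 + ‖X z (some (k, j))‖ ^ 2 := by
    intro j k
    have h2 : ‖formPart W X j k z‖ ^ 2 * ew W z
        = 1 / 2 * ‖X z (some (j, k)) - X z (some (k, j))‖ ^ 2 := by
      rw [formPart, norm_mul, norm_mul, norm_inv, Complex.norm_real, Complex.norm_real,
        Real.norm_of_nonneg (Real.exp_pos _).le, Real.norm_of_nonneg (Real.sqrt_nonneg _),
        mul_pow, mul_pow, inv_pow, Real.sq_sqrt (by norm_num), mul_right_comm, h]
      ring
    rw [h2]
    have h3 := norm_sub_le (X z (some (j, k))) (X z (some (k, j)))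
    nlinarith [sq_nonneg (‖X z (some (j, k))‖ - ‖X z (some (k, j))‖),
      norm_nonneg (X z (some (j, k)) - X z (some (k, j)))]
  rw [norm_pairSpace_sq, Finset.sum_mul]
  simp only [Finset.sum_mul]
  have h4 : ∑ j, ∑ k, ‖formPart W X j k z‖ ^ 2 * ew W z
      ≤ ∑ j, ∑ k, (‖X z (some (j, k))‖ ^ 2 + ‖X z (some (k, j))‖ ^ 2) :=
    Finset.sum_le_sum fun j _ => Finset.sum_le_sum fun k _ => h1 j k
  simp only [Finset.sum_add_distrib] at h4
  have h5 : ∑ j, ∑ k, ‖X z (some (k, j))‖ ^ 2 = ∑ j, ∑ k, ‖X z (some (j, k))‖ ^ 2 :=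
    Finset.sum_comm
  nlinarith [sq_nonneg ‖X z none‖]

lemma memLp_coord {X : Cn n → PairSpace n} (hX : MemLp X 2 volume) (o : Option (Fin n × Fin n)) :
    MemLp (fun z => X z o) 2 volume :=
  (EuclideanSpace.proj (𝕜 := ℂ) o : PairSpace n →L[ℂ] ℂ).comp_memLp' hX

section Relation

variable {Ω : Set (Cn n)} (hΩ : IsOpen Ω) {W : Cn n → ℝ} (hW : ContDiffOn ℝ 2 W Ω)

lemma continuousOn_exp_half_pos (hW : ContinuousOn W Ω) :
    ContinuousOn (fun z => (Real.exp (W z / 2) : ℂ)) Ω :=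
  Complex.continuous_ofReal.comp_continuousOn
    (Real.continuous_exp.comp_continuousOn (hW.div_const 2))

lemma l2loc_scalarPart (hW : ContinuousOn W Ω) {X : Cn n → PairSpace n} (hX : MemLp X 2 volume) :
    L2loc Ω (scalarPart W X) :=
  (L2loc.of_memLp (memLp_coord hX none)).continuousOn_mul (continuousOn_exp_half_pos hW)

lemma l2loc_formPart (hW : ContinuousOn W Ω) {X : Cn n → PairSpace n} (hX : MemLp X 2 volume)
    (j k : Fin n) : L2loc Ω (formPart W X j k) :=
  (L2loc.of_memLp (((memLp_coord hX (some (j, k))).sub (memLp_coord hX (some (k, j)))).const_mul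
    ((Real.sqrt 2 : ℂ)⁻¹))).continuousOn_mul (continuousOn_exp_half_pos hW)

lemma dstar_single (f : Cn n → ℂ) (k : Fin n) (z : Cn n) :
    dstar W (Pi.single k f) z = -delW W f z k := by
  rw [dstar, Finset.sum_eq_single k, Pi.single_eq_same]
  · intro j _ hj
    rw [Pi.single_eq_of_ne hj]
    simp [delW, del]
  · simp

lemma dbar_single (f : Cn n → ℂ) (j k i : Fin n) (z : Cn n) :
    dbar ((Pi.single k f : Fin n → Cn n → ℂ) j) z i = if j = k then dbar f z i else 0 := by
  split_ifs with h
  · rw [h, Pi.single_eq_same]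
  · rw [Pi.single_eq_of_ne h]
    simp [dbar]

lemma conj_curl_sum {X : PairSpace n} (f : Cn n → ℂ) (k : Fin n) (z : Cn n) :
    ∑ i, ∑ l, X (some (i, l)) * conj (curl (Pi.single k f) z i l)
      = ∑ i, (X (some (i, k)) - X (some (k, i))) * conj (dbar f z i) := by
  simp only [curl, dbar_single, map_sub, mul_sub, Finset.sum_sub_distrib, sub_mul]
  congr 1
  · refine Finset.sum_congr rfl fun i _ => ?_
    rw [Finset.sum_eq_single k] <;> simp +contextual
  · rw [Finset.sum_eq_single k] <;> simp +contextual

include hΩ hW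

/-- The first order system satisfied by a weak solution. -/
lemma weak_relation {F : Cn n → ℂ} (hF : CcOn Ω 1 F)
    {X : Lp (PairSpace n) 2 (volume : Measure (Cn n))}
    (hX : ∀ β : testForms Ω, inner ℂ X (pairMap hΩ hW β)
        = ∫ z, (∑ j, β.1 j z * conj (dbar F z j)) * ew W z)
    {b : Cn n → ℂ} (hb : CcOn Ω 2 b) (k : Fin n) :
    ∫ z, (F z - scalarPart W X z) * dbar b z k
      = -∫ z, ∑ i, formPart W X i k z * (del b z i + del (fun w => (W w : ℂ)) z i * b z) := by
  set f : Cn n → ℂ := fun z => (Real.exp (W z) : ℂ) * conj (b z) with hf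
  have hfc : CcOn Ω 2 f := CcOn.mul_left hΩ (contDiffOn_ofReal hW.exp) hb.conjugate
  have hβ : (Pi.single k f : Fin n → Cn n → ℂ) ∈ testForms Ω := by
    intro j
    by_cases h : j = k
    · rw [h, Pi.single_eq_same]; exact hfc
    · rw [Pi.single_eq_of_ne h]; exact CcOn.zero
  have hXL := Lp.memLp X
  have hEe : ∀ z, (Real.exp (W z) : ℂ) * ew W z = 1 := fun z => by
    rw [← Complex.ofReal_mul, ew, ← Real.exp_add]; simp
  have hconj : ∀ z, (fun w => conj (f w)) z = (Real.exp (W z) : ℂ) * b z := fun z => by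
    simp only [hf, map_mul, Complex.conj_ofReal, Complex.conj_conj]
  have key := hX ⟨_, hβ⟩
  rw [show inner ℂ X (pairMap hΩ hW ⟨_, hβ⟩) = _ from inner_toLp X (memLp_pairFun hΩ hW hβ)] at key
  have key2 := congrArg conj key
  rw [← integral_conj, ← integral_conj] at key2
  have hdW : ∀ z ∈ Ω, DifferentiableAt ℝ W z := fun z hz =>
    (hW.contDiffAt (hΩ.mem_nhds hz)).differentiableAt (by norm_num)
  -- pointwise identification of both sides
  have hd1 : ∀ z ∈ Ω, ∀ i, conj (dbar f z i)
      = (Real.exp (W z) : ℂ) * (del b z i + del (fun w => (W w : ℂ)) z i * b z) := by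
    intro z hz i
    rw [conj_dbar, funext hconj]
    have hE : DifferentiableAt ℝ (fun w => (Real.exp (W w) : ℂ)) z :=
      ((contDiffOn_ofReal hW.exp).contDiffAt (hΩ.mem_nhds hz)).differentiableAt (by norm_num)
    rw [del_mul hE (hb.differentiable (by norm_num) z)]
    have h3 := del_ew (W := fun w => -W w) (hdW z hz).neg i
    have h4 : (fun w => ((-W w : ℝ) : ℂ)) = fun w => (-1 : ℂ) * (W w : ℂ) := by ext; simp
    have h5 : DifferentiableAt ℝ (fun w => (W w : ℂ)) z :=
      ((contDiffOn_ofReal hW).contDiffAt (hΩ.mem_nhds hz)).differentiableAt (by norm_num)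
    rw [h4, del_const_mul _ h5] at h3
    simp only [ew, neg_neg] at h3
    rw [h3]; ring
  have hd2 : ∀ z ∈ Ω, conj (delW W f z k) = (Real.exp (W z) : ℂ) * dbar b z k := by
    intro z hz
    have hE : ContDiffOn ℝ 1 f Ω := (hfc.mono (by norm_num)).contDiff.contDiffOn
    have h6 := del_mul_ew hΩ hW hE hz k
    have h7 : (fun w => f w * (ew W w : ℂ)) = fun w => conj (b w) := by
      ext w; rw [hf]; linear_combination conj (b w) * hEe w
    rw [h7] at h6
    have h8 := congrArg conj h6
    rw [conj_del] at h8
    simp only [Complex.conj_conj, map_mul, Complex.conj_ofReal] at h8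
    rw [h8]
    linear_combination (-conj (delW W f z k)) * hEe z
  have hL : ∀ z, conj (inner ℂ (X z) (pairFun W (Pi.single k f) z))
      = -(scalarPart W X z * dbar b z k) + ∑ i, formPart W X i k z *
        (del b z i + del (fun w => (W w : ℂ)) z i * b z) := by
    intro z
    by_cases hz : z ∈ Ω
    · have e1 : conj (inner ℂ (X z) (pairFun W (Pi.single k f) z))
          = (Real.exp (-W z / 2) : ℂ) * (X z none * conj (dstar W (Pi.single k f) z)
            + (Real.sqrt 2 : ℂ)⁻¹ *
              ∑ i, ∑ l, X z (some (i, l)) * conj (curl (Pi.single k f) z i l)) := by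
        simp only [PiLp.inner_apply, pairFun, Fintype.sum_option, Fintype.sum_prod_type,
          RCLike.inner_apply, map_add, map_sum, map_mul, Complex.conj_ofReal, Complex.conj_conj,
          map_inv₀, Finset.mul_sum, mul_add]
        congr 1
        · ring
        · refine Finset.sum_congr rfl fun i _ => Finset.sum_congr rfl fun l _ => ?_
          ring
      have e2 : (Real.exp (-W z / 2) : ℂ) * (Real.exp (W z) : ℂ) = (Real.exp (W z / 2) : ℂ) := by
        rw [← Complex.ofReal_mul, ← Real.exp_add]; congr 2; ring
      rw [e1, conj_curl_sum, dstar_single, map_neg, hd2 z hz]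
      simp only [hd1 z hz, scalarPart, formPart, ← e2, Finset.mul_sum, mul_add]
      congr 1
      · ring
      · refine Finset.sum_congr rfl fun i _ => ?_
        ring
    · have h0 : b =ᶠ[nhds z] fun _ => 0 :=
        notMem_tsupport_iff_eventuallyEq.1 fun h => hz (hb.subset h)
      have h1 : f =ᶠ[nhds z] fun _ => 0 :=
        notMem_tsupport_iff_eventuallyEq.1 fun h => hz (hfc.subset h)
      have h2 : ∀ j, (Pi.single k f : Fin n → Cn n → ℂ) j =ᶠ[nhds z] fun _ => 0 := by
        intro j
        by_cases h : j = k
        · rw [h, Pi.single_eq_same]; exact h1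
        · rw [Pi.single_eq_of_ne h]; rfl
      have h3 : pairFun W (Pi.single k f) z = 0 := by
        ext o
        rcases o with _ | ⟨i, l⟩ <;> simp [pairFun, dstar_eq_zero h2, curl_eq_zero h2]
      have h4 : ∀ i, del b z i = 0 := fun i => by rw [del_congr h0, del_const]
      simp [h3, dbar_eq_zero h0, h4, h0.eq_of_nhds]
  have hR : ∀ z, conj ((∑ j, (Pi.single k f : Fin n → Cn n → ℂ) j z * conj (dbar F z j)) * ew W z)
      = b z * dbar F z k := by
    intro z
    rw [Finset.sum_eq_single k]
    · simp only [Pi.single_eq_same, map_mul, Complex.conj_conj, Complex.conj_ofReal]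
      rw [show conj (f z) = _ from hconj z]
      linear_combination (b z * dbar F z k) * hEe z
    · intro j _ hj
      rw [Pi.single_eq_of_ne hj]; simp
    · simp
  simp only [hL, hR] at key2
  have hWd : ∀ i, ContinuousOn (fun z => del (fun w => (W w : ℂ)) z i) Ω := fun i =>
    (contDiffOn_del (l := 1) hΩ (contDiffOn_ofReal hW) (by norm_num) i).continuousOn
  have hbd := hb.dbar (l := 1) (by norm_num) k
  have i1 : Integrable (fun z => scalarPart W X z * dbar b z k) :=
    (l2loc_scalarPart hW.continuousOn hXL).integrable_mul hbd.continuous.continuousOn hbd.compact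
      hbd.subset fun z hz => image_eq_zero_of_notMem_tsupport (f := fun z => dbar b z k) hz
  have i2 : Integrable (fun z => ∑ i, formPart W X i k z *
        (del b z i + del (fun w => (W w : ℂ)) z i * b z)) := by
    refine integrable_finsetSum _ fun i _ =>
      (l2loc_formPart hW.continuousOn hXL i k).integrable_mul
        ((hb.del (l := 1) (by norm_num) i).continuous.continuousOn.add
          ((hWd i).mul hb.continuous.continuousOn)) hb.compact hb.subset fun z hz => ?_
    have h0 : b =ᶠ[nhds z] fun _ => 0 := notMem_tsupport_iff_eventuallyEq.1 hz
    rw [del_congr h0, del_const, h0.eq_of_nhds]; simp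
  have i3 : Integrable (fun z => F z * dbar b z k) :=
    (L2loc.of_continuousOn (Ω := Ω) hF.continuous.continuousOn).integrable_mul
      hbd.continuous.continuousOn hbd.compact
      hbd.subset fun z hz => image_eq_zero_of_notMem_tsupport (f := fun z => dbar b z k) hz
  have i1' : Integrable (fun z => -(scalarPart W X z * dbar b z k)) := i1.neg
  rw [integral_add i1' i2, integral_neg] at key2
  simp only [sub_mul]
  rw [integral_sub i3 i1]
  have h9 := integral_mul_dbar hΩ hF.contDiff.contDiffOn (hb.mono (by norm_num)) k
  rw [h9]
  have h10 : ∫ z, b z * dbar F z k = ∫ z, dbar F z k * b z := by simp only [mul_comm]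
  rw [h10] at key2
  linear_combination key2

end Relation

/-! ### Radial mollifiers -/

/-- The unnormalized radial bump. -/
def radialBump (z : Cn n) : ℝ := Real.smoothTransition (1 - ‖z‖ ^ 2)

variable (n) in
/-- The total mass of the radial bump. -/
def bumpMass : ℝ := ∫ z : Cn n, radialBump z

/-- The radial mollifier at scale `r`. -/
def moll (r : ℝ) (z : Cn n) : ℝ :=
  (bumpMass n)⁻¹ * ((r ^ Module.finrank ℝ (Cn n))⁻¹ * radialBump (r⁻¹ • z))

lemma contDiff_radialBump : ContDiff ℝ (⊤ : ℕ∞) (radialBump : Cn n → ℝ) :=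
  Real.smoothTransition.contDiff.comp (contDiff_const.sub (contDiff_norm_sq ℝ))

lemma radialBump_eq_zero {z : Cn n} (hz : 1 ≤ ‖z‖) : radialBump z = 0 :=
  Real.smoothTransition.zero_of_nonpos (by nlinarith)

lemma integrable_radialBump : Integrable (radialBump : Cn n → ℝ) := by
  refine contDiff_radialBump.continuous.integrable_of_hasCompactSupport
    (HasCompactSupport.intro (isCompact_closedBall 0 1) fun z hz => radialBump_eq_zero ?_)
  simp only [mem_closedBall, dist_zero_right, not_le] at hz
  exact hz.le

lemma bumpMass_pos : 0 < bumpMass n := by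
  have hc : Continuous (radialBump : Cn n → ℝ) := contDiff_radialBump.continuous
  refine (integral_pos_iff_support_of_nonneg (fun z => Real.smoothTransition.nonneg _)
    integrable_radialBump).2 ?_
  refine (hc.isOpen_support).measure_pos _ ⟨0, ?_⟩
  simp [radialBump]

lemma contDiff_moll (r : ℝ) : ContDiff ℝ (⊤ : ℕ∞) (moll r : Cn n → ℝ) :=
  contDiff_const.mul (contDiff_const.mul (contDiff_radialBump.comp (contDiff_const_smul _)))

lemma continuous_moll (r : ℝ) : Continuous (moll r : Cn n → ℝ) := (contDiff_moll r).continuous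

lemma moll_nonneg {r : ℝ} (hr : 0 < r) (z : Cn n) : 0 ≤ moll r z := by
  have := bumpMass_pos (n := n)
  have h : 0 ≤ radialBump (r⁻¹ • z) := Real.smoothTransition.nonneg _
  rw [moll]; positivity

lemma moll_eq_zero {r : ℝ} (hr : 0 < r) {z : Cn n} (hz : r ≤ ‖z‖) : moll r z = 0 := by
  rw [moll, radialBump_eq_zero, mul_zero, mul_zero]
  rw [norm_smul, norm_inv, Real.norm_of_nonneg hr.le, inv_mul_eq_div, le_div_iff₀ hr]
  linarith

lemma moll_congr (r : ℝ) {z w : Cn n} (h : ‖z‖ = ‖w‖) : moll r z = moll r w := by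
  simp only [moll, radialBump, norm_smul, h]

lemma moll_sub_comm (r : ℝ) (z w : Cn n) : moll r (z - w) = moll r (w - z) :=
  moll_congr r (norm_sub_rev _ _)

lemma moll_le {r : ℝ} (hr : 0 < r) (z : Cn n) :
    moll r z ≤ (bumpMass n)⁻¹ * (r ^ Module.finrank ℝ (Cn n))⁻¹ := by
  have := bumpMass_pos (n := n)
  have h : radialBump (r⁻¹ • z) ≤ 1 := Real.smoothTransition.le_one _
  rw [moll]
  gcongr
  exact mul_le_of_le_one_right (by positivity) h

lemma integral_moll {r : ℝ} (hr : 0 < r) : ∫ z : Cn n, moll r z = 1 := by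
  have := bumpMass_pos (n := n)
  simp only [moll]
  rw [integral_const_mul, integral_const_mul, Measure.integral_comp_inv_smul, abs_of_pos (by positivity),
    smul_eq_mul, ← mul_assoc _ _ (integral _ _), inv_mul_cancel₀ (by positivity), one_mul]
  exact inv_mul_cancel₀ this.ne'

lemma hasCompactSupport_moll {r : ℝ} (hr : 0 < r) : HasCompactSupport (moll r : Cn n → ℝ) :=
  HasCompactSupport.intro (isCompact_closedBall 0 r) fun z hz => moll_eq_zero hr (by
    simp only [mem_closedBall, dist_zero_right, not_le] at hz
    exact hz.le)

lemma integrable_moll {r : ℝ} (hr : 0 < r) : Integrable (moll r : Cn n → ℝ) :=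
  (continuous_moll r).integrable_of_hasCompactSupport (hasCompactSupport_moll hr)

lemma integral_moll_sub {r : ℝ} (hr : 0 < r) (x : Cn n) : ∫ t, moll r (x - t) = 1 := by
  rw [integral_sub_left_eq_self (fun t => moll r t) volume x]; exact integral_moll hr

lemma integrable_moll_sub {r : ℝ} (hr : 0 < r) (x : Cn n) : Integrable (fun t => moll r (x - t)) :=
  (integrable_moll hr).comp_sub_left x

/-- The translated mollifier as a complex-valued test function. -/
lemma ccOn_moll_sub {Ω : Set (Cn n)} {r : ℝ} (hr : 0 < r) {x : Cn n} (hx : closedBall x r ⊆ Ω) :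
    CcOn Ω (⊤ : ℕ∞) (fun t => (moll r (x - t) : ℂ)) := by
  have h0 : ∀ t ∉ closedBall x r, (moll r (x - t) : ℂ) = 0 := fun t ht => by
    rw [moll_eq_zero hr, Complex.ofReal_zero]
    rw [mem_closedBall', not_le, dist_eq_norm] at ht
    exact ht.le
  refine ⟨Complex.ofRealCLM.contDiff.comp ((contDiff_moll r).comp (contDiff_const.sub contDiff_id)),
    HasCompactSupport.intro (isCompact_closedBall x r) h0, ?_⟩
  refine (closure_minimal (fun t ht => ?_) isClosed_closedBall).trans hx
  by_contra h
  exact ht (h0 t h)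

lemma ccOn_moll {r : ℝ} (hr : 0 < r) : CcOn univ (⊤ : ℕ∞) (fun t : Cn n => (moll r t : ℂ)) := by
  refine ⟨Complex.ofRealCLM.contDiff.comp (contDiff_moll r),
    (hasCompactSupport_moll hr).comp_left Complex.ofReal_zero, subset_univ _⟩

/-- Mollification at scale `r`. -/
def mollify (r : ℝ) (f : Cn n → ℂ) (x : Cn n) : ℂ := ∫ t, f t * (moll r (x - t) : ℂ)

section Mollify

variable {f : Cn n → ℂ} (hf : Integrable f) {r : ℝ} (hr : 0 < r)

lemma mollify_eq_convolution (f : Cn n → ℂ) (r : ℝ) :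
    mollify r f = convolution f (fun t => (moll r t : ℂ)) (ContinuousLinearMap.mul ℝ ℂ) volume := by
  ext x; rfl

include hf hr

lemma contDiff_mollify : ContDiff ℝ (⊤ : ℕ∞) (mollify r f) := by
  rw [mollify_eq_convolution]
  exact (ccOn_moll hr).compact.contDiff_convolution_right _ hf.locallyIntegrable
    (ccOn_moll hr).contDiff

lemma fderiv_mollify (x v : Cn n) :
    fderiv ℝ (mollify r f) x v
      = ∫ t, f t * fderiv ℝ (fun t : Cn n => (moll r t : ℂ)) (x - t) v := by
  have hb := ccOn_moll (n := n) hr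
  have hb1 : ContDiff ℝ 1 (fun t : Cn n => (moll r t : ℂ)) := hb.contDiff.of_le (by norm_cast)
  have h := hb.compact.hasFDerivAt_convolution_right (ContinuousLinearMap.mul ℝ ℂ)
    hf.locallyIntegrable hb1 x
  rw [mollify_eq_convolution, h.fderiv, convolution, ContinuousLinearMap.integral_apply]
  · rfl
  · exact (hb.compact.fderiv (𝕜 := ℝ)).convolutionExists_right _ hf.locallyIntegrable
      (hb1.continuous_fderiv (by simp)) x

lemma integrable_mul_fderiv_moll (x v : Cn n) :
    Integrable (fun t => f t * fderiv ℝ (fun t : Cn n => (moll r t : ℂ)) (x - t) v) := by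
  have hb := ccOn_moll (n := n) hr
  have hc : Continuous (fun t : Cn n => fderiv ℝ (fun t : Cn n => (moll r t : ℂ)) t v) :=
    (hb.contDiff.continuous_fderiv (by simp)).clm_apply continuous_const
  have hcs : HasCompactSupport
      (fun t : Cn n => fderiv ℝ (fun t : Cn n => (moll r t : ℂ)) t v) :=
    hb.compact.fderiv_apply (𝕜 := ℝ) v
  obtain ⟨C, hC⟩ := hc.bounded_above_of_compact_support hcs
  exact hf.mul_bdd (c := C) ((hc.comp (continuous_const.sub continuous_id)).aestronglyMeasurable)
    (Filter.Eventually.of_forall fun t => hC _)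

lemma dbar_mollify (x : Cn n) (j : Fin n) :
    dbar (mollify r f) x j = ∫ t, f t * dbar (fun t : Cn n => (moll r t : ℂ)) (x - t) j := by
  have h1 := integrable_mul_fderiv_moll hf hr x (e n j)
  have h2 := integrable_mul_fderiv_moll hf hr x (I • e n j)
  simp only [dbar]
  rw [fderiv_mollify hf hr, fderiv_mollify hf hr, ← integral_const_mul, ← integral_add h1
    (h2.const_mul _), ← integral_const_mul]
  refine integral_congr_ae (Filter.Eventually.of_forall fun t => ?_)
  simp only; ring

lemma del_mollify (x : Cn n) (j : Fin n) :
    del (mollify r f) x j = ∫ t, f t * del (fun t : Cn n => (moll r t : ℂ)) (x - t) j := by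
  have h1 := integrable_mul_fderiv_moll hf hr x (e n j)
  have h2 := integrable_mul_fderiv_moll hf hr x (I • e n j)
  simp only [del]
  rw [fderiv_mollify hf hr, fderiv_mollify hf hr, ← integral_const_mul, ← integral_sub h1
    (h2.const_mul _), ← integral_const_mul]
  refine integral_congr_ae (Filter.Eventually.of_forall fun t => ?_)
  simp only; ring

lemma integrable_mul_moll_sub (x : Cn n) : Integrable (fun t => f t * (moll r (x - t) : ℂ)) :=
  hf.mul_bdd (c := (bumpMass n)⁻¹ * (r ^ Module.finrank ℝ (Cn n))⁻¹)
    (Complex.continuous_ofReal.comp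
      ((continuous_moll r).comp (continuous_const.sub continuous_id))).aestronglyMeasurable
    (Filter.Eventually.of_forall fun t => by
      rw [Complex.norm_real, Real.norm_of_nonneg (moll_nonneg hr _)]; exact moll_le hr _)

/-- Fubini for mollification against a compactly supported function. -/
lemma integrable_prod_moll {g : Cn n → ℂ} (hg : Integrable g) :
    Integrable (fun p : Cn n × Cn n => f p.1 * (moll r (p.2 - p.1) : ℂ) * g p.2)
      (volume.prod volume) := by
  have hm : Continuous (fun p : Cn n × Cn n => (moll r (p.2 - p.1) : ℂ)) :=
    Complex.continuous_ofReal.comp ((continuous_moll r).comp (continuous_snd.sub continuous_fst))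
  have h := (hf.mul_prod hg).mul_bdd (c := (bumpMass n)⁻¹ * (r ^ Module.finrank ℝ (Cn n))⁻¹)
    hm.aestronglyMeasurable (Filter.Eventually.of_forall fun t => by
      rw [Complex.norm_real, Real.norm_of_nonneg (moll_nonneg hr _)]; exact moll_le hr _)
  refine h.congr (Filter.Eventually.of_forall fun p => ?_)
  simp only; ring

lemma integral_mollify_mul {g : Cn n → ℂ} (hg : Integrable g) :
    ∫ x, mollify r f x * g x = ∫ t, f t * mollify r g t := by
  have h := integrable_prod_moll hf hr hg
  have h1 : ∀ x, mollify r f x * g x = ∫ t, f t * (moll r (x - t) : ℂ) * g x := fun x => by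
    rw [integral_mul_const]; rfl
  have h2 : ∀ t, f t * mollify r g t = ∫ x, f t * (moll r (x - t) : ℂ) * g x := fun t => by
    rw [mollify, ← integral_const_mul]
    refine integral_congr_ae (Filter.Eventually.of_forall fun x => ?_)
    simp only [moll_sub_comm r t x]; ring
  simp only [h1, h2]
  exact (integral_integral_swap (f := fun t x => f t * (moll r (x - t) : ℂ) * g x) h).symm

omit hf in
/-- Mollification of a function with small oscillation. -/
lemma norm_mollify_sub_le {g : Cn n → ℂ} (hg : Integrable g) {ω : ℝ} {t : Cn n}
    (hω : ∀ x, ‖t - x‖ ≤ r → ‖g x - g t‖ ≤ ω) : ‖mollify r g t - g t‖ ≤ ω := by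
  have i1 := integrable_moll_sub hr t
  have i1c : Integrable (fun x => (moll r (t - x) : ℂ)) := i1.ofReal
  have h1 : g t = ∫ x, g t * (moll r (t - x) : ℂ) := by
    rw [integral_const_mul, integral_complex_ofReal, integral_moll_sub hr]; simp
  have h2 : mollify r g t - g t = ∫ x, (g x - g t) * (moll r (t - x) : ℂ) := by
    simp only [sub_mul]
    rw [integral_sub (integrable_mul_moll_sub hg hr t) (i1c.const_mul _), ← h1]; rfl
  rw [h2]
  calc _ ≤ ∫ x, ω * moll r (t - x) := by
        refine norm_integral_le_of_norm_le (i1.const_mul _) (Filter.Eventually.of_forall fun x => ?_)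
        rw [norm_mul, Complex.norm_real, Real.norm_of_nonneg (moll_nonneg hr _)]
        by_cases hx : ‖t - x‖ ≤ r
        · exact mul_le_mul_of_nonneg_right (hω x hx) (moll_nonneg hr _)
        · rw [moll_eq_zero hr (not_le.1 hx).le]; simp
    _ = ω := by rw [integral_const_mul, integral_moll_sub hr, mul_one]

lemma norm_integral_mollify_mul_sub_le {g : Cn n → ℂ} (hg : Continuous g)
    (hgc : HasCompactSupport g) {ω : ℝ} (hω : ∀ t x, ‖t - x‖ ≤ r → ‖g x - g t‖ ≤ ω) :
    ‖(∫ x, mollify r f x * g x) - ∫ t, f t * g t‖ ≤ ω * ∫ t, ‖f t‖ := by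
  have hgi : Integrable g := hg.integrable_of_hasCompactSupport hgc
  obtain ⟨C, hC⟩ := hg.bounded_above_of_compact_support hgc
  have hmc : Continuous (mollify r g) := (contDiff_mollify hgi hr).continuous
  have hd : ∀ t, ‖mollify r g t - g t‖ ≤ ω := fun t => norm_mollify_sub_le hr hgi (hω t)
  have i1 : Integrable (fun t => f t * g t) :=
    hf.mul_bdd (c := C) hg.aestronglyMeasurable (Filter.Eventually.of_forall hC)
  have i2 : Integrable (fun t => f t * (mollify r g t - g t)) :=
    hf.mul_bdd (c := ω) (hmc.sub hg).aestronglyMeasurable (Filter.Eventually.of_forall hd)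
  have h1 : ∫ t, f t * mollify r g t = ∫ t, (f t * (mollify r g t - g t) + f t * g t) := by
    congr 1; ext t; ring
  rw [integral_mollify_mul hf hr hgi, h1, integral_add i2 i1, add_sub_cancel_right,
    ← integral_const_mul]
  refine norm_integral_le_of_norm_le (hf.norm.const_mul _) (Filter.Eventually.of_forall fun t => ?_)
  rw [norm_mul, mul_comm]
  exact mul_le_mul_of_nonneg_right (hd t) (norm_nonneg _)

/-- Jensen's inequality for mollification with an additional bounded factor. -/
lemma norm_integral_mul_moll_sq_le (hf2 : Integrable (fun t => ‖f t‖ ^ 2)) {x : Cn n} {w : Cn n → ℂ}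
    {ω : ℝ} (hw : ∀ t, ‖x - t‖ ≤ r → f t ≠ 0 → ‖w t‖ ≤ ω) :
    ‖∫ t, f t * w t * (moll r (x - t) : ℂ)‖ ^ 2 ≤ ω ^ 2 * ∫ t, ‖f t‖ ^ 2 * moll r (x - t) := by
  have i0 := integrable_moll_sub hr x
  have i1 : Integrable (fun t => ‖f t‖ * moll r (x - t)) := by
    refine (integrable_mul_moll_sub hf hr x).norm.congr (Filter.Eventually.of_forall fun t => ?_)
    simp only [norm_mul, Complex.norm_real, Real.norm_of_nonneg (moll_nonneg hr _)]
  have i2 : Integrable (fun t => ‖f t‖ ^ 2 * moll r (x - t)) :=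
    hf2.mul_bdd (c := (bumpMass n)⁻¹ * (r ^ Module.finrank ℝ (Cn n))⁻¹)
      ((continuous_moll r).comp (continuous_const.sub continuous_id)).aestronglyMeasurable
      (Filter.Eventually.of_forall fun t => by
        rw [Real.norm_of_nonneg (moll_nonneg hr _)]; exact moll_le hr _)
  set m := ∫ t, ‖f t‖ * moll r (x - t) with hm
  have h1 : ‖∫ t, f t * w t * (moll r (x - t) : ℂ)‖ ≤ ω * m := by
    rw [hm, ← integral_const_mul]
    refine norm_integral_le_of_norm_le (i1.const_mul _) (Filter.Eventually.of_forall fun t => ?_)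
    rw [norm_mul, norm_mul, Complex.norm_real, Real.norm_of_nonneg (moll_nonneg hr _)]
    by_cases ht : ‖x - t‖ ≤ r
    · by_cases hft : f t = 0
      · simp [hft]
      · have := hw t ht hft
        have h3 := moll_nonneg hr (x - t)
        calc _ ≤ ‖f t‖ * ω * moll r (x - t) := by gcongr
          _ = _ := by ring
    · rw [moll_eq_zero hr (not_le.1 ht).le]; simp
  have h2 : 0 ≤ ∫ t, (‖f t‖ - m) ^ 2 * moll r (x - t) :=
    integral_nonneg fun t => mul_nonneg (sq_nonneg _) (moll_nonneg hr _)
  have h3 : ∫ t, (‖f t‖ - m) ^ 2 * moll r (x - t)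
      = (∫ t, ‖f t‖ ^ 2 * moll r (x - t)) - 2 * m * m + m ^ 2 := by
    have e1 : ∀ t, (‖f t‖ - m) ^ 2 * moll r (x - t) = (‖f t‖ ^ 2 * moll r (x - t)
        - 2 * m * (‖f t‖ * moll r (x - t))) + m ^ 2 * moll r (x - t) := fun t => by ring
    simp only [e1]
    have i3 : Integrable (fun t => ‖f t‖ ^ 2 * moll r (x - t)
        - 2 * m * (‖f t‖ * moll r (x - t))) := i2.sub (i1.const_mul _)
    rw [integral_add i3 (i0.const_mul _), integral_sub i2 (i1.const_mul _), integral_const_mul,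
      integral_const_mul, integral_moll_sub hr, mul_one]
  have h4 : ‖∫ t, f t * w t * (moll r (x - t) : ℂ)‖ ^ 2 ≤ (ω * m) ^ 2 :=
    pow_le_pow_left₀ (norm_nonneg _) h1 2
  nlinarith [sq_nonneg ω]

end Mollify

/-! ### Weak solutions are weakly holomorphic -/

lemma exists_uniform_modulus {F : Type*} [NormedAddCommGroup F] {g : Cn n → F} (hg : Continuous g)
    (hgc : HasCompactSupport g) {ω : ℝ} (hω : 0 < ω) :
    ∃ r0 > 0, ∀ t x, ‖t - x‖ ≤ r0 → ‖g x - g t‖ ≤ ω := by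
  have h := hgc.uniformContinuous_of_continuous hg
  rw [Metric.uniformContinuous_iff] at h
  obtain ⟨d, hd, h⟩ := h ω hω
  refine ⟨d / 2, by positivity, fun t x htx => ?_⟩
  have := h (a := x) (b := t) (by rw [dist_comm, dist_eq_norm]; linarith)
  rw [dist_eq_norm] at this
  exact this.le

/-- The mollified squared norm. -/
def sqMoll (r : ℝ) (f : Cn n → ℂ) (x : Cn n) : ℝ := ∫ t, ‖f t‖ ^ 2 * moll r (x - t)

lemma ofReal_sqMoll (r : ℝ) (f : Cn n → ℂ) (x : Cn n) :
    (sqMoll r f x : ℂ) = mollify r (fun t => ((‖f t‖ ^ 2 : ℝ) : ℂ)) x := by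
  rw [sqMoll, ← integral_complex_ofReal, mollify]
  simp only [Complex.ofReal_mul]

lemma continuous_sqMoll {f : Cn n → ℂ} (hf2 : Integrable (fun t => ‖f t‖ ^ 2)) {r : ℝ}
    (hr : 0 < r) : Continuous (sqMoll r f) := by
  have h : Continuous (mollify r (fun t => ((‖f t‖ ^ 2 : ℝ) : ℂ))) :=
    (contDiff_mollify hf2.ofReal hr).continuous
  refine (Complex.continuous_re.comp h).congr fun x => ?_
  rw [Function.comp, ← ofReal_sqMoll, Complex.ofReal_re]

lemma integral_mul_sqMoll_le {f : Cn n → ℂ} (hf2 : Integrable (fun t => ‖f t‖ ^ 2)) {r : ℝ}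
    (hr : 0 < r) {m : Cn n → ℝ} (hm : Continuous m) (hmc : HasCompactSupport m) {ω : ℝ}
    (hω : ∀ t x, ‖t - x‖ ≤ r → ‖m x - m t‖ ≤ ω) :
    ∫ x, m x * sqMoll r f x ≤ (∫ t, m t * ‖f t‖ ^ 2) + ω * ∫ t, ‖f t‖ ^ 2 := by
  have h := norm_integral_mollify_mul_sub_le (f := fun t => ((‖f t‖ ^ 2 : ℝ) : ℂ)) hf2.ofReal hr
    (g := fun x => (m x : ℂ)) (Complex.continuous_ofReal.comp hm)
    (hmc.comp_left Complex.ofReal_zero) (ω := ω) (fun t x htx => by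
      rw [← Complex.ofReal_sub, Complex.norm_real]; exact hω t x htx)
  have e1 : ∫ x, mollify r (fun t => ((‖f t‖ ^ 2 : ℝ) : ℂ)) x * (m x : ℂ)
      = ((∫ x, m x * sqMoll r f x : ℝ) : ℂ) := by
    rw [← integral_complex_ofReal]
    refine integral_congr_ae (Filter.Eventually.of_forall fun x => ?_)
    simp only [← ofReal_sqMoll, Complex.ofReal_mul, mul_comm]
  have e2 : ∫ x, ((‖f x‖ ^ 2 : ℝ) : ℂ) * (m x : ℂ) = ((∫ x, m x * ‖f x‖ ^ 2 : ℝ) : ℂ) := by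
    rw [← integral_complex_ofReal]
    refine integral_congr_ae (Filter.Eventually.of_forall fun x => ?_)
    simp only [Complex.ofReal_mul, mul_comm]
  have e3 : ∀ t, ‖((‖f t‖ ^ 2 : ℝ) : ℂ)‖ = ‖f t‖ ^ 2 := fun t => by
    rw [Complex.norm_real, Real.norm_of_nonneg (sq_nonneg _)]
  rw [e1, e2, ← Complex.ofReal_sub, Complex.norm_real] at h
  simp only [e3] at h
  have := (le_abs_self _).trans h
  linarith

lemma sum_sum_antisymm_mul_symm {A B : Fin n → Fin n → ℂ} (hA : ∀ i k, A k i = -A i k)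
    (hB : ∀ i k, B k i = B i k) : ∑ i, ∑ k, A i k * B i k = 0 := by
  have h : ∑ i, ∑ k, A i k * B i k = -∑ i, ∑ k, A i k * B i k := by
    conv_lhs => rw [Finset.sum_comm]
    rw [← Finset.sum_neg_distrib]
    refine Finset.sum_congr rfl fun i _ => ?_
    rw [← Finset.sum_neg_distrib]
    refine Finset.sum_congr rfl fun k _ => ?_
    rw [hA i k, hB i k]; ring
  linear_combination (1 / 2 : ℂ) * h

section Apriori

variable {Ω : Set (Cn n)} (hΩ : IsOpen Ω) {W : Cn n → ℝ} (hW : ContDiffOn ℝ 2 W Ω)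
include hΩ hW

/-- Interior estimate for `∂̄u` when `∂̄u` is, up to an error, the weighted adjoint of an
antisymmetric tensor. -/
lemma integral_sq_dbar_le {u : Cn n → ℂ} (hu : ContDiffOn ℝ 2 u Ω) {G D : Fin n → Fin n → Cn n → ℂ}
    (hG : ∀ i k, ContDiffOn ℝ 1 (G i k) Ω) (hD : ∀ i k, ContinuousOn (D i k) Ω)
    (hanti : ∀ i k z, G k i z = -G i k z) {χ : Cn n → ℝ} (hχ : CcOn Ω 2 (fun z => (χ z : ℂ)))
    (hrel : ∀ z ∈ tsupport (fun z => (χ z : ℂ)), ∀ k,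
      dbar u z k = ∑ i, (-delW W (G i k) z i + D i k z)) :
    ∫ z, χ z ^ 2 * (∑ k, ‖dbar u z k‖ ^ 2) * ew W z
      ≤ 8 * (n + 1) * (∫ z, gradSq χ z * (∑ i, ∑ k, ‖G i k z‖ ^ 2) * ew W z)
        + 2 * (n + 1) * ∫ z, χ z ^ 2 * (∑ i, ∑ k, ‖D i k z‖ ^ 2) * ew W z := by
  set S := tsupport (fun z => (χ z : ℂ)) with hS
  have hSc : IsCompact S := hχ.compact
  have hSΩ : S ⊆ Ω := hχ.subset
  have hχ0 : ∀ z ∉ S, χ z = 0 := fun z hz => by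
    exact_mod_cast image_eq_zero_of_notMem_tsupport (f := fun z => (χ z : ℂ)) hz
  have hχj0 : ∀ j, ∀ z ∉ S, dbar (fun z => (χ z : ℂ)) z j = 0 := fun j z hz =>
    image_eq_zero_of_notMem_tsupport (f := fun z => dbar (fun z => (χ z : ℂ)) z j)
      (fun h => hz (CcOn.tsupport_dbar _ j h))
  have hχg0 : ∀ z ∉ S, gradSq χ z = 0 := fun z hz => by
    simp [gradSq, hχj0 _ z hz]
  have ha : ∀ k, ContDiffOn ℝ 1 (fun z => dbar u z k) Ω := fun k =>
    contDiffOn_dbar hΩ hu (by norm_num) k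
  have hχr : ContDiff ℝ 2 χ := by
    have := Complex.reCLM.contDiff.comp hχ.contDiff
    exact this
  have hχc : Continuous χ := hχr.continuous
  have hewc : ContinuousOn (ew W) Ω := (contDiffOn_ew hW).continuousOn
  have hgc : ContinuousOn (gradSq χ) Ω := continuousOn_gradSq hΩ hχr.contDiffOn
  have hχjc : ∀ j, ContinuousOn (fun z => dbar (fun z => (χ z : ℂ)) z j) Ω := fun j =>
    (hχ.dbar (l := 1) (by norm_num) j).continuous.continuousOn
  have hac : ∀ k, ContinuousOn (fun z => dbar u z k) Ω := fun k => (ha k).continuousOn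
  have hGc : ∀ i k, ContinuousOn (G i k) Ω := fun i k => (hG i k).continuousOn
  have hewcc : ContinuousOn (fun z => (ew W z : ℂ)) Ω :=
    Complex.continuous_ofReal.comp_continuousOn hewc
  have hχcc : Continuous (fun z => (χ z : ℂ)) := hχ.continuous
  have hdelc : ∀ i k, ContinuousOn (fun z => delW W (G i k) z i) Ω := fun i k =>
    (contDiffOn_delW hΩ hW (hG i k) (l := 0) (by norm_num) (by norm_num) i).continuousOn
  -- the test functions
  have hb : ∀ k, CcOn Ω 1 (fun z => (χ z : ℂ) ^ 2 * dbar u z k) := fun k => by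
    have h1 := CcOn.mul_right hΩ (CcOn.mul_left hΩ hχ.contDiff.contDiffOn hχ |>.mono
      (by norm_num : (1 : WithTop ℕ∞) ≤ 2)) (ha k)
    simpa only [sq] using h1
  have hdb : ∀ k i, ∀ z ∈ Ω, dbar (fun z => (χ z : ℂ) ^ 2 * dbar u z k) z i
      = 2 * χ z * dbar (fun z => (χ z : ℂ)) z i * dbar u z k
        + (χ z : ℂ) ^ 2 * dbar (fun w => dbar u w k) z i := fun k i z hz => by
    have d1 : DifferentiableAt ℝ (fun z => (χ z : ℂ)) z :=
      (hχ.differentiable (by norm_num)) z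
    have d2 : DifferentiableAt ℝ (fun z => dbar u z k) z :=
      ((ha k).contDiffAt (hΩ.mem_nhds hz)).differentiableAt (by norm_num)
    have e1 : (fun z => (χ z : ℂ) ^ 2 * dbar u z k)
        = fun z => ((χ z : ℂ) * (χ z : ℂ)) * dbar u z k := by ext; ring
    rw [e1, dbar_mul (d1.fun_mul d1) d2, dbar_mul d1 d1]; ring
  have hintg : ∀ {f : Cn n → ℂ}, ContinuousOn f Ω → (∀ z ∉ S, f z = 0) → Integrable f :=
    fun hf h0 => integrable_of_vanish hΩ hf hSc hSΩ h0
  have hintr : ∀ {f : Cn n → ℝ}, ContinuousOn f Ω → (∀ z ∉ S, f z = 0) → Integrable f :=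
    fun hf h0 => integrable_of_vanish hΩ hf hSc hSΩ h0
  have star : ∀ {f : Cn n → ℂ}, ContinuousOn f Ω → ContinuousOn (fun z => conj (f z)) Ω :=
    fun hf => Complex.continuous_conj.comp_continuousOn hf
  -- the energy identity
  have hI : ((∫ z, χ z ^ 2 * (∑ k, ‖dbar u z k‖ ^ 2) * ew W z : ℝ) : ℂ)
      = ∫ z, ∑ i, ∑ k, (G i k z * conj (2 * χ z * dbar (fun z => (χ z : ℂ)) z i * dbar u z k)
        + D i k z * conj ((χ z : ℂ) ^ 2 * dbar u z k)) * ew W z := by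
    have i1 : ∀ i k, Integrable (fun z =>
        delW W (G i k) z i * conj ((χ z : ℂ) ^ 2 * dbar u z k) * ew W z) := fun i k =>
      hintg (((hdelc i k).mul (star ((hχcc.continuousOn.pow 2).mul (hac k)))).mul hewcc)
        (fun z hz => by simp [hχ0 z hz])
    have i2 : ∀ i k, Integrable (fun z =>
        D i k z * conj ((χ z : ℂ) ^ 2 * dbar u z k) * ew W z) := fun i k =>
      hintg (((hD i k).mul (star ((hχcc.continuousOn.pow 2).mul (hac k)))).mul hewcc)
        (fun z hz => by simp [hχ0 z hz])
    have i3 : ∀ i k, Integrable (fun z =>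
        G i k z * conj (dbar (fun z => (χ z : ℂ) ^ 2 * dbar u z k) z i) * ew W z) := fun i k => by
      have hc := (hb k).dbar (l := 0) (by norm_num) i
      refine hintg (((hGc i k).mul (star hc.continuous.continuousOn)).mul hewcc) (fun z hz => ?_)
      have : dbar (fun z => (χ z : ℂ) ^ 2 * dbar u z k) z i = 0 := by
        refine image_eq_zero_of_notMem_tsupport
          (f := fun z => dbar (fun z => (χ z : ℂ) ^ 2 * dbar u z k) z i) fun h => hz ?_
        have h2 := CcOn.tsupport_dbar _ i h
        refine closure_mono (fun w hw => ?_) h2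
        simp only [Function.mem_support] at hw ⊢
        intro h0; apply hw; rw [h0]; ring
      rw [this]; simp
    have e1 : ((∫ z, χ z ^ 2 * (∑ k, ‖dbar u z k‖ ^ 2) * ew W z : ℝ) : ℂ)
        = ∫ z, ∑ i, ∑ k, (-(delW W (G i k) z i * conj ((χ z : ℂ) ^ 2 * dbar u z k) * ew W z)
          + D i k z * conj ((χ z : ℂ) ^ 2 * dbar u z k) * ew W z) := by
      rw [← integral_complex_ofReal]
      refine integral_congr_ae (Filter.Eventually.of_forall fun z => ?_)
      simp only
      by_cases hz : z ∈ S
      · have e2 : ∀ k, ((‖dbar u z k‖ ^ 2 : ℝ) : ℂ)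
            = (∑ i, (-delW W (G i k) z i + D i k z)) * conj (dbar u z k) := fun k => by
          rw [← hrel z hz k, Complex.mul_conj, Complex.normSq_eq_norm_sq]
        rw [Finset.sum_comm]
        rw [Complex.ofReal_mul, Complex.ofReal_mul, Complex.ofReal_sum]
        simp only [e2, Finset.sum_mul, Finset.mul_sum]
        refine Finset.sum_congr rfl fun k _ => Finset.sum_congr rfl fun i _ => ?_
        simp only [map_mul, map_pow, Complex.conj_ofReal, Complex.ofReal_pow]; ring
      · simp [hχ0 z hz]
    have e3 : ∫ z, ∑ i, ∑ k, (-(delW W (G i k) z i * conj ((χ z : ℂ) ^ 2 * dbar u z k) * ew W z)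
          + D i k z * conj ((χ z : ℂ) ^ 2 * dbar u z k) * ew W z)
        = ∫ z, ∑ i, ∑ k, (G i k z * conj (dbar (fun z => (χ z : ℂ) ^ 2 * dbar u z k) z i) * ew W z
          + D i k z * conj ((χ z : ℂ) ^ 2 * dbar u z k) * ew W z) := by
      rw [integral_finsetSum, integral_finsetSum]
      · refine Finset.sum_congr rfl fun i _ => ?_
        rw [integral_finsetSum, integral_finsetSum]
        · refine Finset.sum_congr rfl fun k _ => ?_
          rw [integral_add (i1 i k).fun_neg (i2 i k), integral_add (i3 i k) (i2 i k), integral_neg,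
            integral_delW_mul hΩ hW (hG i k) (hb k) i, neg_neg]
        · exact fun k _ => (i3 i k).add (i2 i k)
        · exact fun k _ => (i1 i k).fun_neg.add (i2 i k)
      · exact fun i _ => integrable_finsetSum _ fun k _ => (i3 i k).add (i2 i k)
      · exact fun i _ => integrable_finsetSum _ fun k _ => (i1 i k).fun_neg.add (i2 i k)
    rw [e1, e3]
    refine integral_congr_ae (Filter.Eventually.of_forall fun z => ?_)
    simp only
    by_cases hz : z ∈ Ω
    · have hs := sum_sum_antisymm_mul_symm (A := fun i k => G i k z)
        (B := fun i k => conj ((χ z : ℂ) ^ 2 * dbar (fun w => dbar u w k) z i))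
        (fun i k => hanti i k z) (fun i k => by
          rw [dbar_dbar_comm (hu.contDiffAt (hΩ.mem_nhds hz))])
      have hs2 : ∑ i, ∑ k, G i k z * conj ((χ z : ℂ) ^ 2 * dbar (fun w => dbar u w k) z i)
          * ew W z = 0 := by
        simp only [← Finset.sum_mul]; rw [hs, zero_mul]
      rw [← sub_eq_zero, ← Finset.sum_sub_distrib, ← hs2]
      refine Finset.sum_congr rfl fun i _ => ?_
      rw [← Finset.sum_sub_distrib]
      refine Finset.sum_congr rfl fun k _ => ?_
      rw [hdb k i z hz, map_add]; ring
    · have hzS : z ∉ S := fun h => hz (hSΩ h)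
      refine Finset.sum_congr rfl fun i _ => Finset.sum_congr rfl fun k _ => ?_
      have : dbar (fun z => (χ z : ℂ) ^ 2 * dbar u z k) z i = 0 :=
        ((hb k).dbar (l := 0) (by norm_num) i).eq_zero hz
      rw [this, hχ0 z hzS]; simp
  have j1 : Integrable (fun z => χ z ^ 2 * (∑ k, ‖dbar u z k‖ ^ 2) * ew W z) :=
    hintr (((hχc.continuousOn.pow 2).mul (continuousOn_finsetSum _
      fun k _ => (hac k).norm.pow 2)).mul hewc) (fun z hz => by simp [hχ0 z hz])
  have j2 : Integrable (fun z => gradSq χ z * (∑ i, ∑ k, ‖G i k z‖ ^ 2) * ew W z) :=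
    hintr ((hgc.mul (continuousOn_finsetSum _ fun i _ => continuousOn_finsetSum _
      fun k _ => (hGc i k).norm.pow 2)).mul hewc) (fun z hz => by simp [hχg0 z hz])
  have j3 : Integrable (fun z => χ z ^ 2 * (∑ i, ∑ k, ‖D i k z‖ ^ 2) * ew W z) :=
    hintr (((hχc.continuousOn.pow 2).mul (continuousOn_finsetSum _ fun i _ =>
      continuousOn_finsetSum _ fun k _ => (hD i k).norm.pow 2)).mul hewc)
      (fun z hz => by simp [hχ0 z hz])
  have hN : (0 : ℝ) < n + 1 := by positivity
  have hbound : ∫ z, χ z ^ 2 * (∑ k, ‖dbar u z k‖ ^ 2) * ew W z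
      ≤ ∫ z, (2⁻¹ * (χ z ^ 2 * (∑ k, ‖dbar u z k‖ ^ 2) * ew W z)
        + 4 * (n + 1) * (gradSq χ z * (∑ i, ∑ k, ‖G i k z‖ ^ 2) * ew W z))
        + (n + 1) * (χ z ^ 2 * (∑ i, ∑ k, ‖D i k z‖ ^ 2) * ew W z) := by
    have j4 := ((j1.const_mul 2⁻¹).add (j2.const_mul (4 * (n + 1)))).add
      (j3.const_mul ((n : ℝ) + 1))
    have := norm_integral_le_of_norm_le (f := fun z => ∑ i, ∑ k, (G i k z * conj (2 * χ z *
      dbar (fun z => (χ z : ℂ)) z i * dbar u z k)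
        + D i k z * conj ((χ z : ℂ) ^ 2 * dbar u z k)) * ew W z) j4
        (Filter.Eventually.of_forall fun z => ?_)
    · rw [← hI, Complex.norm_real] at this
      exact (le_abs_self _).trans this
    · have hw := (ew_pos W z).le
      have hterm : ∀ i k, ‖(G i k z * conj (2 * χ z * dbar (fun z => (χ z : ℂ)) z i * dbar u z k)
          + D i k z * conj ((χ z : ℂ) ^ 2 * dbar u z k)) * ew W z‖
          ≤ ((2 * ((n : ℝ) + 1))⁻¹ * (χ z ^ 2 * ‖dbar u z k‖ ^ 2)
            + 4 * (n + 1) * (gradSq χ z * ‖G i k z‖ ^ 2)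
            + (n + 1) * (χ z ^ 2 * ‖D i k z‖ ^ 2)) * ew W z := fun i k => by
        rw [norm_mul, Complex.norm_real, Real.norm_of_nonneg hw]
        refine mul_le_mul_of_nonneg_right ((norm_add_le _ _).trans ?_) hw
        simp only [norm_mul, RCLike.norm_conj, norm_pow, Complex.norm_real, Real.norm_eq_abs,
          sq_abs, Complex.norm_two]
        set p := |χ z| * ‖dbar u z k‖ with hp
        set q := ‖dbar (fun z => (χ z : ℂ)) z i‖ * ‖G i k z‖ with hq
        set s := |χ z| * ‖D i k z‖ with hs
        have hq2 : q ^ 2 ≤ gradSq χ z * ‖G i k z‖ ^ 2 := by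
          rw [hq, mul_pow]
          refine mul_le_mul_of_nonneg_right ?_ (sq_nonneg _)
          exact Finset.single_le_sum (f := fun i => ‖dbar (fun z => (χ z : ℂ)) z i‖ ^ 2)
            (fun i _ => sq_nonneg _) (Finset.mem_univ i)
        have hp2 : χ z ^ 2 * ‖dbar u z k‖ ^ 2 = p ^ 2 := by rw [hp, mul_pow, sq_abs]
        have hs2 : χ z ^ 2 * ‖D i k z‖ ^ 2 = s ^ 2 := by rw [hs, mul_pow, sq_abs]
        have y1 : 2 * (p * q) ≤ (4 * ((n : ℝ) + 1))⁻¹ * p ^ 2 + 4 * (n + 1) * q ^ 2 := by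
          have h0 : 0 ≤ (4 * ((n : ℝ) + 1))⁻¹ * (p - 4 * (n + 1) * q) ^ 2 := by positivity
          have : (4 * ((n : ℝ) + 1))⁻¹ * (p - 4 * (n + 1) * q) ^ 2
            = (4 * ((n : ℝ) + 1))⁻¹ * p ^ 2 + 4 * (n + 1) * q ^ 2 - 2 * (p * q) := by field_simp; ring
          linarith
        have y2 : p * s ≤ (4 * ((n : ℝ) + 1))⁻¹ * p ^ 2 + (n + 1) * s ^ 2 := by
          have h0 : 0 ≤ (4 * ((n : ℝ) + 1))⁻¹ * (p - 2 * (n + 1) * s) ^ 2 := by positivity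
          have : (4 * ((n : ℝ) + 1))⁻¹ * (p - 2 * (n + 1) * s) ^ 2
            = (4 * ((n : ℝ) + 1))⁻¹ * p ^ 2 + (n + 1) * s ^ 2 - p * s := by field_simp; ring
          linarith
        have y3 : (2 * ((n : ℝ) + 1))⁻¹ = (4 * ((n : ℝ) + 1))⁻¹ + (4 * ((n : ℝ) + 1))⁻¹ := by
          field_simp; norm_num
        have y4 : 4 * ((n : ℝ) + 1) * q ^ 2 ≤ 4 * (n + 1) * (gradSq χ z * ‖G i k z‖ ^ 2) := by
          gcongr
        rw [hp2, hs2, y3]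
        have l1 : ‖G i k z‖ * (2 * |χ z| * ‖dbar (fun z => (χ z : ℂ)) z i‖ * ‖dbar u z k‖)
          = 2 * (p * q) := by rw [hp, hq]; ring
        have l2 : ‖D i k z‖ * (χ z ^ 2 * ‖dbar u z k‖) = p * s := by
          rw [hp, hs, ← sq_abs (χ z)]; ring
        rw [l1, l2]
        linarith
      refine (norm_sum_le _ _).trans ((Finset.sum_le_sum fun i _ => (norm_sum_le _ _).trans
        (Finset.sum_le_sum fun k _ => hterm i k)).trans ?_)
      have hA : 0 ≤ χ z ^ 2 * (∑ k, ‖dbar u z k‖ ^ 2) * ew W z := by positivity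
      have eA : ∑ i : Fin n, ∑ k, ((2 * ((n : ℝ) + 1))⁻¹ * (χ z ^ 2 * ‖dbar u z k‖ ^ 2)
            + 4 * (n + 1) * (gradSq χ z * ‖G i k z‖ ^ 2)
            + (n + 1) * (χ z ^ 2 * ‖D i k z‖ ^ 2)) * ew W z
          = n * (2 * ((n : ℝ) + 1))⁻¹ * (χ z ^ 2 * (∑ k, ‖dbar u z k‖ ^ 2) * ew W z)
            + 4 * (n + 1) * (gradSq χ z * (∑ i, ∑ k, ‖G i k z‖ ^ 2) * ew W z)
            + (n + 1) * (χ z ^ 2 * (∑ i, ∑ k, ‖D i k z‖ ^ 2) * ew W z) := by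
        simp only [add_mul, Finset.sum_add_distrib, ← Finset.sum_mul, ← Finset.mul_sum,
          Finset.sum_const, Finset.card_univ, Fintype.card_fin, nsmul_eq_mul]
        ring
      have hfrac : n * (2 * ((n : ℝ) + 1))⁻¹ ≤ 2⁻¹ := by
        rw [← div_eq_mul_inv, div_le_iff₀ (by positivity)]; linarith
      rw [eA]
      have := mul_le_mul_of_nonneg_right hfrac hA
      simp only [Pi.add_apply]
      linarith
  have j5 : Integrable (fun z => 2⁻¹ * (χ z ^ 2 * (∑ k, ‖dbar u z k‖ ^ 2) * ew W z)
      + 4 * (n + 1) * (gradSq χ z * (∑ i, ∑ k, ‖G i k z‖ ^ 2) * ew W z)) :=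
    (j1.const_mul 2⁻¹).add (j2.const_mul _)
  rw [integral_add j5 (j3.const_mul _), integral_add (j1.const_mul _) (j2.const_mul _),
    integral_const_mul, integral_const_mul, integral_const_mul] at hbound
  linarith

end Apriori

section WeaklyHolomorphic

variable {Ω : Set (Cn n)} {W : Cn n → ℝ} {h : Cn n → ℂ} {Γ : Fin n → Fin n → Cn n → ℂ}

lemma L2loc.integrable_indicator {f : Cn n → ℂ} (hf : L2loc Ω f) {L : Set (Cn n)} (hL : IsCompact L)
    (hLΩ : L ⊆ Ω) : Integrable (L.indicator f) :=
  (integrable_indicator_iff hL.measurableSet).2 (hf.integrableOn hL hLΩ)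

lemma L2loc.integrable_indicator_sq {f : Cn n → ℂ} (hf : L2loc Ω f) {L : Set (Cn n)}
    (hL : IsCompact L) (hLΩ : L ⊆ Ω) : Integrable (fun t => ‖L.indicator f t‖ ^ 2) := by
  have h := (integrable_indicator_iff hL.measurableSet).2 (hf.integrableOn_sq hL hLΩ)
  refine h.congr (Filter.Eventually.of_forall fun t => ?_)
  by_cases ht : t ∈ L <;> simp [ht]

/-- The distributional relation for `∂̄h`, mollified. -/
lemma dbar_mollify_eq_sum (hΩ : IsOpen Ω) (hW : ContDiffOn ℝ 2 W Ω) (hh : L2loc Ω h)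
    (hΓ : ∀ i k, L2loc Ω (Γ i k))
    (hR : ∀ b, CcOn Ω 2 b → ∀ k, ∫ z, h z * dbar b z k
      = -∫ z, ∑ i, Γ i k z * (del b z i + del (fun w => (W w : ℂ)) z i * b z))
    {L : Set (Cn n)} (hL : IsCompact L) (hLΩ : L ⊆ Ω) {r : ℝ} (hr : 0 < r) {x : Cn n}
    (hx : closedBall x r ⊆ L) (k : Fin n) :
    dbar (mollify r (L.indicator h)) x k = ∑ i, (-delW W (mollify r (L.indicator (Γ i k))) x i
      + (mollify r (L.indicator (fun t => del (fun w => (W w : ℂ)) t i * Γ i k t)) x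
        - del (fun w => (W w : ℂ)) x i * mollify r (L.indicator (Γ i k)) x)) := by
  set b : Cn n → ℂ := fun t => (moll r (x - t) : ℂ) with hbdef
  have hbL : CcOn L (⊤ : ℕ∞) b := ccOn_moll_sub hr hx
  have hb : CcOn Ω (⊤ : ℕ∞) b := ⟨hbL.contDiff, hbL.compact, hbL.subset.trans hLΩ⟩
  have hb2 : CcOn Ω 2 b := hb.mono (by norm_cast)
  have hWi : ∀ i, ContinuousOn (fun z => del (fun w => (W w : ℂ)) z i) Ω := fun i =>
    (contDiffOn_del hΩ (contDiffOn_ofReal hW) (l := 0) (by norm_num) i).continuousOn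
  have hdelb : ∀ i, Continuous (fun z => del b z i) := fun i =>
    (contDiff_del hb.contDiff (l := 0) (by norm_cast) i).continuous
  have hb0 : ∀ z ∉ L, b z = 0 := fun z hz => hbL.eq_zero hz
  have hdelb0 : ∀ i, ∀ z ∉ L, del b z i = 0 := fun i z hz =>
    (hbL.del (l := 0) (by norm_cast) i).eq_zero hz
  have hdbarb0 : ∀ i, ∀ z ∉ L, dbar b z i = 0 := fun i z hz =>
    (hbL.dbar (l := 0) (by norm_cast) i).eq_zero hz
  have e1 : dbar (mollify r (L.indicator h)) x k = -∫ z, h z * dbar b z k := by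
    rw [dbar_mollify (hh.integrable_indicator hL hLΩ) hr, ← integral_neg]
    refine integral_congr_ae (Filter.Eventually.of_forall fun t => ?_)
    simp only [hbdef]
    rw [dbar_translate (fun t => (moll r t : ℂ))]
    by_cases ht : t ∈ L
    · simp [ht]
    · have := hdbarb0 k t ht
      simp only [hbdef] at this
      rw [dbar_translate (fun t => (moll r t : ℂ))] at this
      rw [this, neg_eq_zero.1 this]; simp
  have i1 : ∀ i, Integrable (fun z => Γ i k z * del b z i) := fun i =>
    (hΓ i k).integrable_mul (hdelb i).continuousOn hL hLΩ (hdelb0 i)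
  have i2 : ∀ i, Integrable (fun z => Γ i k z * (del (fun w => (W w : ℂ)) z i * b z)) := fun i =>
    (hΓ i k).integrable_mul ((hWi i).mul hb.continuous.continuousOn) hL hLΩ
      (fun z hz => by rw [hb0 z hz, mul_zero])
  have e2 : ∀ i, ∫ z, Γ i k z * del b z i = -del (mollify r (L.indicator (Γ i k))) x i := fun i => by
    rw [del_mollify ((hΓ i k).integrable_indicator hL hLΩ) hr, ← integral_neg]
    refine integral_congr_ae (Filter.Eventually.of_forall fun t => ?_)
    simp only [hbdef]
    rw [del_translate (fun t => (moll r t : ℂ))]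
    by_cases ht : t ∈ L
    · simp [ht]
    · have := hdelb0 i t ht
      simp only [hbdef] at this
      rw [del_translate (fun t => (moll r t : ℂ))] at this
      rw [this, neg_eq_zero.1 this]; simp
  have e3 : ∀ i, ∫ z, Γ i k z * (del (fun w => (W w : ℂ)) z i * b z)
      = mollify r (L.indicator (fun t => del (fun w => (W w : ℂ)) t i * Γ i k t)) x := fun i => by
    refine integral_congr_ae (Filter.Eventually.of_forall fun t => ?_)
    by_cases ht : t ∈ L
    · simp [ht, hbdef]; ring
    · simp [ht, hb0 t ht]
  rw [e1, hR b hb2 k, neg_neg, integral_finsetSum]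
  · refine Finset.sum_congr rfl fun i _ => ?_
    simp only [mul_add]
    rw [integral_add (i1 i) (i2 i), e2, e3, delW]; ring
  · intro i _
    simp only [mul_add]
    exact (i1 i).add (i2 i)

lemma norm_integral_mul_dbar_le (hΩ : IsOpen Ω) (hW : ContDiffOn ℝ 2 W Ω) (hh : L2loc Ω h)
    (hΓ : ∀ i k, L2loc Ω (Γ i k)) (hanti : ∀ i k z, Γ k i z = -Γ i k z)
    (hR : ∀ b, CcOn Ω 2 b → ∀ k, ∫ z, h z * dbar b z k
      = -∫ z, ∑ i, Γ i k z * (del b z i + del (fun w => (W w : ℂ)) z i * b z))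
    {ψ : Cn n → ℂ} (hψ : CcOn Ω 2 ψ) (k : Fin n) {χ : Cn n → ℝ}
    (hχ : CcOn Ω 2 (fun z => (χ z : ℂ))) (hχ1 : ∀ z ∈ tsupport ψ, χ z = 1) {τ : ℝ} (hτ : 0 < τ) :
    ‖∫ z, h z * dbar ψ z k‖ ≤ τ * (8 * (n + 1) *
        ∫ z, gradSq χ z * (∑ i, ∑ k, ‖Γ i k z‖ ^ 2) * ew W z)
      + (4 * τ)⁻¹ * ∫ z, ‖ψ z‖ ^ 2 * (ew W z)⁻¹ := by
  set S := tsupport (fun z => (χ z : ℂ)) with hS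
  have hSc : IsCompact S := hχ.compact
  have hSΩ : S ⊆ Ω := hχ.subset
  have hχ0 : ∀ z ∉ S, χ z = 0 := fun z hz => by
    exact_mod_cast image_eq_zero_of_notMem_tsupport (f := fun z => (χ z : ℂ)) hz
  have hχg0 : ∀ z ∉ S, gradSq χ z = 0 := fun z hz => by
    have : ∀ j, dbar (fun z => (χ z : ℂ)) z j = 0 := fun j =>
      image_eq_zero_of_notMem_tsupport (f := fun z => dbar (fun z => (χ z : ℂ)) z j)
        (fun h => hz (CcOn.tsupport_dbar _ j h))
    simp [gradSq, this]
  have hχr : ContDiff ℝ 2 χ := Complex.reCLM.contDiff.comp hχ.contDiff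
  have hχc : Continuous χ := hχr.continuous
  have hewc : ContinuousOn (ew W) Ω := (contDiffOn_ew hW).continuousOn
  have hgc : ContinuousOn (gradSq χ) Ω := continuousOn_gradSq hΩ hχr.contDiffOn
  obtain ⟨r0, hr0, hL0⟩ := hSc.exists_cthickening_subset_open hΩ hSΩ
  set L := cthickening r0 S with hLdef
  have hL : IsCompact L := hSc.cthickening
  have hSL : S ⊆ L := self_subset_cthickening S
  have hψS : tsupport ψ ⊆ S := fun z hz => subset_tsupport _ (by simp [hχ1 z hz])
  -- cut-off weights
  set m1 : Cn n → ℝ := fun z => gradSq χ z * ew W z with hm1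
  set m2 : Cn n → ℝ := fun z => χ z ^ 2 * ew W z with hm2
  have hm1c := continuous_of_vanish hΩ (f := m1) (hgc.mul hewc) hSc hSΩ
    (fun z hz => by simp [hm1, hχg0 z hz])
  have hm2c := continuous_of_vanish hΩ (f := m2) ((hχc.continuousOn.pow 2).mul hewc) hSc hSΩ
    (fun z hz => by simp [hm2, hχ0 z hz])
  have hm1n : ∀ z, 0 ≤ m1 z := fun z => mul_nonneg (gradSq_nonneg _ _) (ew_pos W z).le
  have hm2n : ∀ z, 0 ≤ m2 z := fun z => mul_nonneg (sq_nonneg _) (ew_pos W z).le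
  have hψd := hψ.dbar (l := 1) (by norm_num) k
  set Wi : Cn n → Fin n → ℂ := fun z i => del (fun w => (W w : ℂ)) z i with hWidef
  have hWi : ∀ i, ContinuousOn (fun z => Wi z i) Ω := fun i =>
    (contDiffOn_del hΩ (contDiffOn_ofReal hW) (l := 0) (by norm_num) i).continuousOn
  have hWic : ContinuousOn Wi L := continuousOn_pi.2 fun i => (hWi i).mono hL0
  have hWu := Metric.uniformContinuousOn_iff.1 (hL.uniformContinuousOn_of_continuous hWic)
  have hh1 := hh.integrable_indicator hL hL0
  have hΓ1 := fun i k => (hΓ i k).integrable_indicator hL hL0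
  have hΓ2 := fun i k => (hΓ i k).integrable_indicator_sq hL hL0
  have hWΓ1 := fun i k => ((hΓ i k).continuousOn_mul (hWi i)).integrable_indicator hL hL0
  set h1 := L.indicator h with hh1def
  set Γ1 : Fin n → Fin n → Cn n → ℂ := fun i k => L.indicator (Γ i k) with hΓ1def
  set P := ∑ i, ∑ k, ∫ t, ‖Γ1 i k t‖ ^ 2 with hP
  set Q := ∑ i, ∑ k, ∫ t, m1 t * ‖Γ1 i k t‖ ^ 2 with hQ
  set Q2 := ∑ i, ∑ k, ∫ t, m2 t * ‖Γ1 i k t‖ ^ 2 with hQ2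
  have hbdd : ∀ (m : Cn n → ℝ), Continuous m → HasCompactSupport m → ∀ (f : Cn n → ℝ),
      Integrable f → Integrable (fun z => m z * f z) := fun m hm hmc f hf => by
    obtain ⟨C, hC⟩ := hm.bounded_above_of_compact_support hmc
    exact hf.bdd_mul (c := C) hm.aestronglyMeasurable (Filter.Eventually.of_forall hC)
  have hQeq : Q = ∫ z, gradSq χ z * (∑ i, ∑ k, ‖Γ i k z‖ ^ 2) * ew W z := by
    have e0 : ∀ z, gradSq χ z * (∑ i, ∑ k, ‖Γ i k z‖ ^ 2) * ew W z
        = ∑ i, ∑ k, m1 z * ‖Γ1 i k z‖ ^ 2 := fun z => by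
      by_cases hz : z ∈ S
      · simp only [hm1, hΓ1def, Set.indicator_of_mem (hSL hz), ← Finset.mul_sum]; ring
      · simp [hm1, hχg0 z hz]
    simp only [e0]
    rw [integral_finsetSum _ fun i _ => integrable_finsetSum _ fun k _ =>
      hbdd m1 hm1c.1 hm1c.2 _ (hΓ2 i k)]
    refine Finset.sum_congr rfl fun i _ => ?_
    rw [integral_finsetSum _ fun k _ => hbdd m1 hm1c.1 hm1c.2 _ (hΓ2 i k)]
  set B := ∫ t, ‖h1 t‖ with hB
  have key : ∀ ω : ℝ, 0 < ω → ‖∫ z, h z * dbar ψ z k‖ ≤ ω * B + τ * (8 * (n + 1) * (Q + ω * P)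
      + 2 * (n + 1) * (ω ^ 2 * (Q2 + ω * P))) + (4 * τ)⁻¹ * ∫ z, ‖ψ z‖ ^ 2 * (ew W z)⁻¹ := by
    intro ω hω
    obtain ⟨r1, hr1, hu1⟩ := exists_uniform_modulus hm1c.1 hm1c.2 hω
    obtain ⟨r2, hr2, hu2⟩ := exists_uniform_modulus hm2c.1 hm2c.2 hω
    obtain ⟨r3, hr3, hu3⟩ := exists_uniform_modulus hψd.continuous hψd.compact hω
    obtain ⟨r4, hr4, hu4⟩ := hWu ω hω
    obtain ⟨r, hr, hrr0, hrr1, hrr2, hrr3, hrr4⟩ : ∃ r > 0, r ≤ r0 ∧ r ≤ r1 ∧ r ≤ r2 ∧ r ≤ r3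
        ∧ r < r4 := by
      refine ⟨min (min r0 r1) (min (min r2 r3) (r4 / 2)), by positivity, ?_, ?_, ?_, ?_, ?_⟩
      · exact (min_le_left _ _).trans (min_le_left _ _)
      · exact (min_le_left _ _).trans (min_le_right _ _)
      · exact (min_le_right _ _).trans ((min_le_left _ _).trans (min_le_left _ _))
      · exact (min_le_right _ _).trans ((min_le_left _ _).trans (min_le_right _ _))
      · exact ((min_le_right _ _).trans (min_le_right _ _)).trans_lt (by linarith)
    have hball : ∀ x ∈ S, closedBall x r ⊆ L := fun x hx =>
      (closedBall_subset_closedBall hrr0).trans (closedBall_subset_cthickening hx r0)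
    set u := mollify r h1 with hudef
    have hu : ContDiff ℝ 2 u := (contDiff_mollify hh1 hr).of_le (by norm_cast)
    set G : Fin n → Fin n → Cn n → ℂ := fun i k => mollify r (Γ1 i k) with hGdef
    have hG : ∀ i k, ContDiff ℝ 1 (G i k) := fun i k =>
      (contDiff_mollify (hΓ1 i k) hr).of_le (by norm_cast)
    set D : Fin n → Fin n → Cn n → ℂ := fun i k x =>
      mollify r (L.indicator (fun t => Wi t i * Γ i k t)) x - Wi x i * G i k x with hDdef
    have hD : ∀ i k, ContinuousOn (D i k) Ω := fun i k =>
      (contDiff_mollify (hWΓ1 i k) hr).continuous.continuousOn.sub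
        ((hWi i).mul (hG i k).continuous.continuousOn)
    have hGanti : ∀ i k z, G k i z = -G i k z := fun i k z => by
      simp only [hGdef, mollify]
      rw [← integral_neg]
      refine integral_congr_ae (Filter.Eventually.of_forall fun t => ?_)
      by_cases ht : t ∈ L
      · simp [hΓ1def, ht, hanti i k t]
      · simp [hΓ1def, ht]
    have hmain := integral_sq_dbar_le hΩ hW hu.contDiffOn (G := G) (D := D)
      (fun i k => (hG i k).contDiffOn) hD hGanti hχ
      (fun z hz k => dbar_mollify_eq_sum hΩ hW hh hΓ hR hL hL0 hr (hball z hz) k)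
    have hGsq : ∀ i k x, ‖G i k x‖ ^ 2 ≤ sqMoll r (Γ1 i k) x := fun i k x => by
      have := norm_integral_mul_moll_sq_le (hΓ1 i k) hr (hΓ2 i k) (x := x) (w := fun _ => 1)
        (ω := 1) (fun t _ _ => by simp)
      simpa [sqMoll, hGdef, mollify] using this
    have hDsq : ∀ i k, ∀ x ∈ S, ‖D i k x‖ ^ 2 ≤ ω ^ 2 * sqMoll r (Γ1 i k) x := fun i k x hx => by
      have h2 := norm_integral_mul_moll_sq_le (hΓ1 i k) hr (hΓ2 i k) (x := x)
        (w := fun t => Wi t i - Wi x i) (ω := ω) (fun t hxt ht => by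
          have htL : t ∈ L := by
            by_contra htL
            exact ht (Set.indicator_of_notMem htL _)
          have h3 := hu4 t htL x (hSL hx) (by rw [dist_comm, dist_eq_norm]; linarith)
          rw [dist_eq_norm] at h3
          exact (norm_le_pi_norm (Wi t - Wi x) i).trans h3.le)
      have e1 : D i k x = ∫ t, Γ1 i k t * (Wi t i - Wi x i) * (moll r (x - t) : ℂ) := by
        simp only [hDdef, hGdef, mollify]
        rw [← integral_const_mul, ← integral_sub (integrable_mul_moll_sub (hWΓ1 i k) hr x)
          ((integrable_mul_moll_sub (hΓ1 i k) hr x).const_mul _)]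
        refine integral_congr_ae (Filter.Eventually.of_forall fun t => ?_)
        by_cases ht : t ∈ L
        · simp [hΓ1def, ht]; ring
        · simp [hΓ1def, ht]
      rw [e1]; exact h2
    have hsm : ∀ i k, Continuous (sqMoll r (Γ1 i k)) := fun i k => continuous_sqMoll (hΓ2 i k) hr
    have hints : ∀ (m : Cn n → ℝ), Continuous m → HasCompactSupport m → ∀ i k,
        Integrable (fun z => m z * sqMoll r (Γ1 i k) z) := fun m hm hmc i k =>
      (hm.mul (hsm i k)).integrable_of_hasCompactSupport hmc.mul_right
    have hb1 : ∫ z, gradSq χ z * (∑ i, ∑ k, ‖G i k z‖ ^ 2) * ew W z ≤ Q + ω * P := by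
      calc _ ≤ ∫ z, ∑ i, ∑ k, m1 z * sqMoll r (Γ1 i k) z := by
            refine integral_mono_of_nonneg (Filter.Eventually.of_forall fun z => ?_)
              (integrable_finsetSum _ fun i _ => integrable_finsetSum _ fun k _ =>
                hints m1 hm1c.1 hm1c.2 i k) (Filter.Eventually.of_forall fun z => ?_)
            · exact mul_nonneg (mul_nonneg (gradSq_nonneg _ _) (by positivity)) (ew_pos W z).le
            · simp only
              rw [mul_right_comm, Finset.mul_sum]
              refine Finset.sum_le_sum fun i _ => ?_
              rw [Finset.mul_sum]
              exact Finset.sum_le_sum fun k _ => mul_le_mul_of_nonneg_left (hGsq i k z) (hm1n z)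
        _ = ∑ i, ∑ k, ∫ z, m1 z * sqMoll r (Γ1 i k) z := by
            rw [integral_finsetSum _ fun i _ => integrable_finsetSum _ fun k _ =>
              hints m1 hm1c.1 hm1c.2 i k]
            refine Finset.sum_congr rfl fun i _ => ?_
            rw [integral_finsetSum _ fun k _ => hints m1 hm1c.1 hm1c.2 i k]
        _ ≤ ∑ i, ∑ k, ((∫ t, m1 t * ‖Γ1 i k t‖ ^ 2) + ω * ∫ t, ‖Γ1 i k t‖ ^ 2) :=
            Finset.sum_le_sum fun i _ => Finset.sum_le_sum fun k _ =>
              integral_mul_sqMoll_le (hΓ2 i k) hr hm1c.1 hm1c.2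
                (fun t x htx => hu1 t x (htx.trans hrr1))
        _ = Q + ω * P := by simp only [Finset.sum_add_distrib, hP, hQ, Finset.mul_sum]
    have hb2 : ∫ z, χ z ^ 2 * (∑ i, ∑ k, ‖D i k z‖ ^ 2) * ew W z ≤ ω ^ 2 * (Q2 + ω * P) := by
      calc _ ≤ ∫ z, ∑ i, ∑ k, ω ^ 2 * (m2 z * sqMoll r (Γ1 i k) z) := by
            refine integral_mono_of_nonneg (Filter.Eventually.of_forall fun z => ?_)
              (integrable_finsetSum _ fun i _ => integrable_finsetSum _ fun k _ =>
                (hints m2 hm2c.1 hm2c.2 i k).const_mul _) (Filter.Eventually.of_forall fun z => ?_)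
            · exact mul_nonneg (mul_nonneg (sq_nonneg _) (by positivity)) (ew_pos W z).le
            · simp only
              by_cases hz : z ∈ S
              · rw [mul_right_comm, Finset.mul_sum]
                refine Finset.sum_le_sum fun i _ => ?_
                rw [Finset.mul_sum]
                refine Finset.sum_le_sum fun k _ => ?_
                rw [mul_left_comm]
                exact mul_le_mul_of_nonneg_left (hDsq i k z hz) (hm2n z)
              · simp [hm2, hχ0 z hz]
        _ = ∑ i, ∑ k, ω ^ 2 * ∫ z, m2 z * sqMoll r (Γ1 i k) z := by
            rw [integral_finsetSum _ fun i _ => integrable_finsetSum _ fun k _ =>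
              (hints m2 hm2c.1 hm2c.2 i k).const_mul _]
            refine Finset.sum_congr rfl fun i _ => ?_
            rw [integral_finsetSum _ fun k _ => (hints m2 hm2c.1 hm2c.2 i k).const_mul _]
            exact Finset.sum_congr rfl fun k _ => integral_const_mul _ _
        _ ≤ ∑ i, ∑ k, ω ^ 2 * ((∫ t, m2 t * ‖Γ1 i k t‖ ^ 2) + ω * ∫ t, ‖Γ1 i k t‖ ^ 2) :=
            Finset.sum_le_sum fun i _ => Finset.sum_le_sum fun k _ =>
              mul_le_mul_of_nonneg_left (integral_mul_sqMoll_le (hΓ2 i k) hr hm2c.1 hm2c.2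
                (fun t x htx => hu2 t x (htx.trans hrr2))) (sq_nonneg _)
        _ = ω ^ 2 * (Q2 + ω * P) := by
            simp only [Finset.sum_add_distrib, hP, hQ2, ← Finset.mul_sum]
    -- comparison of the pairings
    have hd0 : ∀ z ∉ tsupport ψ, dbar ψ z k = 0 := fun z hz =>
      image_eq_zero_of_notMem_tsupport (f := fun z => dbar ψ z k)
        (fun h => hz (CcOn.tsupport_dbar _ k h))
    have hc1 : ‖(∫ z, u z * dbar ψ z k) - ∫ z, h z * dbar ψ z k‖ ≤ ω * B := by
      have := norm_integral_mollify_mul_sub_le hh1 hr (g := fun z => dbar ψ z k) hψd.continuous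
        hψd.compact (ω := ω) (fun t x htx => hu3 t x (htx.trans hrr3))
      have e1 : ∫ z, h1 z * dbar ψ z k = ∫ z, h z * dbar ψ z k := by
        refine integral_congr_ae (Filter.Eventually.of_forall fun z => ?_)
        by_cases hz : z ∈ tsupport ψ
        · simp [hh1def, hSL (hψS hz)]
        · simp [hd0 z hz]
      rwa [e1] at this
    have hj1 : Integrable (fun z => χ z ^ 2 * (∑ k, ‖dbar u z k‖ ^ 2) * ew W z) :=
      integrable_of_vanish hΩ (((hχc.continuousOn.pow 2).mul (continuousOn_finsetSum _
        fun k _ => (contDiff_dbar hu (l := 0) (by norm_num) k).continuous.continuousOn.norm.pow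
          2)).mul hewc) hSc hSΩ (fun z hz => by simp [hχ0 z hz])
    have hj2 : Integrable (fun z => ‖ψ z‖ ^ 2 * (ew W z)⁻¹) :=
      integrable_of_vanish hΩ ((hψ.continuous.continuousOn.norm.pow 2).mul
        (hewc.inv₀ fun z _ => (ew_pos W z).ne')) hψ.compact hψ.subset
        (fun z hz => by simp [image_eq_zero_of_notMem_tsupport hz])
    have hc2 : ‖∫ z, u z * dbar ψ z k‖ ≤ τ * (∫ z, χ z ^ 2 * (∑ k, ‖dbar u z k‖ ^ 2) * ew W z)
        + (4 * τ)⁻¹ * ∫ z, ‖ψ z‖ ^ 2 * (ew W z)⁻¹ := by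
      rw [integral_mul_dbar hΩ (hu.contDiffOn.of_le (by norm_num)) (hψ.mono (by norm_num)) k,
        norm_neg, ← integral_const_mul, ← integral_const_mul,
        ← integral_add (hj1.const_mul _) (hj2.const_mul _)]
      refine norm_integral_le_of_norm_le ((hj1.const_mul _).add (hj2.const_mul _))
        (Filter.Eventually.of_forall fun z => ?_)
      have hw := ew_pos W z
      by_cases hz : z ∈ tsupport ψ
      · rw [hχ1 z hz, one_pow, one_mul, norm_mul]
        have hs : ‖dbar u z k‖ ^ 2 ≤ ∑ k, ‖dbar u z k‖ ^ 2 :=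
          Finset.single_le_sum (f := fun k => ‖dbar u z k‖ ^ 2) (fun i _ => sq_nonneg _)
            (Finset.mem_univ k)
        have h0 : 0 ≤ (4 * τ)⁻¹ * (ew W z)⁻¹ * (2 * τ * ew W z * ‖dbar u z k‖ - ‖ψ z‖) ^ 2 := by
          positivity
        have e1 : (4 * τ)⁻¹ * (ew W z)⁻¹ * (2 * τ * ew W z * ‖dbar u z k‖ - ‖ψ z‖) ^ 2
            = τ * (‖dbar u z k‖ ^ 2 * ew W z) + (4 * τ)⁻¹ * (‖ψ z‖ ^ 2 * (ew W z)⁻¹)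
              - ‖dbar u z k‖ * ‖ψ z‖ := by field_simp; ring
        have h2 : τ * (‖dbar u z k‖ ^ 2 * ew W z)
            ≤ τ * ((∑ k, ‖dbar u z k‖ ^ 2) * ew W z) := by gcongr
        linarith
      · rw [image_eq_zero_of_notMem_tsupport hz]
        simp only [mul_zero, norm_zero]
        positivity
    have hN : (0 : ℝ) ≤ 8 * (n + 1) := by positivity
    have hN2 : (0 : ℝ) ≤ 2 * (n + 1) := by positivity
    have hfin : τ * (∫ z, χ z ^ 2 * (∑ k, ‖dbar u z k‖ ^ 2) * ew W z)
        ≤ τ * (8 * (n + 1) * (Q + ω * P) + 2 * (n + 1) * (ω ^ 2 * (Q2 + ω * P))) :=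
      mul_le_mul_of_nonneg_left (hmain.trans (add_le_add (mul_le_mul_of_nonneg_left hb1 hN)
        (mul_le_mul_of_nonneg_left hb2 hN2))) hτ.le
    have htri : ‖∫ z, h z * dbar ψ z k‖ ≤ ‖∫ z, u z * dbar ψ z k‖
        + ‖(∫ z, u z * dbar ψ z k) - ∫ z, h z * dbar ψ z k‖ := by
      have := norm_sub_le (∫ z, u z * dbar ψ z k)
        ((∫ z, u z * dbar ψ z k) - ∫ z, h z * dbar ψ z k)
      rwa [sub_sub_cancel] at this
    linarith
  have hlim : Filter.Tendsto (fun ω : ℝ => ω * B + τ * (8 * (n + 1) * (Q + ω * P)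
      + 2 * (n + 1) * (ω ^ 2 * (Q2 + ω * P))) + (4 * τ)⁻¹ * ∫ z, ‖ψ z‖ ^ 2 * (ew W z)⁻¹)
      (nhdsWithin 0 (Ioi 0)) (nhds (τ * (8 * (n + 1) * Q)
        + (4 * τ)⁻¹ * ∫ z, ‖ψ z‖ ^ 2 * (ew W z)⁻¹)) := by
    have hc : Continuous (fun ω : ℝ => ω * B + τ * (8 * (n + 1) * (Q + ω * P)
      + 2 * (n + 1) * (ω ^ 2 * (Q2 + ω * P))) + (4 * τ)⁻¹ * ∫ z, ‖ψ z‖ ^ 2 * (ew W z)⁻¹) := by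
      fun_prop
    have := (hc.tendsto 0).mono_left (nhdsWithin_le_nhds (s := Ioi (0 : ℝ)))
    simpa using this
  rw [← hQeq]
  exact ge_of_tendsto hlim (Filter.eventually_of_mem self_mem_nhdsWithin fun ω hω => key ω hω)

/-- Weak solutions with an antisymmetric defect are weakly holomorphic when the weighted defect is
negligible near infinity. -/
lemma integral_mul_dbar_eq_zero (hΩ : IsOpen Ω) (hW : ContDiffOn ℝ 2 W Ω) (hh : L2loc Ω h)
    (hΓ : ∀ i k, L2loc Ω (Γ i k)) (hanti : ∀ i k z, Γ k i z = -Γ i k z)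
    (hR : ∀ b, CcOn Ω 2 b → ∀ k, ∫ z, h z * dbar b z k
      = -∫ z, ∑ i, Γ i k z * (del b z i + del (fun w => (W w : ℂ)) z i * b z))
    {ψ : Cn n → ℂ} (hψ : CcOn Ω 2 ψ) (k : Fin n)
    (hχ : ∀ κ : ℝ, 0 < κ → ∃ χ : Cn n → ℝ, CcOn Ω 2 (fun z => (χ z : ℂ)) ∧
      (∀ z ∈ tsupport ψ, χ z = 1) ∧
      ∫ z, gradSq χ z * (∑ i, ∑ k, ‖Γ i k z‖ ^ 2) * ew W z ≤ κ) :
    ∫ z, h z * dbar ψ z k = 0 := by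
  set A := ∫ z, ‖ψ z‖ ^ 2 * (ew W z)⁻¹ with hA
  have key : ∀ τ : ℝ, 0 < τ → ‖∫ z, h z * dbar ψ z k‖ ≤ (8 * (n + 1) + 4⁻¹ * A) * τ⁻¹ := by
    intro τ hτ
    obtain ⟨χ, hχ1, hχ2, hχ3⟩ := hχ ((τ ^ 2)⁻¹) (by positivity)
    have h1 := norm_integral_mul_dbar_le hΩ hW hh hΓ hanti hR hψ k hχ1 hχ2 hτ
    have h2 : τ * (8 * (n + 1) * ∫ z, gradSq χ z * (∑ i, ∑ k, ‖Γ i k z‖ ^ 2) * ew W z)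
        ≤ τ * (8 * (n + 1) * (τ ^ 2)⁻¹) := by gcongr
    have h3 : τ * (8 * ((n : ℝ) + 1) * (τ ^ 2)⁻¹) + (4 * τ)⁻¹ * A
        = (8 * (n + 1) + 4⁻¹ * A) * τ⁻¹ := by field_simp
    linarith
  have hlim : Filter.Tendsto (fun τ : ℝ => (8 * (n + 1) + 4⁻¹ * A) * τ⁻¹) Filter.atTop (nhds 0) := by
    simpa using tendsto_inv_atTop_zero.const_mul (8 * ((n : ℝ) + 1) + 4⁻¹ * A)
  exact norm_le_zero_iff.1 (ge_of_tendsto hlim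
    ((Filter.eventually_gt_atTop 0).mono fun τ hτ => key τ hτ))

end WeaklyHolomorphic

/-- A real differentiable function satisfying the Cauchy-Riemann equations is complex
differentiable. -/
lemma differentiableAt_of_dbar_eq_zero {A : Cn n → ℂ} {z : Cn n} (hA : DifferentiableAt ℝ A z)
    (h : ∀ j, dbar A z j = 0) : DifferentiableAt ℂ A z := by
  have hI : ∀ j, fderiv ℝ A z (I • e n j) = I * fderiv ℝ A z (e n j) := fun j => by
    have h1 := h j
    rw [dbar, mul_eq_zero, or_iff_right (by norm_num)] at h1
    linear_combination (-I) * h1 + (fderiv ℝ A z (I • e n j)) * I_mul_I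
  refine (differentiableAt_iff_restrictScalars ℝ hA).2
    ⟨∑ j, (EuclideanSpace.proj j : Cn n →L[ℂ] ℂ).smulRight (fderiv ℝ A z (e n j)), ?_⟩
  ext w
  conv_rhs => rw [eq_sum_basis w]
  simp only [map_sum, map_add, map_smul, hI]
  simp only [ContinuousLinearMap.coe_restrictScalars', _root_.sum_apply,
    ContinuousLinearMap.smulRight_apply, PiLp.proj_apply, smul_eq_mul, real_smul]
  refine Finset.sum_congr rfl fun j _ => ?_
  conv_lhs => rw [← Complex.re_add_im (w j)]
  ring

/-- Multiplication by a unit complex number preserves Lebesgue measure. -/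
lemma integral_comp_unit_smul (f : Cn n → ℂ) {c : ℂ} (hc : ‖c‖ = 1) :
    ∫ t, f (c • t) = ∫ t, f t := by
  have hc0 : c ≠ 0 := fun h => by simp [h] at hc
  let T : Cn n ≃ₗᵢ[ℝ] Cn n :=
    { (LinearEquiv.smulOfNeZero ℂ (Cn n) c hc0).restrictScalars ℝ with
      norm_map' := fun t => by
        change ‖c • t‖ = ‖t‖
        rw [norm_smul, hc, one_mul] }
  exact (T.measurePreserving).integral_comp T.toHomeomorph.measurableEmbedding f

/-- The mean value property for radial mollifiers. -/
lemma mollify_eq_self {A : Cn n → ℂ} (hA : Continuous A) {s : ℝ} (hs : 0 < s) {x : Cn n}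
    (hd : ∀ z ∈ closedBall x s, DifferentiableAt ℂ A z) : mollify s A x = A x := by
  set G : ℝ → Cn n → ℂ := fun θ t => A (x - circleMap 0 1 θ • t) * (moll s t : ℂ) with hG
  have hGc : Continuous (Function.uncurry G) := by
    have h1 : Continuous fun p : ℝ × Cn n => circleMap 0 1 p.1 :=
      (continuous_circleMap 0 1).comp continuous_fst
    exact (hA.comp (continuous_const.sub (h1.smul continuous_snd))).mul
      (Complex.continuous_ofReal.comp ((continuous_moll s).comp continuous_snd))
  have hn : ∀ θ, ‖circleMap 0 1 θ‖ = 1 := fun θ => by simp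
  have h1 : ∀ θ, ∫ t, G θ t = mollify s A x := fun θ => by
    have e1 : mollify s A x = ∫ t, A (x - t) * (moll s t : ℂ) := by
      rw [mollify, ← integral_sub_left_eq_self _ volume x]
      simp
    rw [e1, ← integral_comp_unit_smul (fun t => A (x - t) * (moll s t : ℂ)) (hn θ)]
    refine integral_congr_ae (Filter.Eventually.of_forall fun t => ?_)
    simp only [hG]
    rw [moll_congr s (z := circleMap 0 1 θ • t) (w := t) (by rw [norm_smul, hn, one_mul])]
  have h0 : ∀ θ, ∀ t ∉ closedBall (0 : Cn n) s, G θ t = 0 := fun θ t ht => by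
    simp only [mem_closedBall, dist_zero_right, not_le] at ht
    simp [hG, moll_eq_zero hs ht.le]
  have h2 : ∀ t, ∫ θ in (0 : ℝ)..(2 * Real.pi), G θ t
      = (2 * Real.pi : ℂ) * (A x * (moll s t : ℂ)) := fun t => by
    by_cases ht : t ∈ closedBall (0 : Cn n) s
    · simp only [mem_closedBall, dist_zero_right] at ht
      have hdf : DiffContOnCl ℂ (fun ζ : ℂ => A (x - ζ • t)) (ball 0 |(1 : ℝ)|) := by
        refine DifferentiableOn.diffContOnCl fun ζ hζ => ?_
        rw [abs_one, closure_ball _ one_ne_zero, mem_closedBall, dist_zero_right] at hζ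
        refine DifferentiableAt.differentiableWithinAt ?_
        refine DifferentiableAt.comp ζ (hd _ ?_) (by fun_prop)
        rw [mem_closedBall, dist_eq_norm, sub_sub_cancel_left, norm_neg, norm_smul]
        nlinarith [norm_nonneg ζ, norm_nonneg t]
      have := hdf.circleAverage
      rw [Real.circleAverage_def, zero_smul, sub_zero] at this
      simp only [hG]
      rw [intervalIntegral.integral_mul_const, ← this, real_smul]
      push_cast
      have : (Real.pi : ℂ) ≠ 0 := by exact_mod_cast Real.pi_ne_zero
      field_simp
    · simp only [h0 _ t ht, intervalIntegral.integral_zero]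
      simp only [mem_closedBall, dist_zero_right, not_le] at ht
      simp [moll_eq_zero hs ht.le]
  have hintg : Integrable (Function.uncurry G)
      ((volume.restrict (uIoc 0 (2 * Real.pi))).prod volume) := by
    have hk : IsCompact (Icc (0 : ℝ) (2 * Real.pi) ×ˢ closedBall (0 : Cn n) s) :=
      isCompact_Icc.prod (isCompact_closedBall _ _)
    have h3 : IntegrableOn (Function.uncurry G) (Icc (0 : ℝ) (2 * Real.pi) ×ˢ closedBall 0 s)
        (volume.prod volume) := hGc.continuousOn.integrableOn_compact hk
    have h4 := h3.of_forall_sdiff_eq_zero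
      (t := uIoc (0 : ℝ) (2 * Real.pi) ×ˢ univ) (measurableSet_uIoc.prod MeasurableSet.univ)
      (fun p hp => by
        obtain ⟨⟨hp1, -⟩, hp2⟩ := hp
        refine h0 p.1 p.2 fun hp3 => hp2 ⟨?_, hp3⟩
        rw [uIoc_of_le (by positivity)] at hp1
        exact Ioc_subset_Icc_self hp1)
    rwa [IntegrableOn, ← Measure.prod_restrict, Measure.restrict_univ] at h4
  have h5 := intervalIntegral_integral_swap hintg
  simp only [h1, h2] at h5
  rw [intervalIntegral.integral_const, integral_const_mul, integral_const_mul,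
    integral_complex_ofReal, integral_moll hs, real_smul] at h5
  have hpi : (2 * Real.pi : ℂ) ≠ 0 := by
    exact_mod_cast (by positivity : (2 * Real.pi : ℝ) ≠ 0)
  simp only [sub_zero, ofReal_mul, ofReal_ofNat, ofReal_one, mul_one] at h5
  exact mul_left_cancel₀ hpi h5

lemma mollify_comm {f : Cn n → ℂ} (hf : Integrable f) {r s : ℝ} (hr : 0 < r) (hs : 0 < s)
    (x : Cn n) : mollify s (mollify r f) x = mollify r (mollify s f) x := by
  have h1 : ∀ {a b : ℝ}, 0 < a → 0 < b → mollify a (mollify b f) x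
      = ∫ t, f t * mollify b (fun y => (moll a (x - y) : ℂ)) t := fun ha hb => by
    exact integral_mollify_mul hf hb (integrable_moll_sub ha x).ofReal
  rw [h1 hs hr, h1 hr hs]
  refine integral_congr_ae (Filter.Eventually.of_forall fun t => ?_)
  simp only [mollify]
  rw [← integral_sub_left_eq_self _ volume (x + t)]
  refine congrArg _ (integral_congr_ae (Filter.Eventually.of_forall fun y => ?_))
  simp only
  rw [show x - (x + t - y) = -(t - y) by abel, show t - (x + t - y) = -(x - y) by abel,
    moll_congr s (norm_neg _), moll_congr r (norm_neg _), mul_comm]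

section Weyl

variable {Ω : Set (Cn n)} {h : Cn n → ℂ}

lemma mollify_indicator {L : Set (Cn n)} {r : ℝ} (hr : 0 < r) {x : Cn n}
    (hx : closedBall x r ⊆ L) : mollify r (L.indicator h) x = mollify r h x := by
  refine integral_congr_ae (Filter.Eventually.of_forall fun t => ?_)
  by_cases ht : t ∈ L
  · simp [ht]
  · have h1 : t ∉ closedBall x r := fun h => ht (hx h)
    rw [mem_closedBall', not_le, dist_eq_norm] at h1
    simp [moll_eq_zero hr h1.le]

variable (hh : L2loc Ω h) (hw : ∀ ψ, CcOn Ω 2 ψ → ∀ k, ∫ z, h z * dbar ψ z k = 0)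

include hh hw

lemma differentiableAt_mollify {L : Set (Cn n)} (hL : IsCompact L) (hLΩ : L ⊆ Ω) {r : ℝ}
    (hr : 0 < r) {x : Cn n} (hx : closedBall x r ⊆ L) :
    DifferentiableAt ℂ (mollify r (L.indicator h)) x := by
  have hi := hh.integrable_indicator hL hLΩ
  refine differentiableAt_of_dbar_eq_zero
    ((contDiff_mollify hi hr).differentiable (by simp)).differentiableAt fun k => ?_
  have hbL : CcOn L (⊤ : ℕ∞) (fun t => (moll r (x - t) : ℂ)) := ccOn_moll_sub hr hx
  have hb : CcOn Ω 2 (fun t => (moll r (x - t) : ℂ)) :=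
    CcOn.mono ⟨hbL.contDiff, hbL.compact, hbL.subset.trans hLΩ⟩ (by norm_cast)
  have h1 := hw _ hb k
  rw [dbar_mollify hi hr, ← neg_eq_zero, ← h1, ← integral_neg]
  refine integral_congr_ae (Filter.Eventually.of_forall fun t => ?_)
  simp only
  have h2 := dbar_translate (fun t => (moll r t : ℂ)) x t k
  rw [h2]
  by_cases ht : t ∈ L
  · simp [ht]
  · have h3 : dbar (fun t => (moll r (x - t) : ℂ)) t k = 0 :=
      (hbL.dbar (l := 0) (by norm_cast) k).eq_zero ht
    rw [h2] at h3
    rw [h3, neg_eq_zero.1 h3]; simp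

lemma mollify_eq_mollify {L : Set (Cn n)} (hL : IsCompact L) (hLΩ : L ⊆ Ω) {r s : ℝ}
    (hr : 0 < r) (hs : 0 < s) {x : Cn n} (hx : closedBall x (r + s) ⊆ L) :
    mollify r h x = mollify s h x := by
  have hi := hh.integrable_indicator hL hLΩ
  have key : ∀ {a b : ℝ}, 0 < a → 0 < b → closedBall x (a + b) ⊆ L →
      mollify b (mollify a (L.indicator h)) x = mollify a h x := fun {a b} ha hb hab => by
    rw [mollify_eq_self (contDiff_mollify hi ha).continuous hb fun z hz => ?_,
      mollify_indicator ha ((closedBall_subset_closedBall (by linarith)).trans hab)]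
    refine differentiableAt_mollify hh hw hL hLΩ ha
      ((closedBall_subset_closedBall' ?_).trans hab)
    rw [mem_closedBall] at hz
    linarith
  rw [← key hr hs hx, mollify_comm hi hr hs, key hs hr (by rwa [add_comm])]

/-- Weyl's lemma for weakly holomorphic functions. -/
lemma exists_holomorphic_of_weak (hΩ : IsOpen Ω) : ∃ H : Cn n → ℂ, DifferentiableOn ℂ H Ω ∧
    ∀ x r, 0 < r → closedBall x (2 * r) ⊆ Ω → H x = mollify r h x := by
  have hrad : ∀ x : Cn n, ∃ r : ℝ, x ∈ Ω → 0 < r ∧ closedBall x (2 * r) ⊆ Ω := fun x => by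
    by_cases hx : x ∈ Ω
    · obtain ⟨ε, hε, hεΩ⟩ := Metric.nhds_basis_closedBall.mem_iff.1 (hΩ.mem_nhds hx)
      exact ⟨ε / 2, fun _ => ⟨by positivity, by rwa [mul_div_cancel₀ _ two_ne_zero]⟩⟩
    · exact ⟨0, fun h => absurd h hx⟩
  choose R hR using hrad
  have hH : ∀ x r, 0 < r → closedBall x (2 * r) ⊆ Ω → mollify (R x) h x = mollify r h x := by
    intro x r hr hxr
    have hx : x ∈ Ω := hxr (mem_closedBall_self (by positivity))
    obtain ⟨hR1, hR2⟩ := hR x hx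
    rcases le_total r (R x) with hle | hle
    · exact mollify_eq_mollify hh hw (isCompact_closedBall x (2 * R x)) hR2 hR1 hr
        (closedBall_subset_closedBall (by linarith))
    · exact mollify_eq_mollify hh hw (isCompact_closedBall x (2 * r)) hxr hR1 hr
        (closedBall_subset_closedBall (by linarith))
  refine ⟨fun x => mollify (R x) h x, fun x hx => ?_, hH⟩
  obtain ⟨ε, hε, hεΩ⟩ := Metric.nhds_basis_closedBall.mem_iff.1 (hΩ.mem_nhds hx)
  have hr : 0 < ε / 3 := by positivity
  have hsub : ∀ y ∈ ball x (ε / 3), closedBall y (2 * (ε / 3)) ⊆ closedBall x ε := fun y hy =>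
    closedBall_subset_closedBall' (by rw [mem_ball] at hy; linarith)
  refine DifferentiableAt.differentiableWithinAt ((differentiableAt_mollify hh hw
    (isCompact_closedBall x ε) hεΩ hr (closedBall_subset_closedBall (by linarith))
    ).congr_of_eventuallyEq ?_)
  filter_upwards [ball_mem_nhds x hr] with y hy
  rw [hH y _ hr ((hsub y hy).trans hεΩ), mollify_indicator hr
    ((closedBall_subset_closedBall (by linarith)).trans (hsub y hy))]

end Weyl

/-! ### Rapidly growing convex functions -/

lemma hasDerivAt_max_zero_pow (k : ℕ) (x : ℝ) :
    HasDerivAt (fun x : ℝ => max x 0 ^ (k + 2)) ((k + 2) * max x 0 ^ (k + 1)) x := by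
  have hne : ∀ y ≠ (0 : ℝ), HasDerivAt (fun x : ℝ => max x 0 ^ (k + 2))
      ((k + 2) * max y 0 ^ (k + 1)) y := fun y hy => by
    rcases lt_or_gt_of_ne hy with h | h
    · rw [max_eq_right h.le, zero_pow (by omega), mul_zero]
      refine (hasDerivAt_const y (0 : ℝ)).congr_of_eventuallyEq ?_
      filter_upwards [Iio_mem_nhds h] with z hz
      rw [max_eq_right (le_of_lt hz), zero_pow (by omega)]
    · rw [max_eq_left h.le]
      have h1 := hasDerivAt_pow (k + 2) y
      push_cast at h1
      refine h1.congr_of_eventuallyEq ?_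
      filter_upwards [Ioi_mem_nhds h] with z hz
      rw [max_eq_left (le_of_lt hz)]
  by_cases hx : x = 0
  · subst hx
    refine hasDerivAt_of_hasDerivAt_of_ne (g := fun x : ℝ => (k + 2) * max x 0 ^ (k + 1)) hne ?_ ?_
    · exact Continuous.continuousAt (by fun_prop)
    · exact Continuous.continuousAt (by fun_prop)
  · exact hne x hx

/-- The locally finite sum `∑ a_N p(s - N + 1)`. -/
def rampSum (a : ℕ → ℝ) (p : ℝ → ℝ) (s : ℝ) : ℝ :=
  ∑ N ∈ Finset.range (⌈s⌉₊ + 1), a N * p (s - N + 1)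

lemma rampSum_eq (a : ℕ → ℝ) {p : ℝ → ℝ} (hp : ∀ x ≤ 0, p x = 0) {s : ℝ} {m : ℕ} (hs : s ≤ m) :
    rampSum a p s = ∑ N ∈ Finset.range (m + 1), a N * p (s - N + 1) := by
  refine Finset.sum_subset ?_ fun N _ hN => ?_
  · have : ⌈s⌉₊ ≤ m := Nat.ceil_le.2 hs
    exact Finset.range_subset_range.2 (by omega)
  · rw [Finset.mem_range, not_lt] at hN
    have h1 : (⌈s⌉₊ : ℝ) + 1 ≤ N := by exact_mod_cast hN
    have h2 := Nat.le_ceil s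
    rw [hp _ (by linarith), mul_zero]

lemma hasDerivAt_rampSum (a : ℕ → ℝ) {p q : ℝ → ℝ} (hp : ∀ x ≤ 0, p x = 0)
    (hq : ∀ x ≤ 0, q x = 0) (hpq : ∀ x, HasDerivAt p (q x) x) (s : ℝ) :
    HasDerivAt (rampSum a p) (rampSum a q s) s := by
  obtain ⟨m, hm⟩ := exists_nat_gt s
  rw [rampSum_eq a hq hm.le]
  have h1 : HasDerivAt (fun s => ∑ N ∈ Finset.range (m + 1), a N * p (s - N + 1))
      (∑ N ∈ Finset.range (m + 1), a N * q (s - N + 1)) s := by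
    refine HasDerivAt.fun_sum fun N _ => HasDerivAt.const_mul _ ?_
    have h2 : HasDerivAt (fun s : ℝ => s - N + 1) 1 s :=
      ((hasDerivAt_id s).sub_const _).add_const _
    have h3 := (hpq (s - N + 1)).comp s h2
    rwa [mul_one] at h3
  refine h1.congr_of_eventuallyEq ?_
  filter_upwards [Iio_mem_nhds hm] with z hz
  exact rampSum_eq a hp (le_of_lt hz)

lemma rampSum_nonneg {a : ℕ → ℝ} (ha : ∀ N, 0 ≤ a N) {p : ℝ → ℝ} (hp : ∀ x, 0 ≤ p x) (s : ℝ) :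
    0 ≤ rampSum a p s :=
  Finset.sum_nonneg fun N _ => mul_nonneg (ha N) (hp _)

/-- Nonnegative increasing convex `C²` functions on the line grow as fast as desired. -/
lemma exists_convex_growth (b : ℕ → ℝ) (hb : ∀ N, 0 ≤ b N) : ∃ κ κ1 κ2 : ℝ → ℝ,
    (∀ s, HasDerivAt κ (κ1 s) s) ∧ (∀ s, HasDerivAt κ1 (κ2 s) s) ∧ Continuous κ2 ∧
    (∀ s, 0 ≤ κ s) ∧ (∀ s, 0 ≤ κ1 s) ∧ (∀ s, 0 ≤ κ2 s) ∧ ∀ (N : ℕ) (s : ℝ), N ≤ s → b N ≤ κ1 s := by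
  have h0 : ∀ k : ℕ, ∀ c : ℝ, ∀ x ≤ (0 : ℝ), c * max x 0 ^ (k + 1) = 0 := fun k c x hx => by
    rw [max_eq_right hx, zero_pow (by omega), mul_zero]
  have hp : ∀ k : ℕ, ∀ c : ℝ, ∀ x, HasDerivAt (fun x : ℝ => c * max x 0 ^ (k + 2))
      ((c * (k + 2)) * max x 0 ^ (k + 1)) x := fun k c x => by
    rw [mul_assoc]; exact (hasDerivAt_max_zero_pow k x).const_mul c
  have hn : ∀ k : ℕ, ∀ c : ℝ, 0 ≤ c → ∀ x : ℝ, 0 ≤ c * max x 0 ^ k := fun k c hc x => by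
    have := le_max_right x 0
    positivity
  have d1 := hp 2 1
  have d2 := hp 1 (1 * ((2 : ℕ) + 2))
  have d3 := hp 0 (1 * ((2 : ℕ) + 2) * ((1 : ℕ) + 2))
  refine ⟨_, _, _, hasDerivAt_rampSum b (h0 3 _) (h0 2 _) d1,
    hasDerivAt_rampSum b (h0 2 _) (h0 1 _) d2, ?_, rampSum_nonneg hb (hn _ _ (by norm_num)),
    rampSum_nonneg hb (hn _ _ (by norm_num)), rampSum_nonneg hb (hn _ _ (by norm_num)), ?_⟩
  · exact continuous_iff_continuousAt.2 fun s =>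
      (hasDerivAt_rampSum b (h0 1 _) (h0 0 _) d3 s).continuousAt
  · intro N s hs
    have hNs : N ∈ Finset.range (⌈s⌉₊ + 1) := by
      rw [Finset.mem_range, Nat.lt_succ_iff]
      exact_mod_cast hs.trans (Nat.le_ceil s)
    have h1 : b N ≤ b N * (1 * ((2 : ℕ) + 2) * max (s - N + 1) 0 ^ (2 + 1)) := by
      refine le_mul_of_one_le_right (hb N) ?_
      have : (1 : ℝ) ≤ max (s - N + 1) 0 := le_max_of_le_left (by linarith)
      have := one_le_pow₀ this (n := 2 + 1)
      norm_num at this ⊢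
      linarith
    exact h1.trans (Finset.single_le_sum
      (f := fun N : ℕ => b N * (1 * (((2 : ℕ) : ℝ) + 2) * max (s - N + 1) 0 ^ (2 + 1)))
      (fun N _ => mul_nonneg (hb N) (hn _ _ (by norm_num) _)) hNs)

/-! ### Levi forms -/

section Levi

variable {Ω : Set (Cn n)} {f g : Cn n → ℝ} {z : Cn n}

lemma levi_add (hf : ContDiffAt ℝ 2 f z) (hg : ContDiffAt ℝ 2 g z) (w : Cn n) :
    LeviForm (fun x => f x + g x) z w = LeviForm f z w + LeviForm g z w := by
  have h1 : fderiv ℝ (fun x => f x + g x) =ᶠ[nhds z] fun x => fderiv ℝ f x + fderiv ℝ g x := by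
    filter_upwards [hf.eventually (by simp), hg.eventually (by simp)] with x hx hy
    exact fderiv_fun_add (hx.differentiableAt (by simp)) (hy.differentiableAt (by simp))
  have hdf : DifferentiableAt ℝ (fderiv ℝ f) z :=
    (hf.fderiv_right (m := 1) (by norm_num)).differentiableAt (by norm_num)
  have hdg : DifferentiableAt ℝ (fderiv ℝ g) z :=
    (hg.fderiv_right (m := 1) (by norm_num)).differentiableAt (by norm_num)
  simp only [LeviForm, h1.fderiv_eq, fderiv_fun_add hdf hdg, add_apply]
  ring

lemma levi_const_mul (hf : ContDiffAt ℝ 2 f z) (c : ℝ) (w : Cn n) :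
    LeviForm (fun x => c * f x) z w = c * LeviForm f z w := by
  have h1 : fderiv ℝ (fun x => c * f x) =ᶠ[nhds z] fun x => c • fderiv ℝ f x := by
    filter_upwards [hf.eventually (by simp)] with x hx
    exact fderiv_const_mul (hx.differentiableAt (by simp)) c
  have hdf : DifferentiableAt ℝ (fderiv ℝ f) z :=
    (hf.fderiv_right (m := 1) (by norm_num)).differentiableAt (by norm_num)
  simp only [LeviForm, h1.fderiv_eq, fderiv_fun_const_smul hdf, smul_apply, smul_eq_mul]
  ring

lemma levi_comp (hf : ContDiffAt ℝ 2 f z) {κ κ1 κ2 : ℝ → ℝ} (h1 : ∀ s, HasDerivAt κ (κ1 s) s)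
    (h2 : ∀ s, HasDerivAt κ1 (κ2 s) s) (w : Cn n) :
    LeviForm (fun x => κ (f x)) z w = κ1 (f z) * LeviForm f z w
      + (1 / 4) * κ2 (f z) * (fderiv ℝ f z w ^ 2 + fderiv ℝ f z (Complex.I • w) ^ 2) := by
  have e1 : fderiv ℝ (fun x => κ (f x)) =ᶠ[nhds z] fun x => κ1 (f x) • fderiv ℝ f x := by
    filter_upwards [hf.eventually (by simp)] with x hx
    exact ((h1 (f x)).comp_hasFDerivAt x (hx.differentiableAt (by simp)).hasFDerivAt).fderiv
  have hd0 : DifferentiableAt ℝ f z := hf.differentiableAt (by simp)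
  have hdf : DifferentiableAt ℝ (fderiv ℝ f) z :=
    (hf.fderiv_right (m := 1) (by norm_num)).differentiableAt (by norm_num)
  have hk : HasFDerivAt (fun x => κ1 (f x)) (κ2 (f z) • fderiv ℝ f z) z :=
    (h2 (f z)).comp_hasFDerivAt z hd0.hasFDerivAt
  have e2 := (hk.smul hdf.hasFDerivAt).fderiv
  simp only [LeviForm, e1.fderiv_eq]
  erw [e2]
  simp only [add_apply, smul_apply, smul_eq_mul, ContinuousLinearMap.smulRight_apply]
  ring

lemma contDiff_two_of_hasDerivAt {κ κ1 κ2 : ℝ → ℝ} (h1 : ∀ s, HasDerivAt κ (κ1 s) s)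
    (h2 : ∀ s, HasDerivAt κ1 (κ2 s) s) (h3 : Continuous κ2) : ContDiff ℝ 2 κ := by
  have e1 : deriv κ = κ1 := funext fun s => (h1 s).deriv
  have e2 : deriv κ1 = κ2 := funext fun s => (h2 s).deriv
  have c1 : ContDiff ℝ 1 κ1 := by
    rw [contDiff_one_iff_deriv, e2]
    exact ⟨fun s => (h2 s).differentiableAt, h3⟩
  rw [show (2 : WithTop ℕ∞) = 1 + 1 by norm_num, contDiff_succ_iff_deriv, e1]
  exact ⟨fun s => (h1 s).differentiableAt, by simp, c1⟩

end Levi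

/-! ### Cutoff functions and weights -/

section Weights

variable {Ω : Set (Cn n)} {R : Cn n → ℝ}

lemma gradSq_eq_zero_of_eventuallyEq {θ : Cn n → ℝ} {z : Cn n} {c : ℝ}
    (h : θ =ᶠ[nhds z] fun _ => c) : gradSq θ z = 0 := by
  refine Finset.sum_eq_zero fun j _ => ?_
  have h1 : (fun w => (θ w : ℂ)) =ᶠ[nhds z] fun _ => (c : ℂ) := by
    filter_upwards [h] with w hw
    rw [hw]
  rw [dbar_congr h1, dbar_const]; simp

lemma exists_cutoffs (hΩ : IsOpen Ω) (hR : ContDiffOn ℝ 2 R Ω)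
    (hc : ∀ c : ℝ, IsCompact {z ∈ Ω | R z ≤ c}) : ∃ χ : ℕ → Cn n → ℝ,
    (∀ N, CcOn Ω 2 (fun z => (χ N z : ℂ))) ∧ (∀ N, ContDiff ℝ 2 (χ N)) ∧
    (∀ N z, 0 ≤ χ N z ∧ χ N z ≤ 1) ∧ (∀ N : ℕ, ∀ z ∈ Ω, R z ≤ N → χ N z = 1) ∧
    (∀ N : ℕ, ∀ z ∈ Ω, (N : ℝ) + 1 ≤ R z → χ N z = 0) ∧ (∀ N, ∀ z ∉ Ω, χ N z = 0) := by
  classical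
  set χ : ℕ → Cn n → ℝ := fun N => Ω.indicator (fun z => Real.smoothTransition (N + 1 - R z))
    with hχ
  have h0 : ∀ N : ℕ, ∀ z ∉ {z ∈ Ω | R z ≤ (N : ℝ) + 1}, χ N z = 0 := fun N z hz => by
    by_cases hzΩ : z ∈ Ω
    · have : ¬ R z ≤ (N : ℝ) + 1 := fun h => hz ⟨hzΩ, h⟩
      simp only [hχ, indicator_of_mem hzΩ]
      exact Real.smoothTransition.zero_of_nonpos (by linarith)
    · simp [hχ, hzΩ]
  have hsub : ∀ N : ℕ, tsupport (χ N) ⊆ {z ∈ Ω | R z ≤ (N : ℝ) + 1} := fun N =>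
    closure_minimal (fun z hz => by_contra fun h => hz (h0 N z h)) (hc _).isClosed
  have hcd : ∀ N, ContDiff ℝ 2 (χ N) := fun N => contDiff_iff_contDiffAt.2 fun z => by
    by_cases hz : z ∈ tsupport (χ N)
    · have hzΩ := (hsub N hz).1
      have h1 : ContDiffAt ℝ 2 (fun z => Real.smoothTransition (N + 1 - R z)) z :=
        Real.smoothTransition.contDiffAt.comp z
          (contDiffAt_const.sub (hR.contDiffAt (hΩ.mem_nhds hzΩ)))
      refine h1.congr_of_eventuallyEq ?_
      filter_upwards [hΩ.mem_nhds hzΩ] with w hw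
      simp [hχ, hw]
    · exact contDiffAt_const.congr_of_eventuallyEq (notMem_tsupport_iff_eventuallyEq.1 hz)
  refine ⟨χ, fun N => ⟨Complex.ofRealCLM.contDiff.comp (hcd N), ?_, ?_⟩, hcd, fun N z => ?_,
    fun N z hz hRz => ?_, fun N z hz hRz => ?_, fun N z hz => by simp [hχ, hz]⟩
  · exact HasCompactSupport.comp_left (g := fun x : ℝ => (x : ℂ))
      (HasCompactSupport.intro (hc _) (h0 N)) Complex.ofReal_zero
  · refine ((tsupport_comp_subset (g := fun x : ℝ => (x : ℂ)) Complex.ofReal_zero _).trans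
      (hsub N)).trans fun z hz => hz.1
  · by_cases hz : z ∈ Ω
    · simp only [hχ, indicator_of_mem hz]
      exact ⟨Real.smoothTransition.nonneg _, Real.smoothTransition.le_one _⟩
    · simp [hχ, hz]
  · simp only [hχ, indicator_of_mem hz]
    exact Real.smoothTransition.one_of_one_le (by linarith)
  · simp only [hχ, indicator_of_mem hz]
    exact Real.smoothTransition.zero_of_nonpos (by linarith)

/-- A weight on a domain exhausted by a strictly plurisubharmonic function, growing so fast that
the gradients of an exhausting sequence of cutoff functions are negligible. -/
lemma exists_weight_cutoffs (hΩ : IsOpen Ω) (hR : ContDiffOn ℝ 2 R Ω)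
    (hc : ∀ c : ℝ, IsCompact {z ∈ Ω | R z ≤ c}) {δ : ℝ} (hδ : 0 < δ)
    (hL : ∀ z ∈ Ω, ∀ w, δ * ‖w‖ ^ 2 ≤ LeviForm R z w) :
    ∃ (Ψ μ : Cn n → ℝ) (χ : ℕ → Cn n → ℝ) (M : ℕ → ℝ), ContDiffOn ℝ 2 Ψ Ω ∧
      (∀ z ∈ Ω, 0 ≤ Ψ z) ∧ ContinuousOn μ Ω ∧ (∀ z ∈ Ω, 0 ≤ μ z) ∧
      (∀ z ∈ Ω, ∀ w, μ z * ‖w‖ ^ 2 ≤ LeviForm Ψ z w) ∧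
      (∀ N, CcOn Ω 2 (fun z => (χ N z : ℂ))) ∧ (∀ N, ContDiff ℝ 2 (χ N)) ∧
      (∀ N z, 0 ≤ χ N z ∧ χ N z ≤ 1) ∧ (∀ N, 0 ≤ M N) ∧ (∀ N z, gradSq (χ N) z ≤ M N) ∧
      (∀ N, ∀ z ∈ Ω, M (N + 1) * gradSq (χ N) z ≤ μ z) ∧
      (∀ L, IsCompact L → L ⊆ Ω → ∃ N0, ∀ N ≥ N0, ∀ z ∈ L, χ N =ᶠ[nhds z] fun _ => 1) ∧
      (∀ N z, gradSq (χ (N + 1)) z ≠ 0 → χ N z = 0) := by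
  obtain ⟨χ, hχc, hχd, hχ01, hχ1, hχ0, hχΩ⟩ := exists_cutoffs hΩ hR hc
  have hloc : ∀ N : ℕ, ∀ z ∈ Ω, R z < N → χ N =ᶠ[nhds z] fun _ => 1 := fun N z hz hRz => by
    filter_upwards [hΩ.mem_nhds hz,
      (hR.continuousOn.continuousAt (hΩ.mem_nhds hz)).eventually (Iio_mem_nhds hRz)] with w hw hw2
    exact hχ1 N w hw (le_of_lt hw2)
  have hgΩ : ∀ N z, gradSq (χ N) z ≠ 0 → z ∈ Ω ∧ (N : ℝ) ≤ R z := fun N z hz => by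
    have hzΩ : z ∈ Ω := by
      by_contra h
      refine hz (Finset.sum_eq_zero fun j _ => ?_)
      have : dbar (fun z => (χ N z : ℂ)) z j = 0 :=
        ((hχc N).dbar (l := 0) (by norm_num) j).eq_zero h
      rw [this]; simp
    refine ⟨hzΩ, ?_⟩
    by_contra h
    exact hz (gradSq_eq_zero_of_eventuallyEq (hloc N z hzΩ (not_le.1 h)))
  have hM : ∀ N, ∃ M : ℝ, 0 ≤ M ∧ ∀ z, gradSq (χ N) z ≤ M := fun N => by
    have h1 : Continuous (gradSq (χ N)) :=
      continuousOn_univ.1 (continuousOn_gradSq isOpen_univ (hχd N).contDiffOn)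
    have h2 : HasCompactSupport (gradSq (χ N)) :=
      HasCompactSupport.intro (hχc N).compact fun z hz => Finset.sum_eq_zero fun j _ => by
        have : dbar (fun z => (χ N z : ℂ)) z j = 0 :=
          image_eq_zero_of_notMem_tsupport (f := fun z => dbar (fun z => (χ N z : ℂ)) z j)
            fun h => hz (CcOn.tsupport_dbar _ j h)
        rw [this]; simp
    obtain ⟨C, hC⟩ := h1.bounded_above_of_compact_support h2
    refine ⟨C, (norm_nonneg _).trans (hC 0), fun z => (le_abs_self _).trans (hC z)⟩
  choose M hM0 hM using hM
  obtain ⟨κ, κ1, κ2, d1, d2, c2, p0, p1, p2, hgr⟩ :=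
    exists_convex_growth (fun N => M (N + 1) * M N / δ)
      (fun N => div_nonneg (mul_nonneg (hM0 _) (hM0 _)) hδ.le)
  refine ⟨fun z => κ (R z), fun z => δ * κ1 (R z), χ, M,
    (contDiff_two_of_hasDerivAt d1 d2 c2).comp_contDiffOn hR, fun z _ => p0 _, ?_,
    fun z _ => mul_nonneg hδ.le (p1 _), fun z hz w => ?_, hχc, hχd, hχ01, hM0, hM,
    fun N z hz => ?_, fun L hLc hLΩ => ?_, fun N z hz => ?_⟩
  · have h1 : Continuous κ1 := continuous_iff_continuousAt.2 fun s => (d2 s).continuousAt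
    exact continuousOn_const.mul (h1.comp_continuousOn hR.continuousOn)
  · rw [levi_comp (hR.contDiffAt (hΩ.mem_nhds hz)) d1 d2]
    have h1 := mul_le_mul_of_nonneg_left (hL z hz w) (p1 (R z))
    have h2 : 0 ≤ (1 / 4) * κ2 (R z)
        * (fderiv ℝ R z w ^ 2 + fderiv ℝ R z (Complex.I • w) ^ 2) := by
      have := p2 (R z)
      positivity
    linarith
  · by_cases h0 : gradSq (χ N) z = 0
    · rw [h0, mul_zero]; exact mul_nonneg hδ.le (p1 _)
    · have h1 := hgr N (R z) (hgΩ N z h0).2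
      rw [div_le_iff₀ hδ] at h1
      calc M (N + 1) * gradSq (χ N) z ≤ M (N + 1) * M N :=
            mul_le_mul_of_nonneg_left (hM N z) (hM0 _)
        _ ≤ δ * κ1 (R z) := by rwa [mul_comm δ]
  · obtain ⟨C, hC⟩ := hLc.exists_bound_of_continuousOn (hR.continuousOn.mono hLΩ)
    obtain ⟨N0, hN0⟩ := exists_nat_gt C
    refine ⟨N0, fun N hN z hz => hloc N z (hLΩ hz) ?_⟩
    have h1 := (le_abs_self _).trans (hC z hz)
    have h2 : (N0 : ℝ) ≤ N := by exact_mod_cast hN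
    linarith
  · obtain ⟨hzΩ, h1⟩ := hgΩ (N + 1) z hz
    push_cast at h1
    exact hχ0 N z hzΩ h1

end Weights

lemma gradSq_one_sub {θ : Cn n → ℝ} (hθ : Differentiable ℝ θ) (z : Cn n) :
    gradSq (fun w => 1 - θ w) z = gradSq θ z := by
  refine Finset.sum_congr rfl fun j _ => ?_
  have h1 : DifferentiableAt ℝ (fun w => (θ w : ℂ)) z :=
    Complex.ofRealCLM.differentiableAt.comp z (hθ z)
  simp only [ofReal_sub, ofReal_one]
  rw [dbar_sub (a := fun _ => (1 : ℂ)) (differentiableAt_const _) h1, dbar_const, zero_sub, norm_neg]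

lemma integral_gradSq_formPart_le {Ω : Set (Cn n)} (hΩ : IsOpen Ω) {W : Cn n → ℝ}
    {X : Cn n → PairSpace n} (hX2 : Integrable (fun z => ‖X z‖ ^ 2)) {χ η : Cn n → ℝ} {M : ℝ}
    (hχ : CcOn Ω 2 (fun z => (χ z : ℂ))) (hM0 : 0 ≤ M) (hM : ∀ z, gradSq χ z ≤ M)
    (hη : Continuous η) (hη1 : ∀ z, |η z| ≤ 1) (hχη : ∀ z, gradSq χ z ≠ 0 → η z = 1) :
    ∫ z, gradSq χ z * (∑ i, ∑ k, ‖formPart W X i k z‖ ^ 2) * ew W z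
      ≤ 2 * (M * ∫ z in Ω, η z ^ 2 * ‖X z‖ ^ 2) := by
  have hintg : Integrable (fun z => η z ^ 2 * ‖X z‖ ^ 2) := by
    refine hX2.bdd_mul (c := 1) (hη.pow 2).aestronglyMeasurable
      (Filter.Eventually.of_forall fun z => ?_)
    rw [Real.norm_eq_abs, abs_pow]
    exact pow_le_one₀ (abs_nonneg _) (hη1 z)
  have hint2 : Integrable (fun z => 2 * (M * (η z ^ 2 * ‖X z‖ ^ 2))) :=
    (hintg.const_mul M).const_mul 2
  have hpt : ∀ z, gradSq χ z * (∑ i, ∑ k, ‖formPart W X i k z‖ ^ 2) * ew W z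
      ≤ Ω.indicator (fun z => 2 * (M * (η z ^ 2 * ‖X z‖ ^ 2))) z := fun z => by
    by_cases h0 : gradSq χ z = 0
    · rw [h0, zero_mul, zero_mul]
      exact indicator_nonneg (fun z _ => by positivity) z
    · have hzΩ : z ∈ Ω := by
        by_contra h
        refine h0 (Finset.sum_eq_zero fun j _ => ?_)
        have : dbar (fun z => (χ z : ℂ)) z j = 0 := (hχ.dbar (l := 0) (by norm_num) j).eq_zero h
        rw [this]; simp
      rw [indicator_of_mem hzΩ, hχη z h0, mul_assoc]
      have h1 := sum_norm_formPart_sq_le W X z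
      have h2 : 0 ≤ (∑ i, ∑ k, ‖formPart W X i k z‖ ^ 2) * ew W z :=
        mul_nonneg (Finset.sum_nonneg fun _ _ => Finset.sum_nonneg fun _ _ => sq_nonneg _)
          (ew_pos W z).le
      have h3 := mul_le_mul (hM z) h1 h2 hM0
      linarith
  have h0 : ∀ z, 0 ≤ gradSq χ z * (∑ i, ∑ k, ‖formPart W X i k z‖ ^ 2) * ew W z := fun z =>
    mul_nonneg (mul_nonneg (gradSq_nonneg _ _)
      (Finset.sum_nonneg fun _ _ => Finset.sum_nonneg fun _ _ => sq_nonneg _)) (ew_pos W z).le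
  have h1 := integral_mono_of_nonneg (Filter.Eventually.of_forall h0)
    (hint2.indicator hΩ.measurableSet) (Filter.Eventually.of_forall hpt)
  rwa [integral_indicator hΩ.measurableSet, integral_const_mul, integral_const_mul] at h1

/-- Correction of a compactly supported function to a holomorphic function, with the localized
weighted estimates for the correction. -/
lemma exists_holomorphic_correction {Ω : Set (Cn n)} (hΩ : IsOpen Ω) {W lam : Cn n → ℝ} {c : ℝ}
    (hW : ContDiffOn ℝ 2 W Ω) (hlam : ContinuousOn lam Ω)
    (hL : ∀ z ∈ Ω, ∀ w, lam z * ‖w‖ ^ 2 ≤ LeviForm W z w) (hc : 0 < c) (hcl : ∀ z ∈ Ω, c ≤ lam z)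
    {χ : ℕ → Cn n → ℝ} {M : ℕ → ℝ} (hχc : ∀ N, CcOn Ω 2 (fun z => (χ N z : ℂ)))
    (hχd : ∀ N, ContDiff ℝ 2 (χ N)) (hχ01 : ∀ N z, 0 ≤ χ N z ∧ χ N z ≤ 1) (hM0 : ∀ N, 0 ≤ M N)
    (hM : ∀ N z, gradSq (χ N) z ≤ M N)
    (hMl : ∀ N, ∀ z ∈ Ω, M (N + 1) * gradSq (χ N) z ≤ lam z)
    (hχ1 : ∀ L, IsCompact L → L ⊆ Ω → ∃ N0, ∀ N ≥ N0, ∀ z ∈ L, χ N =ᶠ[nhds z] fun _ => 1)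
    (hχ0 : ∀ N z, gradSq (χ (N + 1)) z ≠ 0 → χ N z = 0) {F : Cn n → ℂ} (hF : CcOn Ω 1 F) :
    ∃ (X : Lp (PairSpace n) 2 (volume : Measure (Cn n))) (H : Cn n → ℂ), DifferentiableOn ℂ H Ω ∧
      (∀ x r, 0 < r → closedBall x (2 * r) ⊆ Ω →
        H x = mollify r (fun z => F z - scalarPart W X z) x) ∧
      (∀ θ : Cn n → ℝ, ContDiffOn ℝ 2 θ Ω → (∀ z ∈ Ω, |θ z| ≤ 1) →
        (∀ z ∈ Ω, gradSq θ z ≤ c / 8 * θ z ^ 2) →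
        ∫ z in Ω, θ z ^ 2 * ‖X z‖ ^ 2
          ≤ 6 / c * ∫ z, θ z ^ 2 * (∑ j, ‖dbar F z j‖ ^ 2) * ew W z) := by
  obtain ⟨X, hX, hC1, hC2⟩ := exists_weak_solution hΩ hW hlam hL hc hcl hF
  have hXm : MemLp X 2 volume := Lp.memLp X
  have hX2 : Integrable (fun z => ‖X z‖ ^ 2) := hXm.integrable_norm_pow (p := 2) (by norm_num)
  have hh : L2loc Ω (fun z => F z - scalarPart W X z) :=
    (L2loc.of_continuousOn hF.continuous.continuousOn).sub (l2loc_scalarPart hW.continuousOn hXm)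
  have hw : ∀ ψ, CcOn Ω 2 ψ → ∀ k, ∫ z, (F z - scalarPart W X z) * dbar ψ z k = 0 := by
    intro ψ hψ k
    refine integral_mul_dbar_eq_zero hΩ hW hh (fun i k => l2loc_formPart hW.continuousOn hXm i k)
      (fun i k z => formPart_antisymm W X i k z)
      (fun b hb k => weak_relation hΩ hW hF hX hb k) hψ k fun κ hκ => ?_
    obtain ⟨S, hSc, hSΩ, hS⟩ := hC2 (κ / 2) (by positivity)
    obtain ⟨N, hN⟩ := hχ1 (tsupport ψ ∪ tsupport F ∪ S) ((hψ.compact.union hF.compact).union hSc)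
      (union_subset (union_subset hψ.subset hF.subset) hSΩ)
    have hgr := gradSq_one_sub ((hχd N).differentiable (by norm_num))
    have habs : ∀ z, |1 - χ N z| ≤ 1 := fun z => by
      have := hχ01 N z
      rw [abs_le]; constructor <;> linarith
    have key := hS (fun z => 1 - χ N z) (M (N + 1)) (M N)
      (contDiff_const.sub (hχd N)).contDiffOn (fun z _ => habs z) (hM0 _) (hM0 _)
      (fun z _ => by rw [hgr]; exact hM N z) (fun z hz => by rw [hgr]; exact hMl N z hz)
      (fun z hz j => by
        refine image_eq_zero_of_notMem_tsupport (f := fun z => dbar F z j) fun h => hz ?_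
        have := (hN N le_rfl z (Or.inl (Or.inr (CcOn.tsupport_dbar _ j h)))).eq_of_nhds
        simp [this])
      (fun z hz => by
        rw [hgr]; exact gradSq_eq_zero_of_eventuallyEq (hN N le_rfl z (Or.inr hz)))
    refine ⟨χ (N + 1), hχc _, fun z hz =>
      (hN (N + 1) (by omega) z (Or.inl (Or.inl hz))).eq_of_nhds, ?_⟩
    have h1 := integral_gradSq_formPart_le (W := W) (η := fun z => 1 - χ N z) hΩ hX2 (hχc (N + 1)) (hM0 _)
      (hM (N + 1)) (continuous_const.sub (hχd N).continuous) habs (fun z hz => by rw [hχ0 N z hz, sub_zero])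
    linarith
  obtain ⟨H, hH1, hH2⟩ := exists_holomorphic_of_weak hh hw hΩ
  exact ⟨X, H, hH1, hH2, hC1⟩

lemma gradSq_le_of_fderiv {θ : Cn n → ℝ} {z : Cn n} (hθ : DifferentiableAt ℝ θ z) {A : ℝ}
    (hA : ∀ v, |fderiv ℝ θ z v| ≤ A * ‖v‖) : gradSq θ z ≤ n * A ^ 2 := by
  have h1 : ∀ j ∈ Finset.univ, ‖dbar (fun w => (θ w : ℂ)) z j‖ ^ 2 ≤ A ^ 2 := fun j _ => by
    have e1 : ‖e n j‖ = 1 := by simp [e]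
    have e2 : ‖Complex.I • e n j‖ = 1 := by rw [norm_smul, e1]; simp
    have a1 := hA (e n j)
    have a2 := hA (Complex.I • e n j)
    rw [e1, mul_one] at a1
    rw [e2, mul_one] at a2
    refine pow_le_pow_left₀ (norm_nonneg _) ?_ 2
    rw [dbar, fderiv_ofReal_apply hθ, fderiv_ofReal_apply hθ, norm_mul]
    have h3 := norm_add_le ((fderiv ℝ θ z (e n j) : ℝ) : ℂ)
      (Complex.I * ((fderiv ℝ θ z (Complex.I • e n j) : ℝ) : ℂ))
    rw [norm_mul, Complex.norm_I, one_mul, Complex.norm_real, Complex.norm_real, Real.norm_eq_abs,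
      Real.norm_eq_abs] at h3
    have h4 : ‖(1 / 2 : ℂ)‖ = 1 / 2 := by norm_num
    rw [h4]
    linarith
  have h2 := Finset.sum_le_sum h1
  simpa [gradSq] using h2

/-- A polynomially decaying peak at `p` of width `s⁻¹`. -/
def peak (m : ℕ) (s : ℝ) (p z : Cn n) : ℝ := ((1 + s ^ 2 * ‖z - p‖ ^ 2) ^ m)⁻¹

section peak

variable {m : ℕ} {s : ℝ} {p : Cn n}

lemma contDiff_peak_base : ContDiff ℝ 2 (fun z : Cn n => 1 + s ^ 2 * ‖z - p‖ ^ 2) :=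
  contDiff_const.add (contDiff_const.mul ((contDiff_id.sub contDiff_const).norm_sq ℝ))

lemma contDiff_peak : ContDiff ℝ 2 (peak m s p) :=
  (contDiff_peak_base.pow m).inv fun z => by positivity

lemma peak_pos (z : Cn n) : 0 < peak m s p z := by unfold peak; positivity

lemma peak_le_one (z : Cn n) : peak m s p z ≤ 1 :=
  inv_le_one_of_one_le₀ (one_le_pow₀ (by have : 0 ≤ s ^ 2 * ‖z - p‖ ^ 2 := by positivity
                                         linarith))

lemma fderiv_peak_le (hs : 0 ≤ s) (z v : Cn n) :
    |fderiv ℝ (peak m s p) z v| ≤ m * s * peak m s p z * ‖v‖ := by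
  set q : Cn n → ℝ := fun z => 1 + s ^ 2 * ‖z - p‖ ^ 2 with hq
  have hq0 : 0 < q z := by simp only [hq]; positivity
  have hqd : HasFDerivAt q (s ^ 2 • (2 • (innerSL ℝ (z - p)).comp
      (ContinuousLinearMap.id ℝ (Cn n)))) z := by
    have h1 : HasFDerivAt (fun z : Cn n => z - p) (ContinuousLinearMap.id ℝ (Cn n)) z :=
      (hasFDerivAt_id z).sub_const p
    exact (h1.norm_sq.const_mul (s ^ 2)).const_add 1
  have h2 : HasFDerivAt (peak m s p) _ z := (hasDerivAt_inv (pow_ne_zero m hq0.ne')).comp_hasFDerivAt z (hqd.pow m)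
  have hin : |inner ℝ (z - p) v| ≤ ‖z - p‖ * ‖v‖ := abs_real_inner_le_norm _ _
  have hsq : 2 * s ^ 2 * ‖z - p‖ ≤ s * q z := by
    have h3 := mul_nonneg hs (sq_nonneg (s * ‖z - p‖ - 1))
    simp only [hq]
    linarith
  have hmq : (m : ℝ) * q z ^ (m - 1) * q z = m * q z ^ m := by
    rcases Nat.eq_zero_or_pos m with h0 | h0
    · simp [h0]
    · rw [mul_assoc, ← pow_succ, Nat.sub_add_cancel h0]
  have hpk : peak m s p z = (q z ^ m)⁻¹ := rfl
  have h4 : fderiv ℝ (peak m s p) z v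
      = -((q z ^ m)⁻¹ ^ 2 * (m * q z ^ (m - 1)) * (2 * s ^ 2 * inner ℝ (z - p) v)) := by
    rw [h2.fderiv]
    simp [inner_sub_left]
    ring
  rw [h4, abs_neg, abs_mul, abs_mul (2 * s ^ 2), abs_of_nonneg (by positivity),
    abs_of_nonneg (by positivity : 0 ≤ 2 * s ^ 2)]
  have h5 : 2 * s ^ 2 * |inner ℝ (z - p) v| ≤ s * q z * ‖v‖ := by
    have h6 := mul_le_mul_of_nonneg_left hin (by positivity : 0 ≤ 2 * s ^ 2)
    have h7 := mul_le_mul_of_nonneg_right hsq (norm_nonneg v)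
    linarith
  have h8 := mul_le_mul_of_nonneg_left h5
    (by positivity : 0 ≤ (q z ^ m)⁻¹ ^ 2 * (m * q z ^ (m - 1)))
  refine h8.trans (le_of_eq ?_)
  rw [hpk]
  have h9 : q z ^ m * (q z ^ m)⁻¹ = 1 := mul_inv_cancel₀ (pow_ne_zero _ hq0.ne')
  calc _ = (q z ^ m)⁻¹ ^ 2 * (m * q z ^ (m - 1) * q z) * s * ‖v‖ := by ring
    _ = (q z ^ m * (q z ^ m)⁻¹) * (m * s * (q z ^ m)⁻¹ * ‖v‖) := by rw [hmq]; ring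
    _ = _ := by rw [h9, one_mul]

lemma gradSq_peak_le (hs : 0 ≤ s) (z : Cn n) :
    gradSq (peak m s p) z ≤ n * m ^ 2 * s ^ 2 * peak m s p z ^ 2 := by
  have h := gradSq_le_of_fderiv (contDiff_peak.differentiable (by norm_num) z) fun v =>
    fderiv_peak_le (m := m) (p := p) hs z v
  calc _ ≤ _ := h
    _ = _ := by ring

lemma integrable_peak_sq_zero (hm : Module.finrank ℝ (Cn n) < m) :
    Integrable (fun z : Cn n => peak m 1 0 z ^ 2) := by
  have h := integrable_rpow_neg_one_add_norm_sq (E := Cn n) (μ := volume) (r := (4 * m : ℕ))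
    (by exact_mod_cast (by omega : Module.finrank ℝ (Cn n) < 4 * m))
  refine h.congr (Filter.Eventually.of_forall fun z => ?_)
  have h1 : (-((4 * m : ℕ) : ℝ) / 2) = -((2 * m : ℕ) : ℝ) := by push_cast; ring
  simp only [peak, h1]
  rw [Real.rpow_neg (by positivity), Real.rpow_natCast]
  simp only [one_pow, one_mul, sub_zero, inv_pow, ← pow_mul, mul_comm]

lemma peak_eq (z : Cn n) : peak m s p z = peak m 1 0 (s • (z - p)) := by
  simp only [peak, norm_smul, Real.norm_eq_abs, mul_pow, sq_abs, one_pow, one_mul, sub_zero]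

lemma integrable_peak_sq (hm : Module.finrank ℝ (Cn n) < m) (hs : 0 < s) :
    Integrable (fun z : Cn n => peak m s p z ^ 2) := by
  have h := ((integrable_peak_sq_zero (n := n) hm).comp_smul hs.ne').comp_sub_right p
  exact h.congr (Filter.Eventually.of_forall fun z => by simp only [peak_eq (s := s) (p := p)])

lemma integral_peak_sq (hs : 0 < s) :
    ∫ z : Cn n, peak m s p z ^ 2
      = (s ^ Module.finrank ℝ (Cn n))⁻¹ * ∫ z : Cn n, peak m 1 0 z ^ 2 := by
  simp only [peak_eq (s := s) (p := p)]
  rw [integral_sub_right_eq_self (fun z => peak m 1 0 (s • z) ^ 2),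
    Measure.integral_comp_smul_of_nonneg volume (fun z => peak m 1 0 z ^ 2) s (hR := hs.le),
    smul_eq_mul]

lemma le_peak_sq (hs : 0 ≤ s) {r : ℝ} (hsr : s * r ≤ 1) {z : Cn n} (hz : ‖z - p‖ ≤ r) :
    (4 ^ m : ℝ)⁻¹ ≤ peak m s p z ^ 2 := by
  have h1 : s * ‖z - p‖ ≤ 1 := (mul_le_mul_of_nonneg_left hz hs).trans hsr
  have h2 : s ^ 2 * ‖z - p‖ ^ 2 ≤ 1 := by
    rw [← mul_pow]; exact pow_le_one₀ (by positivity) h1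
  rw [peak, inv_pow, ← pow_mul, mul_comm m 2, pow_mul]
  refine inv_anti₀ (by positivity) (pow_le_pow_left₀ (by positivity) ?_ m)
  have h3 : (1 + s ^ 2 * ‖z - p‖ ^ 2) ≤ 2 := by linarith
  calc (1 + s ^ 2 * ‖z - p‖ ^ 2) ^ 2 ≤ 2 ^ 2 := pow_le_pow_left₀ (by positivity) h3 2
    _ = 4 := by norm_num

end peak

/-- Near a compact set of zeros, a nonnegative `C²` function vanishes to second order. -/
lemma exists_quadratic_bound {Ω : Set (Cn n)} (hΩ : IsOpen Ω) {φ : Cn n → ℝ}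
    (hφ : ContDiffOn ℝ 2 φ Ω) (hφ0 : ∀ z ∈ Ω, 0 ≤ φ z) {K L : Set (Cn n)} (hL : IsCompact L)
    (hLΩ : L ⊆ Ω) (hK : ∀ p ∈ K, p ∈ Ω ∧ φ p = 0) :
    ∃ C, 0 ≤ C ∧ ∀ p ∈ K, ∀ z, closedBall p ‖z - p‖ ⊆ L → φ z ≤ C * ‖z - p‖ ^ 2 := by
  have hd1 : ContDiffOn ℝ 1 (fderiv ℝ φ) Ω := hφ.fderiv_of_isOpen hΩ (by norm_num)
  have hd2 : ContinuousOn (fderiv ℝ (fderiv ℝ φ)) Ω := hd1.continuousOn_fderiv_of_isOpen hΩ le_rfl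
  obtain ⟨C, hC⟩ := hL.exists_bound_of_continuousOn
    (E := Cn n →L[ℝ] Cn n →L[ℝ] ℝ) (f := fderiv ℝ (fderiv ℝ φ)) (hd2.mono hLΩ)
  refine ⟨max C 0, le_max_right _ _, fun p hp z hz => ?_⟩
  have hpΩ := (hK p hp).1
  have hmin : fderiv ℝ φ p = 0 := by
    refine IsLocalMin.fderiv_eq_zero ?_
    filter_upwards [hΩ.mem_nhds hpΩ] with y hy
    rw [(hK p hp).2]; exact hφ0 y hy
  have hconv := convex_closedBall p ‖z - p‖
  have hpm : p ∈ closedBall p ‖z - p‖ := mem_closedBall_self (norm_nonneg _)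
  have hzm : z ∈ closedBall p ‖z - p‖ := by rw [mem_closedBall, dist_eq_norm]
  have h1 : ∀ y ∈ closedBall p ‖z - p‖, ‖fderiv ℝ φ y‖ ≤ max C 0 * ‖z - p‖ := fun y hy => by
    have := hconv.norm_image_sub_le_of_norm_fderiv_le (𝕜 := ℝ) (f := fderiv ℝ φ)
      (fun x hx => (hd1.contDiffAt (hΩ.mem_nhds (hLΩ (hz hx)))).differentiableAt (by norm_num))
      (fun x hx => (hC x (hz hx)).trans (le_max_left C 0)) hpm hy
    rw [hmin, sub_zero] at this
    refine this.trans (mul_le_mul_of_nonneg_left ?_ (le_max_right _ _))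
    rwa [mem_closedBall, dist_eq_norm] at hy
  have h2 := hconv.norm_image_sub_le_of_norm_fderiv_le (𝕜 := ℝ) (f := φ)
      (fun x hx => (hφ.contDiffAt (hΩ.mem_nhds (hLΩ (hz hx)))).differentiableAt (by norm_num))
      h1 hpm hzm
  rw [(hK p hp).2, sub_zero] at h2
  calc φ z ≤ ‖φ z‖ := le_abs_self _
    _ ≤ _ := h2
    _ = _ := by ring

lemma norm_mollify_scalarPart_sq_le {Ω : Set (Cn n)} (hΩ : IsOpen Ω) {W θ : Cn n → ℝ}
    (hW : ContinuousOn W Ω) (X : Lp (PairSpace n) 2 (volume : Measure (Cn n))) {p : Cn n}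
    {r κ A : ℝ} (hr : 0 < r) (hp : closedBall p r ⊆ Ω) (hθ : Continuous θ) (hθ1 : ∀ z, |θ z| ≤ 1)
    (hκ : 0 < κ) (hθκ : ∀ z ∈ closedBall p r, κ ≤ θ z ^ 2) (hWA : ∀ z ∈ closedBall p r, W z ≤ A) :
    ‖mollify r (scalarPart W X) p‖ ^ 2
      ≤ (bumpMass n)⁻¹ * (r ^ Module.finrank ℝ (Cn n))⁻¹ * Real.exp A * κ⁻¹ *
        ∫ z in Ω, θ z ^ 2 * ‖X z‖ ^ 2 := by
  have hXm : MemLp X 2 volume := Lp.memLp X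
  have hX2 : Integrable (fun z => ‖X z‖ ^ 2) := hXm.integrable_norm_pow (p := 2) (by norm_num)
  have hintg : Integrable (fun z => θ z ^ 2 * ‖X z‖ ^ 2) := by
    refine hX2.bdd_mul (c := 1) (hθ.pow 2).aestronglyMeasurable
      (Filter.Eventually.of_forall fun z => ?_)
    rw [Real.norm_eq_abs, abs_pow]
    exact pow_le_one₀ (abs_nonneg _) (hθ1 z)
  have hL := isCompact_closedBall p r
  have hu := l2loc_scalarPart hW hXm
  set f : Cn n → ℂ := (closedBall p r).indicator (scalarPart W X) with hf
  have hfi : Integrable f := hu.integrable_indicator hL hp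
  have hf2 : Integrable (fun t => ‖f t‖ ^ 2) := hu.integrable_indicator_sq hL hp
  have h1 := norm_integral_mul_moll_sq_le hfi hr hf2 (x := p) (w := fun _ => 1) (ω := 1)
    (fun _ _ _ => by simp)
  have h2 : ∫ t, f t * 1 * (moll r (p - t) : ℂ) = mollify r (scalarPart W X) p := by
    rw [← mollify_indicator hr (h := scalarPart W X) (le_refl (closedBall p r))]
    simp only [mul_one]; rfl
  rw [h2, one_pow, one_mul] at h1
  refine h1.trans ?_
  set m₀ := (bumpMass n)⁻¹ * (r ^ Module.finrank ℝ (Cn n))⁻¹ with hm₀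
  have hm0 : 0 ≤ m₀ := (moll_nonneg hr (0 : Cn n)).trans (moll_le hr 0)
  have hpt : ∀ t, ‖f t‖ ^ 2 * moll r (p - t)
      ≤ Ω.indicator (fun t => m₀ * Real.exp A * κ⁻¹ * (θ t ^ 2 * ‖X t‖ ^ 2)) t := fun t => by
    by_cases ht : t ∈ closedBall p r
    · rw [hf, indicator_of_mem ht, indicator_of_mem (hp ht)]
      have a1 := norm_scalarPart_sq_le W X t
      have a2 : 1 ≤ Real.exp A * ew W t := by
        rw [ew, ← Real.exp_add]
        exact Real.one_le_exp (by linarith [hWA t ht])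
      have a3 : 1 ≤ κ⁻¹ * θ t ^ 2 := by
        rw [inv_mul_eq_div, le_div_iff₀ hκ, one_mul]; exact hθκ t ht
      have a4 : ‖scalarPart W X t‖ ^ 2 ≤ Real.exp A * ‖X t‖ ^ 2 :=
        calc _ = ‖scalarPart W X t‖ ^ 2 * 1 := (mul_one _).symm
          _ ≤ ‖scalarPart W X t‖ ^ 2 * (Real.exp A * ew W t) :=
            mul_le_mul_of_nonneg_left a2 (sq_nonneg _)
          _ = Real.exp A * (‖scalarPart W X t‖ ^ 2 * ew W t) := by ring
          _ ≤ _ := mul_le_mul_of_nonneg_left a1 (Real.exp_pos A).le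
      have a5 : Real.exp A * ‖X t‖ ^ 2 ≤ Real.exp A * ‖X t‖ ^ 2 * (κ⁻¹ * θ t ^ 2) :=
        le_mul_of_one_le_right (by positivity) a3
      calc _ ≤ (Real.exp A * ‖X t‖ ^ 2 * (κ⁻¹ * θ t ^ 2)) * m₀ :=
            mul_le_mul (a4.trans a5) (moll_le hr _) (moll_nonneg hr _) (by positivity)
        _ = _ := by ring
    · rw [hf, indicator_of_notMem ht]
      simp only [norm_zero, ne_eq, OfNat.ofNat_ne_zero, not_false_eq_true, zero_pow, zero_mul]
      exact indicator_nonneg (fun t _ => by positivity) t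
  have h3 := integral_mono_of_nonneg
    (Filter.Eventually.of_forall fun t => mul_nonneg (sq_nonneg ‖f t‖) (moll_nonneg hr (p - t)))
    ((hintg.const_mul (m₀ * Real.exp A * κ⁻¹)).indicator hΩ.measurableSet)
    (Filter.Eventually.of_forall hpt)
  rwa [integral_indicator hΩ.measurableSet, integral_const_mul] at h3

lemma norm_correction_sq_le {Ω : Set (Cn n)} (hΩ : IsOpen Ω) {W : Cn n → ℝ}
    (hW : ContinuousOn W Ω) (hW0 : ∀ z ∈ Ω, 0 ≤ W z)
    (X : Lp (PairSpace n) 2 (volume : Measure (Cn n))) {F : Cn n → ℂ} {B : ℝ} (hB0 : 0 ≤ B)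
    (hB : ∀ z, ∑ j, ‖dbar F z j‖ ^ 2 ≤ B) (hF : CcOn Ω 1 F)
    {p : Cn n} {m : ℕ} (hm : Module.finrank ℝ (Cn n) < m) {r s A c : ℝ} (hr : 0 < r) (hs : 0 < s)
    (hsr : s * r ≤ 1) (hc : 0 < c) (hp : closedBall p r ⊆ Ω)
    (hWA : ∀ z ∈ closedBall p r, W z ≤ A)
    (hX : ∫ z in Ω, peak m s p z ^ 2 * ‖X z‖ ^ 2
          ≤ 6 / c * ∫ z, peak m s p z ^ 2 * (∑ j, ‖dbar F z j‖ ^ 2) * ew W z) :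
    ‖mollify r (scalarPart W X) p‖ ^ 2
      ≤ (bumpMass n)⁻¹ * (r ^ Module.finrank ℝ (Cn n))⁻¹ * Real.exp A * 4 ^ m *
        (6 / c * (B * ((s ^ Module.finrank ℝ (Cn n))⁻¹ * ∫ z : Cn n, peak m 1 0 z ^ 2))) := by
  have h1 := norm_mollify_scalarPart_sq_le hΩ hW X hr hp (contDiff_peak (m := m) (s := s) (p := p)).continuous
    (fun z => by rw [abs_of_pos (peak_pos z)]; exact peak_le_one z)
    (by positivity : 0 < (4 ^ m : ℝ)⁻¹)
    (fun z hz => le_peak_sq hs.le hsr (by rwa [mem_closedBall, dist_eq_norm] at hz)) hWA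
  rw [inv_inv] at h1
  have hpt : ∀ z, peak m s p z ^ 2 * (∑ j, ‖dbar F z j‖ ^ 2) * ew W z ≤ B * peak m s p z ^ 2 :=
    fun z => by
    have hp2 : 0 ≤ peak m s p z ^ 2 := sq_nonneg _
    have hS : 0 ≤ ∑ j, ‖dbar F z j‖ ^ 2 := Finset.sum_nonneg fun _ _ => sq_nonneg _
    by_cases hz : z ∈ Ω
    · have he : ew W z ≤ 1 := Real.exp_le_one_iff.2 (by linarith [hW0 z hz])
      calc _ ≤ peak m s p z ^ 2 * (∑ j, ‖dbar F z j‖ ^ 2) * 1 :=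
            mul_le_mul_of_nonneg_left he (mul_nonneg hp2 hS)
        _ ≤ _ := by rw [mul_one, mul_comm B]; exact mul_le_mul_of_nonneg_left (hB z) hp2
    · have : ∑ j, ‖dbar F z j‖ ^ 2 = 0 := Finset.sum_eq_zero fun j _ => by
        have := (hF.dbar (l := 0) (by norm_num) j).eq_zero hz
        rw [this]; simp
      rw [this, mul_zero, zero_mul]
      positivity
  have h2 := integral_mono_of_nonneg (Filter.Eventually.of_forall fun z =>
    mul_nonneg (mul_nonneg (sq_nonneg (peak m s p z))
      (Finset.sum_nonneg fun j (_ : j ∈ Finset.univ) => sq_nonneg ‖dbar F z j‖)) (ew_pos W z).le)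
    ((integrable_peak_sq (p := p) hm hs).const_mul B) (Filter.Eventually.of_forall hpt)
  rw [integral_const_mul, integral_peak_sq hs] at h2
  have hm0 : 0 ≤ (bumpMass n)⁻¹ * (r ^ Module.finrank ℝ (Cn n))⁻¹ :=
    (moll_nonneg hr (0 : Cn n)).trans (moll_le hr 0)
  refine h1.trans (mul_le_mul_of_nonneg_left (hX.trans (mul_le_mul_of_nonneg_left h2 ?_)) ?_)
  all_goals positivity

lemma CcOn.exists_bound_sum_dbar {Ω : Set (Cn n)} {F : Cn n → ℂ} (hF : CcOn Ω 1 F) :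
    ∃ B, 0 ≤ B ∧ ∀ z, ∑ j, ‖_root_.dbar F z j‖ ^ 2 ≤ B := by
  have h1 : ∀ j, ∃ C, ∀ z, ‖_root_.dbar F z j‖ ≤ C := fun j =>
    (hF.dbar (l := 0) (by norm_num) j).continuous.bounded_above_of_compact_support
      (hF.dbar (l := 0) (by norm_num) j).compact
  choose C hC using h1
  exact ⟨∑ j, C j ^ 2, Finset.sum_nonneg fun _ _ => sq_nonneg _, fun z =>
    Finset.sum_le_sum fun j _ => pow_le_pow_left₀ (norm_nonneg _) (hC j z) 2⟩

lemma exists_small_scale (n m : ℕ) {δ : ℝ} (hδ : 0 < δ) :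
    ∃ k : ℝ, 0 < k ∧ k ≤ 1 ∧ n * m ^ 2 * k ^ 2 ≤ δ / 8 := by
  set a : ℝ := n * m ^ 2 with ha
  have ha0 : 0 ≤ a := by positivity
  refine ⟨min 1 (δ / 8 / (a + 1)), lt_min one_pos (by positivity), min_le_left _ _, ?_⟩
  set k := min 1 (δ / 8 / (a + 1)) with hk
  have hk0 : 0 ≤ k := le_min one_pos.le (by positivity)
  have h1 : k ^ 2 ≤ k := by
    rw [sq]; exact mul_le_of_le_one_left hk0 (min_le_left _ _)
  have h2 : k * (a + 1) ≤ δ / 8 := (le_div_iff₀ (by positivity)).1 (min_le_right _ _)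
  have h3 := mul_le_mul_of_nonneg_left h1 ha0
  linarith

lemma contDiffOn_conj_coord (Ω : Set (Cn n)) (j : Fin n) :
    ContDiffOn ℝ 1 (fun z : Cn n => conj (z j)) Ω :=
  ((Complex.conjCLE : ℂ →L[ℝ] ℂ).comp
    ((EuclideanSpace.proj j : Cn n →L[ℂ] ℂ).restrictScalars ℝ)).contDiff.contDiffOn

lemma norm_conj_coord_sub_le (z w : Cn n) (j : Fin n) : ‖conj (z j) - conj (w j)‖ ≤ ‖z - w‖ := by
  rw [← map_sub, RCLike.norm_conj]
  exact PiLp.norm_apply_le (z - w) j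

lemma mollify_sub_l2loc {Ω L : Set (Cn n)} {f u : Cn n → ℂ} (hf : Integrable f) (hu : L2loc Ω u)
    (hL : IsCompact L) (hLΩ : L ⊆ Ω) {r : ℝ} (hr : 0 < r) {x : Cn n} (hx : closedBall x r ⊆ L) :
    mollify r (fun z => f z - u z) x = mollify r f x - mollify r u x := by
  have h1 := integrable_mul_moll_sub hf hr x
  have h2 : Integrable (fun t => u t * (moll r (x - t) : ℂ)) := by
    refine (integrable_mul_moll_sub (hu.integrable_indicator hL hLΩ) hr x).congr
      (Filter.Eventually.of_forall fun t => ?_)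
    by_cases ht : t ∈ L
    · simp [ht]
    · have h3 : t ∉ closedBall x r := fun h => ht (hx h)
      rw [mem_closedBall', not_le, dist_eq_norm] at h3
      simp [moll_eq_zero hr h3.le]
  simp only [mollify, sub_mul]
  exact integral_sub h1 h2

/-- Quantitative holomorphic approximation of the conjugate coordinates on compact subsets of the
zero set. -/
lemma exists_holomorphic_rate {Ω : Set (Cn n)} (hΩ : IsOpen Ω) (hpsc : Pseudoconvex Ω)
    {φ : Cn n → ℝ} (hφ : ContDiffOn ℝ 2 φ Ω) (hφ0 : ∀ z ∈ Ω, 0 ≤ φ z) {δ : ℝ} (hδ : 0 < δ)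
    (hL : ∀ z ∈ Ω, ∀ w : Cn n, δ * ‖w‖ ^ 2 ≤ LeviForm φ z w) {K : Set (Cn n)} (hK : IsCompact K)
    (hKφ : ∀ p ∈ K, p ∈ Ω ∧ φ p = 0) (j : Fin n) :
    ∃ D T₀ : ℝ, ∀ T, T₀ ≤ T → 0 < T → ∃ H : Cn n → ℂ, DifferentiableOn ℂ H Ω ∧
      ∀ p ∈ K, ‖H p - conj (p j)‖ ≤ D / T := by
  obtain ⟨ρ, hρ, hρc, hρL⟩ := hpsc
  have hat : ∀ {f : Cn n → ℝ}, ContDiffOn ℝ 2 f Ω → ∀ z ∈ Ω, ContDiffAt ℝ 2 f z :=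
    fun h z hz => h.contDiffAt (hΩ.mem_nhds hz)
  have hRc : ∀ c : ℝ, IsCompact {z ∈ Ω | ρ z + φ z ≤ c} := fun c => by
    have hcont : ContinuousOn (fun z => ρ z + φ z) {z ∈ Ω | ρ z ≤ c} :=
      (hρ.continuousOn.add hφ.continuousOn).mono fun z hz => hz.1
    have h := hcont.preimage_isClosed_of_isClosed (hρc c).isClosed (isClosed_Iic (a := c))
    refine (hρc c).of_isClosed_subset (t := {z ∈ Ω | ρ z + φ z ≤ c}) ?_ fun z hz => ⟨hz.1, ?_⟩
    · convert h using 1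
      ext z
      constructor
      · exact fun hz => ⟨⟨hz.1, by have := hφ0 z hz.1; linarith [hz.2]⟩, hz.2⟩
      · exact fun hz => ⟨hz.1.1, hz.2⟩
    · have := hφ0 z hz.1; linarith [hz.2]
  obtain ⟨Ψ, μ, χ, M, hΨ, hΨ0, hμ, hμ0, hΨL, hχc, hχd, hχ01, hM0, hM, hMl, hχ1, hχ0⟩ :=
    exists_weight_cutoffs hΩ (hρ.add hφ) hRc hδ fun z hz w => by
      rw [levi_add (hat hρ z hz) (hat hφ z hz)]
      have := hρL z hz w
      have := hL z hz w
      linarith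
  obtain ⟨r₀, hr₀, hr₀Ω⟩ := hK.exists_cthickening_subset_open hΩ fun p hp => (hKφ p hp).1
  set L := cthickening r₀ K with hLdef
  have hLc : IsCompact L := hK.cthickening
  have hball : ∀ p ∈ K, closedBall p r₀ ⊆ L := fun p hp => closedBall_subset_cthickening hp r₀
  obtain ⟨N, hN⟩ := hχ1 L hLc hr₀Ω
  set F : Cn n → ℂ := fun z => conj (z j) * (χ N z : ℂ) with hFdef
  have hF : CcOn Ω 1 F := CcOn.mul_left hΩ (contDiffOn_conj_coord Ω j) ((hχc N).mono (by norm_num))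
  have hFL : ∀ z ∈ L, F z = conj (z j) := fun z hz => by
    simp only [hFdef, (hN N le_rfl z hz).eq_of_nhds, ofReal_one, mul_one]
  obtain ⟨B, hB0, hB⟩ := hF.exists_bound_sum_dbar
  obtain ⟨C, hC0, hC⟩ := exists_quadratic_bound hΩ hφ hφ0 hLc hr₀Ω hKφ
  obtain ⟨A, hA⟩ := hLc.exists_bound_of_continuousOn (hΨ.continuousOn.mono hr₀Ω)
  set d := Module.finrank ℝ (Cn n) with hd
  set m := d + 1 with hm
  obtain ⟨k, hk0, hk1, hkδ⟩ := exists_small_scale n m hδ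
  set D : ℝ := (bumpMass n)⁻¹ * Real.exp (C + A) * 4 ^ m *
    (6 / δ * (B * ((k ^ d)⁻¹ * ∫ z : Cn n, peak m 1 0 z ^ 2))) with hD
  have hD0 : 0 ≤ D := by
    have := (bumpMass_pos (n := n)).le
    have : 0 ≤ ∫ z : Cn n, peak m 1 0 z ^ 2 := integral_nonneg fun z => sq_nonneg _
    positivity
  refine ⟨1 + (D + 1), 2 / r₀, fun T hT hT0 => ?_⟩
  have h2T : 2 * (1 / T) ≤ r₀ := by
    rw [div_le_iff₀ hr₀] at hT
    rw [mul_one_div, div_le_iff₀ hT0]; linarith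
  have hr : 0 < 1 / T := by positivity
  have hc : 0 < T ^ 2 * δ := by positivity
  have hTφ : ContDiffOn ℝ 2 (fun z => T ^ 2 * φ z) Ω := contDiffOn_const.mul hφ
  have hW : ContDiffOn ℝ 2 (fun z => T ^ 2 * φ z + Ψ z) Ω := hTφ.add hΨ
  have hW0 : ∀ z ∈ Ω, 0 ≤ T ^ 2 * φ z + Ψ z := fun z hz =>
    add_nonneg (mul_nonneg (sq_nonneg T) (hφ0 z hz)) (hΨ0 z hz)
  obtain ⟨X, H, hH, hHm, hX⟩ := exists_holomorphic_correction hΩ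
    (lam := fun z => T ^ 2 * δ + μ z) hW (continuousOn_const.add hμ)
    (fun z hz w => by
      rw [levi_add (hat hTφ z hz) (hat hΨ z hz), levi_const_mul (hat hφ z hz)]
      have h1 := hΨL z hz w
      have h2 := mul_le_mul_of_nonneg_left (hL z hz w) (sq_nonneg T)
      linarith) hc
    (fun z hz => by linarith [hμ0 z hz]) hχc hχd hχ01 hM0 hM
    (fun N z hz => by linarith [hMl N z hz]) hχ1 hχ0 hF
  refine ⟨H, hH, fun p hp => ?_⟩
  have hpr : closedBall p (1 / T) ⊆ L :=
    (closedBall_subset_closedBall (by linarith)).trans (hball p hp)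
  have hp2 : closedBall p (2 * (1 / T)) ⊆ Ω :=
    ((closedBall_subset_closedBall h2T).trans (hball p hp)).trans hr₀Ω
  have hpp : p ∈ L := hpr (mem_closedBall_self hr.le)
  have hWA : ∀ z ∈ closedBall p (1 / T), T ^ 2 * φ z + Ψ z ≤ C + A := fun z hz => by
    have hzp : ‖z - p‖ ≤ 1 / T := by rwa [mem_closedBall, dist_eq_norm] at hz
    have h1 := hC p hp z ((closedBall_subset_closedBall hzp).trans hpr)
    have h2 := (le_abs_self _).trans (hA z (hpr hz))
    have h3 : T * ‖z - p‖ ≤ 1 := by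
      rw [le_div_iff₀ hT0] at hzp; linarith
    have h4 : (T * ‖z - p‖) ^ 2 ≤ 1 := pow_le_one₀ (by positivity) h3
    have h5 := mul_le_mul_of_nonneg_left h1 (sq_nonneg T)
    have h6 := mul_le_mul_of_nonneg_left h4 hC0
    have h7 : T ^ 2 * (C * ‖z - p‖ ^ 2) = C * (T * ‖z - p‖) ^ 2 := by ring
    linarith
  have hs : 0 < k * T := by positivity
  have key := norm_correction_sq_le hΩ hW.continuousOn hW0 X hB0 hB hF (p := p) (m := m)
    (r := 1 / T) (s := k * T) (A := C + A) (c := T ^ 2 * δ) (by omega) hr hs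
    (by rw [mul_one_div, mul_div_assoc, div_self hT0.ne', mul_one]; exact hk1) hc
    (hpr.trans hr₀Ω) hWA
    (hX _ contDiff_peak.contDiffOn
      (fun z _ => by rw [abs_of_pos (peak_pos z)]; exact peak_le_one z)
      fun z _ => (gradSq_peak_le hs.le z).trans
        (mul_le_mul_of_nonneg_right (by
          have := mul_le_mul_of_nonneg_right hkδ (sq_nonneg T)
          calc _ = n * m ^ 2 * k ^ 2 * T ^ 2 := by ring
            _ ≤ _ := this
            _ = _ := by ring) (sq_nonneg _)))
  have hDe : (bumpMass n)⁻¹ * ((1 / T) ^ d)⁻¹ * Real.exp (C + A) * 4 ^ m *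
      (6 / (T ^ 2 * δ) * (B * (((k * T) ^ d)⁻¹ * ∫ z : Cn n, peak m 1 0 z ^ 2))) = D / T ^ 2 := by
    have hTd : T ^ d ≠ 0 := pow_ne_zero _ hT0.ne'
    rw [hD, one_div, inv_pow, inv_inv, mul_pow, mul_inv]
    field_simp
  rw [hDe] at key
  have hu : ‖mollify (1 / T) (scalarPart (fun z => T ^ 2 * φ z + Ψ z) X) p‖ ≤ (D + 1) / T := by
    refine le_of_sq_le_sq (key.trans ?_) (by positivity)
    rw [div_pow]
    refine div_le_div_of_nonneg_right ?_ (sq_nonneg T)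
    have := sq_nonneg D
    linarith
  have hm1 : ‖mollify (1 / T) F p - F p‖ ≤ 1 / T := by
    refine norm_mollify_sub_le hr hF.integrable fun x hx => ?_
    have hxL : x ∈ L := hpr (by rwa [mem_closedBall', dist_eq_norm])
    rw [hFL x hxL, hFL p hpp]
    refine (norm_conj_coord_sub_le x p j).trans ?_
    rwa [norm_sub_rev]
  have hsub := mollify_sub_l2loc hF.integrable
    (l2loc_scalarPart hW.continuousOn (Lp.memLp X)) hLc hr₀Ω hr hpr
  rw [hHm p _ hr hp2, hsub, ← hFL p hpp, sub_right_comm]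
  refine (norm_sub_le _ _).trans ?_
  rw [add_div]
  exact add_le_add hm1 hu

/-- The algebra of restrictions to `K` of functions holomorphic in `Ω`. -/
def holoRestrict (Ω K : Set (Cn n)) : Subalgebra ℂ C(K, ℂ) where
  carrier := {f | ∃ h : Cn n → ℂ, DifferentiableOn ℂ h Ω ∧ ∀ z : K, f z = h z}
  mul_mem' := by
    rintro f g ⟨a, ha, hf⟩ ⟨b, hb, hg⟩
    exact ⟨fun z => a z * b z, ha.mul hb, fun z => by simp [hf, hg]⟩
  add_mem' := by
    rintro f g ⟨a, ha, hf⟩ ⟨b, hb, hg⟩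
    exact ⟨fun z => a z + b z, ha.add hb, fun z => by simp [hf, hg]⟩
  algebraMap_mem' c := ⟨fun _ => c, differentiableOn_const c, fun z => by simp⟩

/-- The coordinate functions on `K`. -/
def coordMap (K : Set (Cn n)) (j : Fin n) : C(K, ℂ) :=
  ⟨fun z => (z : Cn n) j, by fun_prop⟩

lemma topologicalClosure_holoRestrict_eq_top {Ω K : Set (Cn n)} [CompactSpace K]
    (hc : ∀ j, star (coordMap K j) ∈ (holoRestrict Ω K).topologicalClosure) :
    (holoRestrict Ω K).topologicalClosure = ⊤ := by
  have hcoord : ∀ j, coordMap K j ∈ (holoRestrict Ω K).topologicalClosure := fun j =>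
    (holoRestrict Ω K).le_topologicalClosure ⟨fun z => z j,
      (EuclideanSpace.proj j : Cn n →L[ℂ] ℂ).differentiable.differentiableOn, fun _ => rfl⟩
  set S := StarAlgebra.adjoin ℂ (Set.range (coordMap K)) with hS
  have hsep : S.SeparatesPoints := by
    intro x y hxy
    have : ∃ j, (x : Cn n) j ≠ (y : Cn n) j := by
      by_contra! h
      exact hxy (Subtype.ext (PiLp.ext h))
    obtain ⟨j, hj⟩ := this
    exact ⟨coordMap K j, ⟨coordMap K j, StarAlgebra.subset_adjoin ℂ _ ⟨j, rfl⟩, rfl⟩, hj⟩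
  have htop := ContinuousMap.starSubalgebra_topologicalClosure_eq_top_of_separatesPoints S hsep
  have hle : S.toSubalgebra ≤ (holoRestrict Ω K).topologicalClosure := by
    rw [hS, StarAlgebra.adjoin_toSubalgebra]
    refine Algebra.adjoin_le ?_
    rintro f (⟨j, rfl⟩ | hf)
    · exact hcoord j
    · obtain ⟨j, hj⟩ := hf
      have : f = star (coordMap K j) := by rw [hj, star_star]
      exact this ▸ hc j
  refine top_le_iff.1 fun f _ => ?_
  have hf : f ∈ S.topologicalClosure := by rw [htop]; trivial
  exact closure_minimal hle (holoRestrict Ω K).isClosed_topologicalClosure hf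

/-- Every continuous function on the totally real set `E = {φ = 0}` can be approximated
uniformly on compact subsets of `E` by functions holomorphic in `Ω`. -/
theorem continuous_approx_by_holomorphic_on_totally_real_set
    (Ω : Set (Cn n)) (hΩ : IsOpen Ω) (hpsc : Pseudoconvex Ω)
    (φ : Cn n → ℝ) (hφC2 : ContDiffOn ℝ 2 φ Ω)
    (hφ0 : ∀ z ∈ Ω, 0 ≤ φ z)
    (hpsh : ∀ z ∈ Ω, ∀ w : Cn n, 0 ≤ LeviForm φ z w)
    (δ : ℝ) (hδ : 0 < δ)
    (hLevi : ∀ z ∈ Ω, ∀ w : Cn n, δ * ‖w‖ ^ 2 ≤ LeviForm φ z w)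
    (E : Set (Cn n)) (hE : E = {z ∈ Ω | φ z = 0}) :
    ∀ g : Cn n → ℂ, ContinuousOn g E →
      ∀ K : Set (Cn n), IsCompact K → K ⊆ E →
        ∀ ε : ℝ, 0 < ε →
          ∃ h : Cn n → ℂ, DifferentiableOn ℂ h Ω ∧ ∀ z ∈ K, ‖g z - h z‖ < ε := by
  intro g hg K hK hKE ε hε
  have hKφ : ∀ p ∈ K, p ∈ Ω ∧ φ p = 0 := fun p hp => by
    have := hKE hp
    rwa [hE] at this
  have : CompactSpace K := isCompact_iff_compactSpace.1 hK
  have hc : ∀ j, star (coordMap K j) ∈ (holoRestrict Ω K).topologicalClosure := fun j => by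
    obtain ⟨D, T₀, h⟩ := exists_holomorphic_rate hΩ hpsc hφC2 hφ0 hδ hLevi hK hKφ j
    refine Metric.mem_closure_iff.2 fun η hη => ?_
    set T := max (max T₀ 1) (2 * |D| / η) with hT
    have hT0 : 0 < T := one_pos.trans_le ((le_max_right _ _).trans (le_max_left _ _))
    obtain ⟨H, hH, hHK⟩ := h T ((le_max_left _ _).trans (le_max_left _ _)) hT0
    have hDT : D / T ≤ η / 2 := by
      have h1 : 2 * |D| / η ≤ T := le_max_right _ _
      rw [div_le_iff₀ hη] at h1
      rw [div_le_iff₀ hT0]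
      linarith [le_abs_self D]
    refine ⟨⟨fun z : K => H z, ?_⟩, ⟨H, hH, fun z => rfl⟩, ?_⟩
    · exact (hH.continuousOn.mono fun p hp => (hKφ p hp).1).domRestrict
    · refine lt_of_le_of_lt ((ContinuousMap.dist_le (by positivity)).2 fun z => ?_) (half_lt_self hη)
      rw [dist_comm, dist_eq_norm]
      exact (hHK z z.2).trans hDT
  have htop := topologicalClosure_holoRestrict_eq_top hc
  have hmem : (⟨fun z : K => g z, (hg.mono hKE).domRestrict⟩ : C(K, ℂ))
      ∈ (holoRestrict Ω K).topologicalClosure := by rw [htop]; trivial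
  obtain ⟨f, ⟨h, hh, hfh⟩, hf⟩ := Metric.mem_closure_iff.1 hmem ε hε
  refine ⟨h, hh, fun z hz => ?_⟩
  have h1 := (ContinuousMap.dist_apply_le_dist (⟨z, hz⟩ : K)).trans_lt hf
  rw [dist_eq_norm, hfh] at h1
  exact h1
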